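/- arXiv:1708.02639 — 7 statements merged into one kernel-verified Lean document; each statement's English description precedes it below -/
import Mathlib

section
/- For every real c with 1/100 < c < 2/3 and every real γ with 3c/2 < γ² < 1, there exist constants C₀, C₁ > 0 depending only on γ such that the following holds. Let A and X be finite sets of size larger than 1, let n = log₂|X|, and let M : A × X → {-1,1} be a (k',ℓ')-L₂-extractor with error 2^{-r'}, where k' ≥ C₀, ℓ' ≥ C₀, r' ≥ C₀ and ℓ' ≤ n. Let r = min{ r'/2, (1−γ)·k'/2, (1−γ)·ℓ'/2 − 1 }. Then for every branching program of length at most 2^r and width at most 2^{c·k'·ℓ'} for the learning problem corresponding to M in which each leaf v is labeled by a hypothesis h_v : A → {-1,1}, one has E[ |⟨h_v, M^{(x)}⟩| ] ≤ C₁·2^{-r/2}, where v is the leaf reached by the computation path, M^{(x)} : A → {-1,1} denotes the x-th column of M (M^{(x)}(a) = M(a,x)), ⟨h, M^{(x)}⟩ = E_{a∈A}[h(a)·M(a,x)], and the expectation is over the uniformly random x ∈ X and the i.i.d. uniform samples a₁,…,a_m ∈ A with b_t = M(a_t,x). -/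
open Finset

attribute [local instance] Classical.propDecidable

/-- Expectation with respect to the uniform distribution on a finite set. -/
noncomputable def expE {X : Type*} [Fintype X] (f : X → ℝ) : ℝ :=
  (∑ x, f x) / (Fintype.card X)

/-- Inner product with respect to the uniform distribution. -/
noncomputable def nInner {X : Type*} [Fintype X] (f g : X → ℝ) : ℝ :=
  expE (fun x => f x * g x)

/-- Normalized ℓ₁-norm. -/
noncomputable def nNorm1 {X : Type*} [Fintype X] (f : X → ℝ) : ℝ :=
  expE (fun x => |f x|)

/-- Normalized ℓ₂-norm. -/
noncomputable def nNorm2 {X : Type*} [Fintype X] (f : X → ℝ) : ℝ :=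
  Real.sqrt (expE (fun x => (f x) ^ 2))

/-- `M` is a `(k,ℓ)`-L₂-extractor with error `2^{-r}`. -/
def IsL2Extractor {A X : Type*} [Fintype A] [Fintype X]
    (M : A → X → ℝ) (k ℓ r : ℝ) : Prop :=
  ∀ f : X → ℝ, (∀ x, 0 ≤ f x) → f ≠ 0 →
    nNorm2 f ≤ (2 : ℝ) ^ ℓ * nNorm1 f →
    ((Finset.univ.filter
        (fun a : A => (2 : ℝ) ^ (-r) * nNorm1 f ≤ |nInner (M a) f|)).card : ℝ)
      ≤ (2 : ℝ) ^ (-k) * (Fintype.card A)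

set_option linter.unusedSectionVars false
/-- A branching program of length `m` and width `d` for a learning problem, with
sample set `A` and output (leaf-label) type `O`.  Vertices are arranged in `m+1`
layers with (at most) `d` vertices each; `start` is the single start vertex of
layer `0`; `isLeaf t v` says that vertex `v` of layer `t` is a leaf; every
non-leaf vertex has `2|A|` outgoing edges into the next layer, labeled by the
pairs `(a,b) ∈ A × {-1,1}` (a bit `true` encodes `b = 1`), given by `next`;
every vertex of the last layer is a leaf, and every leaf `v` of layer `t`
carries a label `label t v`. -/
structure BranchingProgram (A : Type*) (O : Type*) (m d : ℕ) where
  start : Fin d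
  isLeaf : ℕ → Fin d → Bool
  next : ℕ → Fin d → A → Bool → Fin d
  label : ℕ → Fin d → O
  last_leaf : ∀ v : Fin d, isLeaf m v = true

namespace BranchingProgram

variable {A X O : Type*} [Fintype A] [Fintype X] {m d : ℕ}

/-- The vertex reached by the computation path after `t` steps, on the unknown
element `x` and the stream of samples `a`, where the `t`-th sample is
`(a t, M (a t) x)`.  Once a leaf is reached the path stays put. -/
noncomputable def state (B : BranchingProgram A O m d) (M : A → X → ℝ)
    (x : X) (a : Fin m → A) (t : ℕ) : Fin d :=
  Nat.rec B.start
    (fun t v =>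
      if B.isLeaf t v then v
      else if h : t < m then
        B.next t v (a ⟨t, h⟩) (if M (a ⟨t, h⟩) x = 1 then true else false)
      else v) t

theorem exists_leaf (B : BranchingProgram A O m d) (M : A → X → ℝ)
    (x : X) (a : Fin m → A) : ∃ t, B.isLeaf t (B.state M x a t) = true :=
  ⟨m, B.last_leaf _⟩

/-- The first time at which the computation path is at a leaf. -/
noncomputable def stopTime (B : BranchingProgram A O m d) (M : A → X → ℝ)
    (x : X) (a : Fin m → A) : ℕ :=
  Nat.find (B.exists_leaf M x a)

/-- The output of the branching program: the label of the (first) leaf reached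
by the computation path. -/
noncomputable def output (B : BranchingProgram A O m d) (M : A → X → ℝ)
    (x : X) (a : Fin m → A) : O :=
  B.label (B.stopTime M x a) (B.state M x a (B.stopTime M x a))

/-- The success probability of a branching program whose leaves are labeled by
elements of `X`: the probability, over a uniform `x ∈ X` and i.i.d. uniform
samples `a₁, …, a_m ∈ A`, that the output equals `x`. -/
noncomputable def successProb (B : BranchingProgram A X m d) (M : A → X → ℝ) : ℝ :=
  ((Finset.univ.filter
      (fun p : X × (Fin m → A) => B.output M p.1 p.2 = p.1)).card : ℝ) /
    ((Fintype.card X : ℝ) * (Fintype.card A : ℝ) ^ m)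

end BranchingProgram

/-- The expected correlation `E[|⟨h_v, M^{(x)}⟩|]` achieved by a branching
program whose leaves are labeled by hypotheses `h : A → ℝ`: the expectation,
over a uniform `x ∈ X` and i.i.d. uniform samples `a₁, …, a_m ∈ A`, of the
absolute correlation of the hypothesis output by the program with the `x`-th
column of `M`. -/
noncomputable def BranchingProgram.hypValue {A X : Type*} [Fintype A] [Fintype X]
    {m d : ℕ} (B : BranchingProgram A (A → ℝ) m d) (M : A → X → ℝ) : ℝ :=
  (∑ p : X × (Fin m → A), |nInner (B.output M p.1 p.2) (fun a => M a p.1)|) /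
    ((Fintype.card X : ℝ) * (Fintype.card A : ℝ) ^ m)

namespace WeakLearning

section Expectation

variable {X : Type*} [Fintype X]

theorem expE_nonneg {f : X → ℝ} (hf : ∀ x, 0 ≤ f x) : 0 ≤ expE f :=
  div_nonneg (sum_nonneg fun x _ => hf x) (Nat.cast_nonneg _)

theorem expE_mono {f g : X → ℝ} (h : ∀ x, f x ≤ g x) : expE f ≤ expE g :=
  div_le_div_of_nonneg_right (sum_le_sum fun x _ => h x) (Nat.cast_nonneg _)

theorem expE_add (f g : X → ℝ) : expE (fun x => f x + g x) = expE f + expE g := by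
  simp only [expE, sum_add_distrib, add_div]

theorem expE_sub (f g : X → ℝ) : expE (fun x => f x - g x) = expE f - expE g := by
  simp only [expE, sum_sub_distrib, sub_div]

theorem expE_mul_left (c : ℝ) (f : X → ℝ) : expE (fun x => c * f x) = c * expE f := by
  simp only [expE, ← mul_sum, mul_div_assoc]

theorem expE_sum {ι : Type*} (s : Finset ι) (F : ι → X → ℝ) :
    expE (fun x => ∑ i ∈ s, F i x) = ∑ i ∈ s, expE (F i) := by
  simp only [expE, ← sum_div]
  rw [sum_comm]

theorem expE_const [Nonempty X] (c : ℝ) : expE (fun _ : X => c) = c := by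
  have : (Fintype.card X : ℝ) ≠ 0 := Nat.cast_ne_zero.mpr Fintype.card_ne_zero
  simp [expE, this]

theorem expE_zero : expE (fun _ : X => (0 : ℝ)) = 0 := by
  simp [expE]

theorem abs_expE_le (f : X → ℝ) : |expE f| ≤ expE fun x => |f x| := by
  rw [expE, expE, abs_div, Nat.abs_cast]
  exact div_le_div_of_nonneg_right (abs_sum_le_sum_abs _ _) (Nat.cast_nonneg _)

theorem eq_zero_of_expE_eq_zero {f : X → ℝ} (hf : ∀ x, 0 ≤ f x) (h : expE f = 0) (x : X) :
    f x = 0 := by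
  have hX : (Fintype.card X : ℝ) ≠ 0 := Nat.cast_ne_zero.mpr (Fintype.card_pos_iff.mpr ⟨x⟩).ne'
  have h0 : ∑ x, f x = 0 := by
    rcases div_eq_zero_iff.mp h with h | h
    · exact h
    · exact absurd h hX
  exact (sum_eq_zero_iff_of_nonneg fun x _ => hf x).mp h0 x (mem_univ x)

theorem nNorm1_of_nonneg {f : X → ℝ} (hf : ∀ x, 0 ≤ f x) : nNorm1 f = expE f := by
  simp only [nNorm1, abs_of_nonneg (hf _)]

theorem abs_nInner_le {u f : X → ℝ} (hu : ∀ x, u x = 1 ∨ u x = -1) (hf : ∀ x, 0 ≤ f x) :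
    |nInner u f| ≤ expE f := by
  refine (abs_expE_le _).trans (expE_mono fun x => ?_)
  rcases hu x with h | h <;> simp [h, abs_of_nonneg (hf x)]

end Expectation

section Extractor

variable {A X : Type*} [Fintype A] [Fintype X] {M : A → X → ℝ} {K L R : ℝ}

theorem card_biased_le (hM : IsL2Extractor M K L R) {f : X → ℝ} (hf : ∀ x, 0 ≤ f x)
    (hf0 : f ≠ 0) (hsq : expE (fun x => f x ^ 2) ≤ ((2 : ℝ) ^ L) ^ 2 * expE f ^ 2) :
    ((univ.filter fun a => (2 : ℝ) ^ (-R) * expE f ≤ |nInner (M a) f|).card : ℝ)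
      ≤ (2 : ℝ) ^ (-K) * Fintype.card A := by
  have h1 := nNorm1_of_nonneg hf
  rw [← h1]
  refine hM f hf hf0 ?_
  rw [h1, nNorm2]
  apply Real.sqrt_le_iff.mpr
  have := expE_nonneg hf
  exact ⟨by positivity, by rw [mul_pow]; exact hsq⟩

/-- The rows of `M` that have correlation at least `β` with some member of the family `f`. -/
noncomputable def biasedRows {ι : Type*} (M : A → X → ℝ) (β : ℝ) (f : ι → X → ℝ) : Finset A :=
  univ.filter fun a => ∃ i, β ≤ |nInner (M a) (f i)|

theorem mem_biasedRows {ι : Type*} {β : ℝ} {f : ι → X → ℝ} {a : A} :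
    a ∈ biasedRows M β f ↔ ∃ i, β ≤ |nInner (M a) (f i)| := by
  simp [biasedRows]

/-- Functions which are biased on many rows can be superposed into one function that is slightly
biased on at least half of the union of the rows. -/
theorem card_union_biased_le [Nonempty X] (hM : IsL2Extractor M K L R) {ι : Type*} [Fintype ι]
    {f : ι → X → ℝ} {Λ η β N : ℝ} (hf : ∀ i x, 0 ≤ f i x) (hf1 : ∀ i, expE (f i) = 1)
    (hsq : ∀ i, expE (fun x => f i x ^ 2) ≤ Λ) (hη : 0 < η) (hη1 : η ≤ 1)
    (hΛ : 1 + η ^ 2 * Λ ≤ ((2 : ℝ) ^ L) ^ 2) (hΛ0 : 0 ≤ Λ) (hN : (Fintype.card ι : ℝ) ≤ N)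
    (hN0 : 0 < N) (hβ : 4 * (2 : ℝ) ^ (-R) * N ≤ η * β) :
    ((biasedRows M β f).card : ℝ)
      ≤ 2 * ((2 : ℝ) ^ (-K) * Fintype.card A) := by
  set F : Finset ι → X → ℝ := fun ω x => 1 + η / N * ∑ i ∈ ω, f i x with hF
  have hηN : 0 < η / N := div_pos hη hN0
  have hsum0 : ∀ (ω : Finset ι) x, 0 ≤ ∑ i ∈ ω, f i x := fun ω x => sum_nonneg fun i _ => hf i x
  have hcardω : ∀ ω : Finset ι, (ω.card : ℝ) ≤ N := fun ω =>
    le_trans (by exact_mod_cast card_le_univ ω) hN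
  have hF0 : ∀ ω x, 0 ≤ F ω x := fun ω x => by
    have := hsum0 ω x
    simp only [hF]; positivity
  have hFne : ∀ ω, F ω ≠ 0 := fun ω h => by
    obtain ⟨x⟩ := ‹Nonempty X›
    have h1 := congrFun h x
    have := mul_nonneg hηN.le (hsum0 ω x)
    simp only [hF, Pi.zero_apply] at h1
    linarith
  have hEF : ∀ ω, expE (F ω) = 1 + η / N * ω.card := fun ω => by
    simp only [hF]
    rw [expE_add, expE_const, expE_mul_left, expE_sum]
    simp [hf1]
  have hEF2 : ∀ ω, expE (F ω) ≤ 2 := fun ω => by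
    rw [hEF]
    have : η / N * ω.card ≤ 1 := by
      rw [div_mul_eq_mul_div, div_le_one hN0]
      nlinarith [hcardω ω, (Nat.cast_nonneg ω.card : (0 : ℝ) ≤ _)]
    linarith
  have hFsq : ∀ ω, expE (fun x => F ω x ^ 2) ≤ ((2 : ℝ) ^ L) ^ 2 * expE (F ω) ^ 2 := fun ω => by
    have e1 : expE (fun x => F ω x ^ 2)
        = 1 + 2 * (η / N) * ω.card + (η / N) ^ 2 * expE (fun x => (∑ i ∈ ω, f i x) ^ 2) := by
      have : (fun x => F ω x ^ 2) = fun x => (1 + 2 * (η / N) * ∑ i ∈ ω, f i x)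
          + (η / N) ^ 2 * (∑ i ∈ ω, f i x) ^ 2 := by
        funext x; simp only [hF]; ring
      rw [this, expE_add, expE_add, expE_const, expE_mul_left, expE_mul_left, expE_sum]
      simp [hf1]
    have e2 : expE (fun x => (∑ i ∈ ω, f i x) ^ 2) ≤ N * (N * Λ) := by
      calc expE (fun x => (∑ i ∈ ω, f i x) ^ 2)
          ≤ expE (fun x => ω.card * ∑ i ∈ ω, f i x ^ 2) :=
            expE_mono fun x => sq_sum_le_card_mul_sum_sq
        _ = ω.card * ∑ i ∈ ω, expE (fun x => f i x ^ 2) := by rw [expE_mul_left, expE_sum]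
        _ ≤ ω.card * (ω.card * Λ) := by
            refine mul_le_mul_of_nonneg_left ?_ (Nat.cast_nonneg _)
            calc ∑ i ∈ ω, expE (fun x => f i x ^ 2) ≤ ∑ i ∈ ω, Λ := sum_le_sum fun i _ => hsq i
              _ = _ := by simp
        _ ≤ N * (N * Λ) := by
            have := hcardω ω
            gcongr
    have e3 : (η / N) ^ 2 * expE (fun x => (∑ i ∈ ω, f i x) ^ 2) ≤ η ^ 2 * Λ := by
      calc _ ≤ (η / N) ^ 2 * (N * (N * Λ)) := by gcongr
        _ = _ := by field_simp
    rw [e1, hEF]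
    set c := η / N * ω.card with hc
    have hc0 : 0 ≤ c := by positivity
    have hP : 1 ≤ ((2 : ℝ) ^ L) ^ 2 := by nlinarith [mul_nonneg (sq_nonneg η) hΛ0]
    have : 2 * (η / N) * ω.card = 2 * c := by rw [hc]; ring
    rw [this]
    nlinarith [mul_nonneg hc0 (sub_nonneg.mpr hP),
      mul_nonneg (sq_nonneg c) (zero_le_one.trans hP)]
  set U := biasedRows M β f with hU
  set bad : Finset ι → A → Prop := fun ω a => (2 : ℝ) ^ (-R) * expE (F ω) ≤ |nInner (M a) (F ω)|
    with hbad
  have hhalf : ∀ a ∈ U, (Fintype.card (Finset ι) : ℝ)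
      ≤ 2 * ((univ.filter fun ω => bad ω a).card : ℝ) := by
    intro a ha
    obtain ⟨i, hi⟩ := mem_biasedRows.mp ha
    have hin : ∀ ω, nInner (M a) (F ω)
        = expE (M a) + η / N * ∑ i ∈ ω, nInner (M a) (f i) := fun ω => by
      have : (fun x => M a x * F ω x)
          = fun x => M a x + η / N * ∑ i ∈ ω, M a x * f i x := by
        funext x; simp only [hF, ← mul_sum]; ring
      rw [nInner, this, expE_add, expE_mul_left, expE_sum]
      rfl
    have hdiff : ∀ ω, i ∉ ω → ¬ bad ω a → bad (insert i ω) a := by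
      intro ω hω h1
      by_contra h2
      simp only [hbad, not_le] at h1 h2
      have hP : (0 : ℝ) < 2 ^ (-R) := by positivity
      have h3 : |nInner (M a) (F (insert i ω)) - nInner (M a) (F ω)| < 4 * (2 : ℝ) ^ (-R) := by
        refine (abs_sub _ _).trans_lt ?_
        nlinarith [hEF2 ω, hEF2 (insert i ω)]
      rw [hin, hin, sum_insert hω] at h3
      have h4 : expE (M a) + η / N * (nInner (M a) (f i) + ∑ i ∈ ω, nInner (M a) (f i))
          - (expE (M a) + η / N * ∑ i ∈ ω, nInner (M a) (f i)) = η / N * nInner (M a) (f i) := by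
        ring
      rw [h4, abs_mul, abs_of_pos hηN, div_mul_eq_mul_div, div_lt_iff₀ hN0] at h3
      have := mul_le_mul_of_nonneg_left hi hη.le
      linarith
    have hinv : ∀ ω, ¬ bad ω a → bad (if i ∈ ω then ω.erase i else insert i ω) a := by
      intro ω h1
      by_cases hω : i ∈ ω
      · rw [if_pos hω]
        by_contra h2
        have := hdiff (ω.erase i) (notMem_erase i ω) h2
        rw [insert_erase hω] at this
        exact h1 this
      · rw [if_neg hω]
        exact hdiff ω hω h1
    have hle : (univ.filter fun ω => ¬ bad ω a).card ≤ (univ.filter fun ω => bad ω a).card := by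
      refine card_le_card_of_injOn (fun ω => if i ∈ ω then ω.erase i else insert i ω) ?_ ?_
      · intro ω hω
        simp only [coe_filter, mem_univ, true_and, Set.mem_ofPred_eq] at hω ⊢
        exact hinv ω hω
      · have hli : Function.LeftInverse (fun ω : Finset ι => if i ∈ ω then ω.erase i else insert i ω)
            (fun ω => if i ∈ ω then ω.erase i else insert i ω) := by
          intro ω
          by_cases hω : i ∈ ω
          · simp [hω, insert_erase]
          · simp [hω]
        exact hli.injective.injOn
    have hadd := card_filter_add_card_filter_not (s := (univ : Finset (Finset ι)))
      (fun ω => bad ω a)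
    rw [card_univ] at hadd
    have : Fintype.card (Finset ι) ≤ 2 * (univ.filter fun ω => bad ω a).card := by omega
    exact_mod_cast this
  have hcount : ∑ ω : Finset ι, ((univ.filter fun a => bad ω a).card : ℝ)
      = ∑ a, ((univ.filter fun ω => bad ω a).card : ℝ) := by
    have := sum_card_bipartiteAbove_eq_sum_card_bipartiteBelow
      (s := (univ : Finset (Finset ι))) (t := (univ : Finset A)) bad
    simp only [bipartiteAbove, bipartiteBelow] at this
    exact_mod_cast this
  have hup : ∑ ω : Finset ι, ((univ.filter fun a => bad ω a).card : ℝ)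
      ≤ Fintype.card (Finset ι) * ((2 : ℝ) ^ (-K) * Fintype.card A) := by
    calc _ ≤ ∑ ω : Finset ι, ((2 : ℝ) ^ (-K) * Fintype.card A) :=
          sum_le_sum fun ω _ => card_biased_le hM (hF0 ω) (hFne ω) (hFsq ω)
      _ = _ := by simp
  have hlow : (U.card : ℝ) * Fintype.card (Finset ι)
      ≤ 2 * ∑ a, ((univ.filter fun ω => bad ω a).card : ℝ) := by
    calc (U.card : ℝ) * Fintype.card (Finset ι)
        = ∑ a ∈ U, (Fintype.card (Finset ι) : ℝ) := by simp
      _ ≤ ∑ a ∈ U, 2 * ((univ.filter fun ω => bad ω a).card : ℝ) := sum_le_sum hhalf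
      _ ≤ ∑ a, 2 * ((univ.filter fun ω => bad ω a).card : ℝ) :=
          sum_le_sum_of_subset_of_nonneg (subset_univ _) fun _ _ _ => by positivity
      _ = _ := by rw [mul_sum]
  have hpos : (0 : ℝ) < Fintype.card (Finset ι) := Nat.cast_pos.mpr Fintype.card_pos
  rw [← hcount] at hlow
  nlinarith

/-- The rows outside `H` whose correlation with `f` is at least `β` times the mass of `f`. -/
noncomputable def badRows (M : A → X → ℝ) (H : Finset A) (β : ℝ) (f : X → ℝ) : Finset A :=
  univ.filter fun a => a ∉ H ∧ β * expE f ≤ |nInner (M a) f|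

theorem mem_badRows {H : Finset A} {β : ℝ} {f : X → ℝ} {a : A} :
    a ∈ badRows M H β f ↔ a ∉ H ∧ β * expE f ≤ |nInner (M a) f| := by
  simp [badRows]

/-- Outside of `H`, every function whose squared `L₂`-norm is at most `Λ` times its squared mass
is `β`-biased on at most a `κ`-fraction of the rows. -/
def UnbiasedOutside (M : A → X → ℝ) (H : Finset A) (Λ β κ : ℝ) : Prop :=
  ∀ f : X → ℝ, (∀ x, 0 ≤ f x) → 0 < expE f → expE (fun x => f x ^ 2) ≤ Λ * expE f ^ 2 →
    ((badRows M H β f).card : ℝ) ≤ κ * Fintype.card A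

/-- Outside a small fixed set `H` of rows, an extractor has far fewer biased rows than its
parameters promise. -/
theorem exists_exceptional_rows [Nonempty X] [Nonempty A] (hM : IsL2Extractor M K L R)
    {Λ η β : ℝ} {N : ℕ} (hη : 0 < η) (hη1 : η ≤ 1)
    (hΛ : 1 + η ^ 2 * Λ ≤ ((2 : ℝ) ^ L) ^ 2) (hΛ0 : 0 ≤ Λ) (hN0 : 0 < N)
    (hβ : 4 * (2 : ℝ) ^ (-R) * N ≤ η * β) :
    ∃ H : Finset A, (H.card : ℝ) ≤ 2 * (2 : ℝ) ^ (-K) * Fintype.card A ∧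
      UnbiasedOutside M H Λ β (3 * (2 : ℝ) ^ (-K) / N) := by
  by_contra! hcon
  simp only [UnbiasedOutside, not_forall, not_le] at hcon
  have hN0' : (0 : ℝ) < N := Nat.cast_pos.mpr hN0
  have hA : (0 : ℝ) < Fintype.card A := Nat.cast_pos.mpr Fintype.card_pos
  set κ := 3 * (2 : ℝ) ^ (-K) / N * Fintype.card A with hκ
  have key : ∀ n ≤ N, ∃ f : Fin n → X → ℝ, (∀ i x, 0 ≤ f i x) ∧ (∀ i, expE (f i) = 1) ∧
      (∀ i, expE (fun x => f i x ^ 2) ≤ Λ) ∧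
      n * κ ≤ ((biasedRows M β f).card : ℝ) := by
    intro n
    induction n with
    | zero => intro _; exact ⟨Fin.elim0, fun i => i.elim0, fun i => i.elim0, fun i => i.elim0,
        by simp⟩
    | succ n ih =>
      intro hn
      obtain ⟨f, hf, hf1, hfsq, hfc⟩ := ih (by omega)
      set H := biasedRows M β f with hH
      have hHc : (H.card : ℝ) ≤ 2 * ((2 : ℝ) ^ (-K) * Fintype.card A) :=
        card_union_biased_le hM hf hf1 hfsq hη hη1 hΛ hΛ0
          (by rw [Fintype.card_fin]; exact_mod_cast (by omega : n ≤ N)) hN0' hβ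
      obtain ⟨g, hg, hg0, hgsq, hgc⟩ := hcon H (by linarith)
      set g' : X → ℝ := fun x => (expE g)⁻¹ * g x with hg'
      have hin : ∀ a, nInner (M a) g' = (expE g)⁻¹ * nInner (M a) g := fun a => by
        rw [nInner, nInner, ← expE_mul_left]
        congr 1; funext x; simp only [hg']; ring
      obtain ⟨F, hF0, hFs⟩ : ∃ F : Fin (n + 1) → X → ℝ, F 0 = g' ∧ ∀ i : Fin n, F i.succ = f i :=
        ⟨Fin.cons (α := fun _ => X → ℝ) g' f, Fin.cons_zero _ _, fun i => Fin.cons_succ _ _ i⟩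
      refine ⟨F, ?_, ?_, ?_, ?_⟩
      · intro i; refine Fin.cases ?_ ?_ i
        · rw [hF0]; exact fun x => mul_nonneg (inv_nonneg.mpr hg0.le) (hg x)
        · intro i; rw [hFs]; exact hf i
      · intro i; refine Fin.cases ?_ ?_ i
        · rw [hF0, hg', expE_mul_left]; exact inv_mul_cancel₀ hg0.ne'
        · intro i; rw [hFs]; exact hf1 i
      · intro i; refine Fin.cases ?_ ?_ i
        · simp only [hF0, hg', mul_pow, expE_mul_left]
          rw [inv_pow, inv_mul_le_iff₀ (by positivity)]
          linarith
        · intro i; rw [hFs]; exact hfsq i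
      · have hsub : H ∪ badRows M H β g
            ⊆ biasedRows M β F := by
          intro a ha
          rw [mem_biasedRows]
          rcases mem_union.mp ha with ha | ha
          · obtain ⟨i, hi⟩ := mem_biasedRows.mp ha
            exact ⟨i.succ, by rw [hFs]; exact hi⟩
          · refine ⟨0, ?_⟩
            have := (mem_badRows.mp ha).2
            rw [hF0, hin, abs_mul, abs_inv, abs_of_pos hg0, inv_mul_eq_div,
              le_div_iff₀ hg0]
            exact this
        have hdisj : Disjoint H (badRows M H β g) := by
          rw [disjoint_left]
          intro a ha ha'
          exact (mem_badRows.mp ha').1 ha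
        have := card_le_card hsub
        rw [card_union_of_disjoint hdisj] at this
        have : (H.card : ℝ) + ((badRows M H β g).card : ℝ)
            ≤ ((biasedRows M β F).card : ℝ) := by exact_mod_cast this
        push_cast
        linarith
  obtain ⟨f, hf, hf1, hfsq, hfc⟩ := key N le_rfl
  have := card_union_biased_le hM hf hf1 hfsq hη hη1 hΛ hΛ0 (by simp) hN0' hβ
  have h3 : N * κ = 3 * ((2 : ℝ) ^ (-K) * Fintype.card A) := by
    rw [hκ]; field_simp
  have hP : 0 < (2 : ℝ) ^ (-K) * Fintype.card A := by positivity
  linarith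

end Extractor

section Scalar

theorem exp_sub_two_mul_sq_le {x : ℝ} (hx : |x| ≤ 1 / 2) : Real.exp (x - 2 * x ^ 2) ≤ 1 + x := by
  obtain ⟨h1, h2⟩ := abs_le.mp hx
  have hpos : 0 < 1 + x := by linarith
  rw [← Real.le_log_iff_exp_le hpos]
  refine le_trans ?_ (Real.one_sub_inv_le_log_of_pos hpos)
  have : 1 - (1 + x)⁻¹ = x / (1 + x) := by field_simp; ring
  rw [this, le_div_iff₀ hpos]
  nlinarith [mul_nonneg (sq_nonneg x) (by linarith : 0 ≤ 1 + 2 * x)]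

theorem exists_eq_mul_of_abs_le {a b β : ℝ} (hβ : 0 ≤ β) (hb : 0 ≤ b) (h : |a| ≤ β * b) :
    ∃ t, |t| ≤ β ∧ a = t * b := by
  rcases hb.eq_or_lt with rfl | hb
  · exact ⟨0, by simpa using hβ, by simpa using h⟩
  · refine ⟨a / b, ?_, by field_simp⟩
    rwa [abs_div, abs_of_pos hb, div_le_iff₀ hb]

/-- The perspective `I ^ (n + 1) / w ^ n` of the power function, split into two nearly equal
halves: the first order terms cancel. -/
theorem perspective_split_le {n : ℕ} {β w I μ ν G : ℝ} (hβ0 : 0 ≤ β) (hβ : β ≤ 1 / 2) (hw : 0 < w)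
    (hI : 0 ≤ I) (hμ : |μ| ≤ β * w) (hν : |ν| ≤ β * I)
    (hG : Real.cosh (2 * (n + 1) * β) * Real.exp (2 * n * β ^ 2) ≤ G) :
    ((I + ν) / 2) ^ (n + 1) / ((w + μ) / 2) ^ n + ((I - ν) / 2) ^ (n + 1) / ((w - μ) / 2) ^ n
      ≤ G * (I ^ (n + 1) / w ^ n) := by
  obtain ⟨s, hs, rfl⟩ := exists_eq_mul_of_abs_le hβ0 hw.le hμ
  obtain ⟨t, ht, rfl⟩ := exists_eq_mul_of_abs_le hβ0 hI hν
  have side : ∀ s t : ℝ, |s| ≤ β → |t| ≤ β →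
      ((I + t * I) / 2) ^ (n + 1) / ((w + s * w) / 2) ^ n
        ≤ I ^ (n + 1) / w ^ n * (Real.exp ((n + 1) * t - n * s) * Real.exp (2 * n * β ^ 2) / 2) := by
    intro s t hs ht
    have h1 := exp_sub_two_mul_sq_le (hs.trans hβ)
    have h2 : 1 + t ≤ Real.exp t := by linarith [Real.add_one_le_exp t]
    have ht0 : 0 ≤ 1 + t := by linarith [(abs_le.mp ht).1]
    have hs2 : s ^ 2 ≤ β ^ 2 := sq_le_sq' (by linarith [(abs_le.mp hs).1]) (abs_le.mp hs).2
    have h3 : ((I + t * I) / 2) ^ (n + 1) ≤ (I / 2 * Real.exp t) ^ (n + 1) :=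
      pow_le_pow_left₀ (by nlinarith [mul_nonneg ht0 hI]) (by nlinarith) _
    have h4 : (w / 2 * Real.exp (s - 2 * β ^ 2)) ^ n ≤ ((w + s * w) / 2) ^ n := by
      refine pow_le_pow_left₀ (by positivity) ?_ _
      have : Real.exp (s - 2 * β ^ 2) ≤ 1 + s :=
        (Real.exp_le_exp.mpr (by linarith)).trans h1
      nlinarith
    calc _ ≤ (I / 2 * Real.exp t) ^ (n + 1) / (w / 2 * Real.exp (s - 2 * β ^ 2)) ^ n :=
          div_le_div₀ (by positivity) h3 (by positivity) h4
      _ = _ := by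
        rw [mul_pow, mul_pow, div_pow, div_pow, ← Real.exp_nat_mul, ← Real.exp_nat_mul,
          ← Real.exp_add]
        have : Real.exp ((n + 1) * t - n * s + 2 * n * β ^ 2)
            = Real.exp (((n + 1 : ℕ) : ℝ) * t) / Real.exp (n * (s - 2 * β ^ 2)) := by
          rw [← Real.exp_sub]; congr 1; push_cast; ring
        rw [this]
        have := (Real.exp_pos (n * (s - 2 * β ^ 2))).ne'
        field_simp
        ring
  have hp := side s t hs ht
  have hm := side (-s) (-t) (by rwa [abs_neg]) (by rwa [abs_neg])
  have e1 : I + -t * I = I - t * I := by ring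
  have e2 : w + -s * w = w - s * w := by ring
  have e3 : (n + 1) * -t - n * -s = -((n + 1) * t - n * s) := by ring
  rw [e1, e2, e3] at hm
  refine (add_le_add hp hm).trans ?_
  rw [← mul_add]
  have hP : 0 ≤ I ^ (n + 1) / w ^ n := by positivity
  rw [mul_comm G]
  refine mul_le_mul_of_nonneg_left (le_trans ?_ hG) hP
  rw [← add_div, ← add_mul, mul_div_right_comm, ← Real.cosh_eq]
  refine mul_le_mul_of_nonneg_right ?_ (Real.exp_pos _).le
  rw [Real.cosh_le_cosh]
  refine (abs_sub _ _).trans ?_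
  have hn : (0 : ℝ) ≤ n := Nat.cast_nonneg n
  rw [abs_of_nonneg (by positivity : 0 ≤ 2 * ((n : ℝ) + 1) * β), abs_mul, abs_mul,
    abs_of_nonneg hn, abs_of_nonneg (by positivity : (0 : ℝ) ≤ n + 1)]
  nlinarith [mul_le_mul_of_nonneg_left ht (by positivity : (0 : ℝ) ≤ n + 1),
    mul_le_mul_of_nonneg_left hs hn]

theorem perspective_split_le_crude {n : ℕ} {β w I μ ν : ℝ} (hβ : β ≤ 1 / 2) (hw : 0 < w)
    (hμ : |μ| ≤ β * w) (hν : |ν| ≤ I) :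
    ((I + ν) / 2) ^ (n + 1) / ((w + μ) / 2) ^ n + ((I - ν) / 2) ^ (n + 1) / ((w - μ) / 2) ^ n
      ≤ (2 / (1 - β)) ^ n * (I ^ (n + 1) / w ^ n) := by
  obtain ⟨m1, m2⟩ := abs_le.mp hμ
  obtain ⟨v1, v2⟩ := abs_le.mp hν
  have hb : 0 < 1 - β := by linarith
  have hd : 0 < (1 - β) * w / 2 := by positivity
  have hp : ((I + ν) / 2) ^ (n + 1) / ((w + μ) / 2) ^ n
      ≤ ((I + ν) / 2) ^ (n + 1) / ((1 - β) * w / 2) ^ n := by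
    refine div_le_div_of_nonneg_left (pow_nonneg (by linarith) _) (by positivity) ?_
    exact pow_le_pow_left₀ hd.le (by linarith) _
  have hm : ((I - ν) / 2) ^ (n + 1) / ((w - μ) / 2) ^ n
      ≤ ((I - ν) / 2) ^ (n + 1) / ((1 - β) * w / 2) ^ n := by
    refine div_le_div_of_nonneg_left (pow_nonneg (by linarith) _) (by positivity) ?_
    exact pow_le_pow_left₀ hd.le (by linarith) _
  refine (add_le_add hp hm).trans ?_
  rw [← add_div]
  have hs := pow_add_pow_le (n := n + 1) (by linarith : 0 ≤ (I + ν) / 2)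
    (by linarith : 0 ≤ (I - ν) / 2) (Nat.succ_ne_zero n)
  rw [show (I + ν) / 2 + (I - ν) / 2 = I by ring] at hs
  refine (div_le_div_of_nonneg_right hs (by positivity)).trans_eq ?_
  rw [div_pow, mul_pow, div_pow]
  field_simp

/-- Radon's inequality. -/
theorem sum_pow_div_sum_pow_le {ι : Type*} (s : Finset ι) (I w : ι → ℝ) (n : ℕ)
    (hI : ∀ i, 0 ≤ I i) (hw : ∀ i, 0 ≤ w i) (h0 : ∀ i, w i = 0 → I i = 0) :
    (∑ i ∈ s, I i) ^ (n + 1) / (∑ i ∈ s, w i) ^ n ≤ ∑ i ∈ s, I i ^ (n + 1) / w i ^ n := by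
  rcases (sum_nonneg fun i (_ : i ∈ s) => hw i).eq_or_lt with hW | hW
  · have hz := (sum_eq_zero_iff_of_nonneg fun i (_ : i ∈ s) => hw i).mp hW.symm
    rw [sum_eq_zero fun i hi => h0 i (hz i hi)]
    simp only [zero_pow (Nat.succ_ne_zero n), zero_div]
    exact sum_nonneg fun i _ => div_nonneg (pow_nonneg (hI i) _) (pow_nonneg (hw i) _)
  · set W := ∑ i ∈ s, w i with hWdef
    have hj := Real.pow_arith_mean_le_arith_mean_pow s (fun i => w i / W) (fun i => I i / w i)
      (fun i _ => div_nonneg (hw i) hW.le) (by rw [← sum_div, div_self hW.ne'])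
      (fun i _ => div_nonneg (hI i) (hw i)) (n + 1)
    have e1 : ∀ i, w i / W * (I i / w i) = I i / W := fun i => by
      by_cases h : w i = 0
      · simp [h, h0 i h]
      · field_simp
    have e2 : ∀ i, w i / W * (I i / w i) ^ (n + 1) = I i ^ (n + 1) / w i ^ n / W := fun i => by
      by_cases h : w i = 0
      · simp [h, h0 i h]
      · rw [div_pow, pow_succ (w i)]
        field_simp
    simp only [e1, e2] at hj
    rw [← sum_div, ← sum_div, div_pow, pow_succ W, ← div_div] at hj
    exact (div_le_div_iff_of_pos_right hW).mp hj

end Scalar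

section Edge

variable {A X : Type*} [Fintype A] [Fintype X]

/-- The part of `f` on which `f` is at most `T` times its mean. -/
noncomputable def lowPart (T : ℝ) (f : X → ℝ) (x : X) : ℝ :=
  if f x ≤ T * expE f then f x else 0

/-- More than a `q`-fraction of the mass of `f` sits where `f` exceeds `T` times its mean. -/
def IsSignificant (T q : ℝ) (f : X → ℝ) : Prop :=
  expE (lowPart T f) < (1 - q) * expE f

/-- The sign encoded by a bit. -/
noncomputable def bitSign (b : Bool) : ℝ := if b then 1 else -1

/-- The bit encoding the entry `M a x`. -/
noncomputable def bitOf (M : A → X → ℝ) (a : A) (x : X) : Bool :=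
  if M a x = 1 then true else false

/-- The part of the weight `f` of a vertex that is sent along its edge labeled `(a, b)`. -/
noncomputable def edgeWeight (M : A → X → ℝ) (H : Finset A) (T β : ℝ) (f : X → ℝ) (a : A)
    (b : Bool) (x : X) : ℝ :=
  if a ∈ H then lowPart T f x / Fintype.card A
  else if a ∈ badRows M H β (lowPart T f) then 0
  else lowPart T f x * ((1 + bitSign b * M a x) / 2) / Fintype.card A

/-- The perspective of the `(n + 1)`-st power of the mean of `f * ψ` relative to the mean of
`f`. -/
noncomputable def moment (n : ℕ) (ψ f : X → ℝ) : ℝ :=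
  expE (fun x => f x * ψ x) ^ (n + 1) / expE f ^ n

theorem moment_nonneg {n : ℕ} {ψ f : X → ℝ} (hψ : ∀ x, 0 ≤ ψ x) (hf : ∀ x, 0 ≤ f x) :
    0 ≤ moment n ψ f :=
  div_nonneg (pow_nonneg (expE_nonneg fun x => mul_nonneg (hf x) (hψ x)) _)
    (pow_nonneg (expE_nonneg hf) _)

variable {M : A → X → ℝ} {H : Finset A} {T β q κ Λ h ε : ℝ} {f : X → ℝ}

theorem lowPart_nonneg (hf : ∀ x, 0 ≤ f x) (x : X) : 0 ≤ lowPart T f x := by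
  unfold lowPart; split_ifs <;> simp [hf x]

theorem lowPart_le (hf : ∀ x, 0 ≤ f x) (x : X) : lowPart T f x ≤ f x := by
  unfold lowPart; split_ifs <;> simp [hf x]

theorem lowPart_le_mul (hT : 0 ≤ T) (hf : ∀ x, 0 ≤ f x) (x : X) : lowPart T f x ≤ T * expE f := by
  unfold lowPart; split_ifs with h
  · exact h
  · exact mul_nonneg hT (expE_nonneg hf)

theorem expE_lowPart_le (hf : ∀ x, 0 ≤ f x) : expE (lowPart T f) ≤ expE f :=
  expE_mono (lowPart_le hf)

theorem expE_le_two_mul_lowPart (hq : q ≤ 1 / 2) (hf : ∀ x, 0 ≤ f x)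
    (hs : ¬ IsSignificant T q f) : expE f ≤ 2 * expE (lowPart T f) := by
  have h1 := not_lt.mp hs
  have h2 := expE_nonneg hf
  nlinarith

theorem half_one_add_bitSign_mul (hM : ∀ a x, M a x = 1 ∨ M a x = -1) (a : A) (b : Bool) (x : X) :
    (1 + bitSign b * M a x) / 2 = if b = bitOf M a x then 1 else 0 := by
  unfold bitSign bitOf
  rcases hM a x with h | h <;> cases b <;> norm_num [h]

theorem edgeWeight_nonneg (hM : ∀ a x, M a x = 1 ∨ M a x = -1) (hf : ∀ x, 0 ≤ f x) (a : A)
    (b : Bool) (x : X) : 0 ≤ edgeWeight M H T β f a b x := by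
  have h1 := lowPart_nonneg (T := T) hf x
  unfold edgeWeight
  rw [half_one_add_bitSign_mul hM]
  split_ifs <;> positivity

theorem edgeWeight_le (hM : ∀ a x, M a x = 1 ∨ M a x = -1) (hf : ∀ x, 0 ≤ f x) (a : A)
    (b : Bool) (x : X) : edgeWeight M H T β f a b x ≤ lowPart T f x / Fintype.card A := by
  have h1 := lowPart_nonneg (T := T) hf x
  unfold edgeWeight
  rw [half_one_add_bitSign_mul hM]
  split_ifs
  · exact le_rfl
  · positivity
  · rw [mul_one]
  · rw [mul_zero, zero_div]; positivity

theorem edgeWeight_of_good {a : A} (ha : a ∉ H) (hb : a ∉ badRows M H β (lowPart T f)) (b : Bool)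
    (ψ : X → ℝ) :
    expE (fun x => edgeWeight M H T β f a b x * ψ x)
      = (expE (fun x => lowPart T f x * ψ x)
          + bitSign b * nInner (M a) (fun x => lowPart T f x * ψ x)) / 2 / Fintype.card A := by
  have : (fun x => edgeWeight M H T β f a b x * ψ x)
      = fun x => (1 / 2 / Fintype.card A : ℝ) * (lowPart T f x * ψ x
          + bitSign b * (M a x * (lowPart T f x * ψ x))) := by
    funext x
    rw [edgeWeight, if_neg ha, if_neg hb]
    ring
  rw [this, expE_mul_left, expE_add, expE_mul_left, nInner]
  ring

theorem edgeWeight_of_mem {a : A} (ha : a ∈ H) (b : Bool) (ψ : X → ℝ) :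
    expE (fun x => edgeWeight M H T β f a b x * ψ x)
      = expE (fun x => lowPart T f x * ψ x) / Fintype.card A := by
  have : (fun x => edgeWeight M H T β f a b x * ψ x)
      = fun x => (1 / Fintype.card A : ℝ) * (lowPart T f x * ψ x) := by
    funext x
    rw [edgeWeight, if_pos ha]
    ring
  rw [this, expE_mul_left]
  ring

theorem edgeWeight_of_bad {a : A} (hb : a ∈ badRows M H β (lowPart T f)) (b : Bool) (x : X) :
    edgeWeight M H T β f a b x = 0 := by
  rw [edgeWeight, if_neg (mem_badRows.mp hb).1, if_pos hb]

theorem edgeWeight_le_mul_expE [Nonempty A] (hM : ∀ a x, M a x = 1 ∨ M a x = -1)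
    (hT : 0 ≤ T) (hβ : β ≤ 1 / 2) (hq : q ≤ 1 / 2) (hf : ∀ x, 0 ≤ f x)
    (hs : ¬ IsSignificant T q f) (a : A) (b : Bool) (x : X) :
    edgeWeight M H T β f a b x ≤ 8 * T * expE (edgeWeight M H T β f a b) := by
  have hA : (0 : ℝ) < Fintype.card A := Nat.cast_pos.mpr Fintype.card_pos
  have hg := lowPart_le_mul (T := T) hT hf x
  have hw := expE_le_two_mul_lowPart hq hf hs
  have hg0 := expE_nonneg (lowPart_nonneg (T := T) hf)
  by_cases hb : a ∈ badRows M H β (lowPart T f)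
  · rw [edgeWeight_of_bad hb]
    exact mul_nonneg (by positivity) (expE_nonneg fun y => (edgeWeight_of_bad hb b y).ge)
  have hTw := mul_le_mul_of_nonneg_left hw hT
  have key : expE (lowPart T f) / 4 / Fintype.card A ≤ expE (edgeWeight M H T β f a b) := by
    by_cases ha : a ∈ H
    · have := edgeWeight_of_mem (M := M) (T := T) (β := β) (f := f) ha b (fun _ => 1)
      simp only [mul_one] at this
      rw [show edgeWeight M H T β f a b = fun x => edgeWeight M H T β f a b x from rfl, this]
      exact div_le_div_of_nonneg_right (by linarith) hA.le
    · have := edgeWeight_of_good (M := M) (T := T) (β := β) (f := f) ha hb b (fun _ => 1)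
      simp only [mul_one] at this
      rw [show edgeWeight M H T β f a b = fun x => edgeWeight M H T β f a b x from rfl, this]
      refine div_le_div_of_nonneg_right ?_ hA.le
      have h2 : |nInner (M a) (lowPart T f)| < β * expE (lowPart T f) := by
        by_contra h3
        exact hb (mem_badRows.mpr ⟨ha, not_lt.mp h3⟩)
      obtain ⟨h3, h4⟩ := abs_lt.mp h2
      have h5 : β * expE (lowPart T f) ≤ 1 / 2 * expE (lowPart T f) :=
        mul_le_mul_of_nonneg_right hβ hg0
      change _ ≤ (expE (lowPart T f) + bitSign b * nInner (M a) (lowPart T f)) / 2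
      cases b <;> simp [bitSign] <;> linarith
  refine (edgeWeight_le hM hf a b x).trans ?_
  have : lowPart T f x / Fintype.card A ≤ 8 * T * (expE (lowPart T f) / 4 / Fintype.card A) := by
    rw [show 8 * T * (expE (lowPart T f) / 4 / Fintype.card A)
      = (T * (2 * expE (lowPart T f))) / Fintype.card A by ring]
    exact div_le_div_of_nonneg_right (hg.trans hTw) hA.le
  exact this.trans (mul_le_mul_of_nonneg_left key (by positivity))

theorem sum_indicator_card (S : Finset A) (c : ℝ) :
    ∑ a, (if a ∈ S then c else 0) = S.card * c := by
  simp [sum_ite_mem]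

/-- Pointwise, the edges carry the weight of the corresponding steps of the process, apart from
the discarded rows; the rows in `H` are counted for both bits. -/
theorem sum_edge_ge (hM : ∀ a x, M a x = 1 ∨ M a x = -1) (hf : ∀ x, 0 ≤ f x)
    {φ : Bool → ℝ} (hφ0 : ∀ b, 0 ≤ φ b) (hφ1 : ∀ b, φ b ≤ 1) (hε : 0 ≤ ε) (a : A) (x : X) :
    lowPart T f x / Fintype.card A * (φ (bitOf M a x) - ε)
      ≤ ∑ b, edgeWeight M H T β f a b x * (φ b - ε)
        + ((if a ∈ H then ε else 0) + if a ∈ badRows M H β (lowPart T f) then 1 else 0)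
          * (lowPart T f x / Fintype.card A) := by
  have hg : 0 ≤ lowPart T f x / Fintype.card A :=
    div_nonneg (lowPart_nonneg hf x) (Nat.cast_nonneg _)
  set g := lowPart T f x / Fintype.card A with hgd
  by_cases ha : a ∈ H
  · have hb : a ∉ badRows M H β (lowPart T f) := fun hb => (mem_badRows.mp hb).1 ha
    simp only [edgeWeight, if_pos ha, if_neg hb, ← hgd, Fintype.sum_bool]
    cases bitOf M a x <;> nlinarith [mul_nonneg hg (hφ0 true), mul_nonneg hg (hφ0 false)]
  · by_cases hb : a ∈ badRows M H β (lowPart T f)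
    · simp only [edgeWeight, if_neg ha, if_pos hb]
      simp only [zero_mul, sum_const_zero, zero_add, one_mul]
      nlinarith [mul_le_mul_of_nonneg_left (hφ1 (bitOf M a x)) hg, mul_nonneg hg hε]
    · simp only [edgeWeight, if_neg ha, if_neg hb, half_one_add_bitSign_mul hM, zero_mul,
        add_zero]
      simp only [mul_ite, mul_one, mul_zero, ite_div, zero_div, ite_mul, zero_mul, ← hgd]
      simp

theorem sum_edge_le [Nonempty A] (hM : ∀ a x, M a x = 1 ∨ M a x = -1) (hf : ∀ x, 0 ≤ f x)
    (hH : (H.card : ℝ) ≤ h * Fintype.card A) (x : X) :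
    ∑ a, ∑ b, edgeWeight M H T β f a b x ≤ (1 + h) * f x := by
  have hA : (0 : ℝ) < Fintype.card A := Nat.cast_pos.mpr Fintype.card_pos
  have hg0 := lowPart_nonneg (T := T) hf x
  have hg : 0 ≤ lowPart T f x / Fintype.card A := by positivity
  have h1 : ∀ a, ∑ b, edgeWeight M H T β f a b x
      ≤ lowPart T f x / Fintype.card A
        + if a ∈ H then lowPart T f x / Fintype.card A else 0 := by
    intro a
    by_cases ha : a ∈ H
    · simp only [edgeWeight, if_pos ha, Fintype.sum_bool]; exact le_rfl
    · by_cases hb : a ∈ badRows M H β (lowPart T f)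
      · simp only [edgeWeight, if_neg ha, if_pos hb]
        simpa using hg
      · simp only [edgeWeight, if_neg ha, if_neg hb, half_one_add_bitSign_mul hM]
        cases bitOf M a x <;> simp
  refine (sum_le_sum fun a _ => h1 a).trans ?_
  rw [sum_add_distrib, sum_indicator_card, sum_const, card_univ, nsmul_eq_mul,
    mul_div_cancel₀ _ hA.ne', ← mul_div_assoc]
  have h2 : H.card * lowPart T f x / Fintype.card A ≤ h * lowPart T f x := by
    rw [div_le_iff₀ hA]
    nlinarith [mul_le_mul_of_nonneg_right hH hg0]
  have hh : 0 ≤ 1 + h := by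
    by_contra! h3
    have : (0 : ℝ) ≤ H.card := Nat.cast_nonneg _
    nlinarith
  have := mul_le_mul_of_nonneg_left (lowPart_le (T := T) hf x) hh
  linarith

end Edge

section Vertex

variable {A X : Type*} [Fintype A] [Fintype X]
variable {M : A → X → ℝ} {H : Finset A} {T β q κ Λ h ε : ℝ} {f : X → ℝ}

theorem expE_sq_le {f : X → ℝ} {S : ℝ} (hf : ∀ x, 0 ≤ f x)
    (hS : ∀ x, f x ≤ S) : expE (fun x => f x ^ 2) ≤ S * expE f := by
  rw [← expE_mul_left]
  exact expE_mono fun x => by nlinarith [hf x, hS x]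

/-- One step of the process: averaging a quantity over the rows, for the weight of a vertex, is
bounded by the quantity accumulated along the edges, up to the discarded mass. -/
theorem expE_step_le [Nonempty A] (hM : ∀ a x, M a x = 1 ∨ M a x = -1) (hT : 0 ≤ T)
    (hq : q ≤ 1 / 2) (hκ : 0 ≤ κ) (hΛ : 2 * T ≤ Λ) (hε : 0 ≤ ε)
    (hH : (H.card : ℝ) ≤ h * Fintype.card A) (hh : 0 ≤ h) (hU : UnbiasedOutside M H Λ β κ)
    (hf : ∀ x, 0 ≤ f x) (hs : ¬ IsSignificant T q f) {φ : A → Bool → X → ℝ}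
    (hφ0 : ∀ a b x, 0 ≤ φ a b x) (hφ1 : ∀ a b x, φ a b x ≤ 1) :
    expE (fun x => f x * ((∑ a, φ a (bitOf M a x) x) / Fintype.card A - ε))
      ≤ (∑ a, ∑ b, expE (fun x => edgeWeight M H T β f a b x * (φ a b x - ε)))
        + (q + κ + ε * h) * expE f := by
  have hA : (0 : ℝ) < Fintype.card A := Nat.cast_pos.mpr Fintype.card_pos
  have hg0 := lowPart_nonneg (T := T) hf
  have hgE := expE_nonneg hg0
  have hfE := expE_nonneg hf
  set B := badRows M H β (lowPart T f) with hB
  have hBc : (B.card : ℝ) * expE (lowPart T f) ≤ κ * Fintype.card A * expE (lowPart T f) := by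
    rcases hgE.eq_or_lt with h0 | h0
    · rw [← h0]; simp
    refine mul_le_mul_of_nonneg_right (hU _ hg0 h0 ?_) hgE
    have h1 := expE_sq_le hg0 (lowPart_le_mul hT hf)
    have h2 := expE_le_two_mul_lowPart hq hf hs
    calc _ ≤ T * expE f * expE (lowPart T f) := h1
      _ ≤ T * (2 * expE (lowPart T f)) * expE (lowPart T f) := by gcongr
      _ = 2 * T * expE (lowPart T f) ^ 2 := by ring
      _ ≤ _ := by gcongr
  have hpt : ∀ x, f x * ((∑ a, φ a (bitOf M a x) x) / Fintype.card A - ε)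
      ≤ ((f x - lowPart T f x)
        + ∑ a, ∑ b, edgeWeight M H T β f a b x * (φ a b x - ε))
        + (((H.card : ℝ) * ε + B.card) / Fintype.card A) * lowPart T f x := by
    intro x
    have h1 : lowPart T f x * ((∑ a, φ a (bitOf M a x) x) / Fintype.card A - ε)
        = ∑ a, lowPart T f x / Fintype.card A * (φ a (bitOf M a x) x - ε) := by
      rw [← mul_sum, sum_sub_distrib, sum_const, card_univ, nsmul_eq_mul]
      field_simp
    have h2 := sum_le_sum fun a (_ : a ∈ univ) => sum_edge_ge (M := M) (H := H) (T := T) (β := β)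
      (φ := fun b => φ a b x) hM hf (fun b => hφ0 a b x) (fun b => hφ1 a b x) hε a x
    rw [← h1, sum_add_distrib, ← sum_mul, sum_add_distrib, sum_indicator_card,
      sum_indicator_card, ← hB] at h2
    have h3 : (∑ a, φ a (bitOf M a x) x) / Fintype.card A ≤ 1 := by
      rw [div_le_one hA]
      calc _ ≤ ∑ a : A, (1 : ℝ) := sum_le_sum fun a _ => hφ1 _ _ _
        _ = _ := by simp
    have h4 := mul_le_mul_of_nonneg_left ((sub_le_self _ hε).trans h3)
      (sub_nonneg.mpr (lowPart_le (T := T) hf x))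
    have h5 : ((H.card : ℝ) * ε + B.card * 1) * (lowPart T f x / Fintype.card A)
        = (((H.card : ℝ) * ε + B.card) / Fintype.card A) * lowPart T f x := by ring
    rw [h5] at h2
    linarith
  refine (expE_mono hpt).trans ?_
  rw [expE_add, expE_add, expE_sub, expE_mul_left, expE_sum]
  simp only [expE_sum]
  have h1 : expE (fun x => f x) - expE (lowPart T f) ≤ q * expE f := by
    have := not_lt.mp hs
    change expE f - _ ≤ _
    linarith
  have h2 : ((H.card : ℝ) * ε + B.card) / Fintype.card A * expE (lowPart T f)
      ≤ (κ + ε * h) * expE f := by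
    rw [div_mul_eq_mul_div, div_le_iff₀ hA]
    have e1 : H.card * ε * expE (lowPart T f) ≤ h * Fintype.card A * ε * expE f := by
      have := expE_lowPart_le (T := T) hf
      gcongr
    have e2 : κ * Fintype.card A * expE (lowPart T f) ≤ κ * Fintype.card A * expE f := by
      have := expE_lowPart_le (T := T) hf
      gcongr
    nlinarith
  change (expE (fun x => f x) - expE (lowPart T f) + _) +
    ((H.card : ℝ) * ε + B.card) / Fintype.card A * expE (lowPart T f) ≤ _
  linarith

/-- A function of which no subset of noticeable mass is concentrated is nearly uncorrelated with
almost all rows, so no hypothesis is correlated with its columns. -/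
theorem expE_hypothesis_le [Nonempty A] (hM : ∀ a x, M a x = 1 ∨ M a x = -1) (hT : 0 ≤ T)
    (hq0 : 0 < q) (hκ : 0 ≤ κ) (hβ : 0 ≤ β) (hΛ : T / q ≤ Λ)
    (hH : (H.card : ℝ) ≤ h * Fintype.card A) (hh : 0 ≤ h) (hU : UnbiasedOutside M H Λ β κ)
    (hf : ∀ x, 0 ≤ f x) (hs : ¬ IsSignificant T q f) {u : A → ℝ} (hu : ∀ a, u a = 1 ∨ u a = -1) :
    expE (fun x => f x * |nInner u (fun a => M a x)|) ≤ (3 * q + β + κ + h) * expE f := by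
  have hA : (0 : ℝ) < Fintype.card A := Nat.cast_pos.mpr Fintype.card_pos
  have hg0 := lowPart_nonneg (T := T) hf
  have hfE := expE_nonneg hf
  have hone : ∀ x, |nInner u (fun a => M a x)| ≤ 1 := by
    intro x
    refine (abs_expE_le _).trans ?_
    calc _ ≤ expE (fun _ : A => (1 : ℝ)) := expE_mono fun a => by
          rcases hu a with h1 | h1 <;> rcases hM a x with h2 | h2 <;> simp [h1, h2]
      _ = 1 := expE_const 1
  have piece : ∀ s : X → ℝ, (∀ x, 0 ≤ s x) → (∀ x, s x ≤ lowPart T f x) →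
      |expE (fun x => s x * nInner u (fun a => M a x))|
        ≤ q * expE f + (β + κ + h) * expE s := by
    intro s hs0 hs1
    have hsE := expE_nonneg hs0
    have hswap : expE (fun x => s x * nInner u (fun a => M a x))
        = expE (fun a => u a * nInner (M a) s) := by
      have e : (fun x => s x * nInner u (fun a => M a x))
          = fun x => (1 / (Fintype.card A : ℝ)) * ∑ a, u a * (M a x * s x) := by
        funext x
        rw [nInner, expE, mul_div_assoc', mul_sum, one_div, inv_mul_eq_div]
        congr 1
        exact sum_congr rfl fun a _ => by ring
      rw [e, expE_mul_left, expE_sum, expE]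
      simp only [expE_mul_left]
      rw [one_div, inv_mul_eq_div]
      rfl
    have hle : |expE (fun x => s x * nInner u (fun a => M a x))|
        ≤ (∑ a, |nInner (M a) s|) / Fintype.card A := by
      rw [hswap]
      refine (abs_expE_le _).trans (expE_mono fun a => ?_)
      rcases hu a with h1 | h1 <;> simp [h1]
    refine hle.trans ?_
    rw [div_le_iff₀ hA]
    have htriv : ∀ a, |nInner (M a) s| ≤ expE s := fun a => abs_nInner_le (hM a) hs0
    by_cases hbig : q * expE f < expE s
    · have hpos : 0 < expE s := lt_of_le_of_lt (by positivity) hbig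
      have hbad := hU s hs0 hpos (by
        have h1 := expE_sq_le hs0
          (fun x => (hs1 x).trans (lowPart_le_mul hT hf x))
        have h2 : expE f ≤ expE s / q := by
          rw [le_div_iff₀ hq0]; linarith
        calc _ ≤ T * expE f * expE s := h1
          _ ≤ T * (expE s / q) * expE s := by gcongr
          _ = T / q * expE s ^ 2 := by ring
          _ ≤ _ := by gcongr)
      have h1 : ∀ a, |nInner (M a) s| ≤ β * expE s + ((if a ∈ H then expE s else 0)
          + if a ∈ badRows M H β s then expE s else 0) := by
        intro a
        have hβs : 0 ≤ β * expE s := by positivity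
        by_cases ha : a ∈ H
        · have := htriv a
          rw [if_pos ha]
          split_ifs <;> linarith
        · by_cases hb : a ∈ badRows M H β s
          · rw [if_neg ha, if_pos hb]; linarith [htriv a]
          · rw [if_neg ha, if_neg hb]
            rw [mem_badRows, not_and, not_le] at hb
            linarith [hb ha]
      refine (sum_le_sum fun a _ => h1 a).trans ?_
      rw [sum_add_distrib, sum_add_distrib, sum_indicator_card, sum_indicator_card, sum_const,
        card_univ, nsmul_eq_mul]
      have := mul_le_mul_of_nonneg_right hH hsE
      have := mul_le_mul_of_nonneg_right hbad hsE
      have : 0 ≤ q * expE f * Fintype.card A := by positivity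
      nlinarith
    · refine (sum_le_sum fun a _ => (htriv a).trans (not_lt.mp hbig)).trans ?_
      rw [sum_const, card_univ, nsmul_eq_mul]
      have : 0 ≤ (β + κ + h) * expE s * Fintype.card A := by positivity
      nlinarith
  set s₁ : X → ℝ := fun x => if 0 ≤ nInner u (fun a => M a x) then lowPart T f x else 0 with hs₁
  set s₂ : X → ℝ := fun x => if 0 ≤ nInner u (fun a => M a x) then 0 else lowPart T f x with hs₂
  have p₁ := piece s₁ (fun x => by simp only [hs₁]; split_ifs <;> simp [hg0 x])
    (fun x => by simp only [hs₁]; split_ifs <;> simp [hg0 x])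
  have p₂ := piece s₂ (fun x => by simp only [hs₂]; split_ifs <;> simp [hg0 x])
    (fun x => by simp only [hs₂]; split_ifs <;> simp [hg0 x])
  have hsum : expE s₁ + expE s₂ = expE (lowPart T f) := by
    rw [← expE_add]
    congr 1; funext x; simp only [hs₁, hs₂]; split_ifs <;> simp
  have hpt : ∀ x, f x * |nInner u (fun a => M a x)| ≤ (f x - lowPart T f x)
      + (s₁ x * nInner u (fun a => M a x) - s₂ x * nInner u (fun a => M a x)) := by
    intro x
    have h1 := mul_le_mul_of_nonneg_left (hone x) (sub_nonneg.mpr (lowPart_le (T := T) hf x))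
    simp only [hs₁, hs₂]
    split_ifs with h0
    · rw [abs_of_nonneg h0] at h1 ⊢; linarith
    · rw [abs_of_neg (not_le.mp h0)] at h1 ⊢; linarith
  refine (expE_mono hpt).trans ?_
  rw [expE_add, expE_sub, expE_sub]
  have h1 : expE (fun x => f x) - expE (lowPart T f) ≤ q * expE f := by
    have := not_lt.mp hs
    change expE f - _ ≤ _
    linarith
  have h2 := (abs_le.mp p₁).2
  have h3 := (abs_le.mp p₂).1
  have h4 : (β + κ + h) * expE (lowPart T f) ≤ (β + κ + h) * expE f :=
    mul_le_mul_of_nonneg_left (expE_lowPart_le hf) (by positivity)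
  rw [← hsum] at h4
  change (expE (fun x => f x) - expE (lowPart T f)) + _ ≤ _
  linarith

end Vertex

section Moment

variable {A X : Type*} [Fintype A] [Fintype X]
variable {M : A → X → ℝ} {H : Finset A} {T β q κ Λ h G : ℝ} {f ψ : X → ℝ} {n : ℕ}

theorem div_pow_succ_div_div_pow {a w c : ℝ} (hc : c ≠ 0) :
    (a / c) ^ (n + 1) / (w / c) ^ n = a ^ (n + 1) / w ^ n / c := by
  rw [div_pow, div_pow, pow_succ c]
  by_cases hw : w ^ n = 0
  · simp [hw]
  · field_simp

theorem expE_edgeWeight_of_good {a : A} (ha : a ∉ H) (hb : a ∉ badRows M H β (lowPart T f))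
    (b : Bool) : expE (edgeWeight M H T β f a b)
      = (expE (lowPart T f) + bitSign b * nInner (M a) (lowPart T f)) / 2 / Fintype.card A := by
  have := edgeWeight_of_good (M := M) (T := T) (β := β) (f := f) ha hb b (fun _ => 1)
  simpa only [mul_one] using this

theorem expE_edgeWeight_of_mem {a : A} (ha : a ∈ H) (b : Bool) :
    expE (edgeWeight M H T β f a b) = expE (lowPart T f) / Fintype.card A := by
  have := edgeWeight_of_mem (M := M) (T := T) (β := β) (f := f) ha b (fun _ => 1)
  simpa only [mul_one] using this

/-- The moments of the edges leaving a vertex along one fixed row. -/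
theorem moment_edge_row_le [Nonempty A] (hM : ∀ a x, M a x = 1 ∨ M a x = -1)
    (hβ0 : 0 ≤ β) (hβ : β ≤ 1 / 2) (hG0 : 0 ≤ G)
    (hG : Real.cosh (2 * (n + 1) * β) * Real.exp (2 * n * β ^ 2) ≤ G)
    (hf : ∀ x, 0 ≤ f x) (hψ : ∀ x, 0 ≤ ψ x) (hw : 0 < expE (lowPart T f)) (a : A) :
    ∑ b, moment n ψ (edgeWeight M H T β f a b)
      ≤ (G + ((if a ∈ H then 2 else 0)
        + if a ∈ badRows M H β (fun x => lowPart T f x * ψ x) then (2 / (1 - β)) ^ n else 0))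
          * (moment n ψ (lowPart T f) / Fintype.card A) := by
  have hA : (Fintype.card A : ℝ) ≠ 0 := Nat.cast_ne_zero.mpr Fintype.card_ne_zero
  have hg0 := lowPart_nonneg (T := T) hf
  have hz : 0 ≤ moment n ψ (lowPart T f) / Fintype.card A :=
    div_nonneg (moment_nonneg hψ hg0) (Nat.cast_nonneg _)
  have hD : 0 ≤ (2 / (1 - β)) ^ n := pow_nonneg (div_nonneg two_pos.le (by linarith)) _
  by_cases ha : a ∈ H
  · rw [if_pos ha, if_neg fun hb => (mem_badRows.mp hb).1 ha, Fintype.sum_bool]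
    simp only [moment, edgeWeight_of_mem ha, expE_edgeWeight_of_mem ha,
      div_pow_succ_div_div_pow hA]
    simp only [moment] at hz
    nlinarith [mul_nonneg hG0 hz]
  by_cases hb : a ∈ badRows M H β (lowPart T f)
  · have : ∀ b, moment n ψ (edgeWeight M H T β f a b) = 0 := fun b => by
      simp only [moment, edgeWeight_of_bad hb, zero_mul, expE_zero]
      simp
    simp only [this, sum_const_zero]
    refine mul_nonneg ?_ hz
    split_ifs <;> positivity
  have hμ : |nInner (M a) (lowPart T f)| ≤ β * expE (lowPart T f) := by
    by_contra h3
    exact hb (mem_badRows.mpr ⟨ha, (not_le.mp h3).le⟩)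
  have hI0 : ∀ x, 0 ≤ lowPart T f x * ψ x := fun x => mul_nonneg (hg0 x) (hψ x)
  have e : ∑ b, moment n ψ (edgeWeight M H T β f a b)
      = (((expE (fun x => lowPart T f x * ψ x)
            + nInner (M a) (fun x => lowPart T f x * ψ x)) / 2) ^ (n + 1)
          / ((expE (lowPart T f) + nInner (M a) (lowPart T f)) / 2) ^ n
        + ((expE (fun x => lowPart T f x * ψ x)
            - nInner (M a) (fun x => lowPart T f x * ψ x)) / 2) ^ (n + 1)
          / ((expE (lowPart T f) - nInner (M a) (lowPart T f)) / 2) ^ n) / Fintype.card A := by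
    rw [Fintype.sum_bool]
    simp only [moment, edgeWeight_of_good ha hb, expE_edgeWeight_of_good ha hb,
      div_pow_succ_div_div_pow hA, bitSign]
    simp only [if_true, one_mul, Bool.false_eq_true, if_false, neg_one_mul, ← sub_eq_add_neg,
      add_div]
  rw [e, if_neg ha, zero_add, ← mul_div_assoc]
  refine div_le_div_of_nonneg_right ?_ (Nat.cast_nonneg _)
  have hz' := moment_nonneg (n := n) hψ hg0
  split_ifs with hb'
  · refine (perspective_split_le_crude hβ hw hμ (abs_nInner_le (hM a) hI0)).trans ?_
    change _ * moment n ψ (lowPart T f) ≤ _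
    exact mul_le_mul_of_nonneg_right (by linarith) hz'
  · have hν : |nInner (M a) (fun x => lowPart T f x * ψ x)|
        ≤ β * expE (fun x => lowPart T f x * ψ x) := by
      by_contra h3
      exact hb' (mem_badRows.mpr ⟨ha, (not_le.mp h3).le⟩)
    rw [add_zero]
    exact perspective_split_le hβ0 hβ hw (expE_nonneg hI0) hμ hν hG

theorem sum_moment_edge_le [Nonempty A] (hM : ∀ a x, M a x = 1 ∨ M a x = -1) (hT : 0 ≤ T)
    (hβ0 : 0 ≤ β) (hβ : β ≤ 1 / 2) (hq0 : 0 < q) (hq : q ≤ 1 / 2) (hκ : 0 ≤ κ) (hh : 0 ≤ h)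
    (hG0 : 0 ≤ G) (hG : Real.cosh (2 * (n + 1) * β) * Real.exp (2 * n * β ^ 2) ≤ G)
    (hΛ : 16 * T ^ 2 / q ≤ Λ) (hH : (H.card : ℝ) ≤ h * Fintype.card A)
    (hU : UnbiasedOutside M H Λ β κ) (hf : ∀ x, 0 ≤ f x) (hs : ¬ IsSignificant T q f)
    (hψ : ∀ x, 0 ≤ ψ x) (hψT : ∀ x, ψ x ≤ 8 * T / q) :
    ∑ a, ∑ b, moment n ψ (edgeWeight M H T β f a b)
      ≤ (2 * h + G + κ * (2 / (1 - β)) ^ n) / (1 - q) ^ n * moment n ψ f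
        + (2 / (1 - β)) ^ n * expE f := by
  have hA : (0 : ℝ) < Fintype.card A := Nat.cast_pos.mpr Fintype.card_pos
  have hg0 := lowPart_nonneg (T := T) hf
  have hfE := expE_nonneg hf
  have hD : 0 ≤ (2 / (1 - β)) ^ n := pow_nonneg (div_nonneg two_pos.le (by linarith)) _
  set D := (2 / (1 - β)) ^ n with hDdef
  have hI0 : ∀ x, 0 ≤ lowPart T f x * ψ x := fun x => mul_nonneg (hg0 x) (hψ x)
  have hq1 : 0 < 1 - q := by linarith
  have hzf := moment_nonneg (n := n) hψ hf
  have hC : 0 ≤ 2 * h + G + κ * D := by positivity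
  rcases (expE_nonneg hg0).eq_or_lt with h0 | hw
  · have hz : ∀ x, lowPart T f x = 0 := eq_zero_of_expE_eq_zero hg0 h0.symm
    have : ∀ a b, moment n ψ (edgeWeight M H T β f a b) = 0 := fun a b => by
      have : ∀ x, edgeWeight M H T β f a b x = 0 := fun x => by
        simp [edgeWeight, hz]
      simp only [moment, this, zero_mul, expE_zero]
      simp
    simp only [this, sum_const_zero]
    positivity
  have hrow := sum_le_sum fun a (_ : a ∈ univ) =>
    moment_edge_row_le (M := M) (H := H) (T := T) hM hβ0 hβ hG0 hG hf hψ hw a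
  refine hrow.trans ?_
  set z := moment n ψ (lowPart T f) with hz
  have hz0 : 0 ≤ z := moment_nonneg hψ hg0
  rw [← sum_mul, sum_add_distrib, sum_add_distrib, sum_indicator_card, sum_indicator_card,
    sum_const, card_univ, nsmul_eq_mul, ← hDdef]
  set B := badRows M H β (fun x => lowPart T f x * ψ x) with hB
  have hzle : z ≤ moment n ψ f / (1 - q) ^ n := by
    have h1 : expE (fun x => lowPart T f x * ψ x) ≤ expE (fun x => f x * ψ x) :=
      expE_mono fun x => mul_le_mul_of_nonneg_right (lowPart_le hf x) (hψ x)
    have h2 : ((1 - q) * expE f) ^ n ≤ expE (lowPart T f) ^ n :=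
      pow_le_pow_left₀ (by positivity) (not_lt.mp hs) n
    have hfpos : 0 < expE f := hw.trans_le (expE_lowPart_le hf)
    calc z ≤ expE (fun x => f x * ψ x) ^ (n + 1) / ((1 - q) * expE f) ^ n :=
          div_le_div₀ (pow_nonneg (expE_nonneg fun x => mul_nonneg (hf x) (hψ x)) _)
            (pow_le_pow_left₀ (expE_nonneg hI0) h1 _) (by positivity) h2
      _ = _ := by rw [moment, mul_pow, div_div, mul_comm ((1 - q) ^ n)]
  have hBz : B.card * D * z ≤ κ * D * z * Fintype.card A + D * expE f * Fintype.card A := by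
    by_cases hcase : expE (lowPart T f) ≤ expE (fun x => lowPart T f x * ψ x)
    · have hIpos := hw.trans_le hcase
      have h2 := expE_le_two_mul_lowPart hq hf hs
      have hbad := hU _ hI0 hIpos (by
        have h1 := expE_sq_le hI0 (S := T * expE f * (8 * T / q)) (fun x =>
          mul_le_mul (lowPart_le_mul hT hf x) (hψT x) (hψ x) (by positivity))
        calc _ ≤ _ := h1
          _ ≤ T * (2 * expE (fun x => lowPart T f x * ψ x)) * (8 * T / q)
              * expE (fun x => lowPart T f x * ψ x) := by
            gcongr
            linarith
          _ = 16 * T ^ 2 / q * expE (fun x => lowPart T f x * ψ x) ^ 2 := by ring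
          _ ≤ _ := by gcongr)
      have h3 : 0 ≤ D * expE f * Fintype.card A := by positivity
      have h4 := mul_le_mul_of_nonneg_right hbad (mul_nonneg hD hz0)
      nlinarith
    · have hzw : z ≤ expE f := by
        refine le_trans ?_ (expE_lowPart_le (T := T) hf)
        rw [hz, moment, div_le_iff₀ (by positivity), ← pow_succ']
        exact pow_le_pow_left₀ (expE_nonneg hI0) (not_le.mp hcase).le _
      have h1 : (B.card : ℝ) ≤ Fintype.card A := by exact_mod_cast card_le_univ B
      have h2 : B.card * D * z ≤ Fintype.card A * D * expE f := by gcongr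
      have h3 : 0 ≤ κ * D * z * Fintype.card A := by positivity
      nlinarith
  have hHz : (H.card : ℝ) * 2 * z ≤ 2 * h * z * Fintype.card A := by
    nlinarith [mul_le_mul_of_nonneg_right hH hz0]
  calc _ = (Fintype.card A * G * z + H.card * 2 * z + B.card * D * z) / Fintype.card A := by ring
    _ ≤ ((2 * h + G + κ * D) * z + D * expE f) := by
        rw [div_le_iff₀ hA]; nlinarith
    _ ≤ (2 * h + G + κ * D) * (moment n ψ f / (1 - q) ^ n) + D * expE f := by gcongr
    _ = _ := by ring

/-- A significant function correlates well with its own normalized high part. -/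
theorem exists_direction_of_significant (hT : 0 < T) (hq0 : 0 < q)
    (hf : ∀ x, 0 ≤ f x) (hfb : ∀ x, f x ≤ 8 * T * expE f) (hs : IsSignificant T q f) :
    ∃ ψ : X → ℝ, (∀ x, 0 ≤ ψ x) ∧ (∀ x, ψ x ≤ 8 * T / q) ∧ expE ψ = 1 ∧
      expE f * T ^ (n + 1) ≤ moment n ψ f := by
  set Q : X → ℝ := fun x => f x - lowPart T f x with hQ
  have hQ0 : ∀ x, 0 ≤ Q x := fun x => sub_nonneg.mpr (lowPart_le hf x)
  have hQE : q * expE f < expE Q := by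
    have : expE Q = expE f - expE (lowPart T f) := expE_sub _ _
    have := show _ < _ from hs
    linarith
  have hfE := expE_nonneg hf
  have hQpos : 0 < expE Q := lt_of_le_of_lt (by positivity) hQE
  have hfpos : 0 < expE f := by
    refine hfE.lt_of_ne fun h0 => ?_
    have h1 : expE Q ≤ expE f := expE_mono fun x => sub_le_self _ (lowPart_nonneg hf x)
    linarith
  refine ⟨fun x => (expE Q)⁻¹ * Q x, fun x => mul_nonneg (inv_nonneg.mpr hQpos.le) (hQ0 x), ?_, ?_,
    ?_⟩
  · intro x
    change (expE Q)⁻¹ * Q x ≤ 8 * T / q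
    rw [inv_mul_eq_div, div_le_div_iff₀ hQpos hq0]
    have h1 : Q x ≤ 8 * T * expE f := (sub_le_self _ (lowPart_nonneg hf x)).trans (hfb x)
    nlinarith [mul_le_mul_of_nonneg_right h1 hq0.le, mul_lt_mul_of_pos_left hQE hT]
  · rw [expE_mul_left, inv_mul_cancel₀ hQpos.ne']
  · have h1 : T * expE f ≤ expE (fun x => f x * ((expE Q)⁻¹ * Q x)) := by
      have e : (fun x => f x * ((expE Q)⁻¹ * Q x)) = fun x => (expE Q)⁻¹ * (f x * Q x) := by
        funext x; ring
      rw [e, expE_mul_left, inv_mul_eq_div, le_div_iff₀ hQpos, ← expE_mul_left]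
      refine expE_mono fun x => ?_
      by_cases hx : f x ≤ T * expE f
      · simp [hQ, lowPart, hx]
      · exact mul_le_mul_of_nonneg_right (not_le.mp hx).le (hQ0 x)
    rw [moment, le_div_iff₀ (by positivity)]
    calc _ = (T * expE f) ^ (n + 1) := by ring
      _ ≤ _ := pow_le_pow_left₀ (by positivity) h1 _

end Moment

section Layers

variable {A X O : Type*} [Fintype A] [Fintype X] {m d : ℕ}

/-- The weight `x ↦ Pr[path is at v after t steps | x]`, for the process that stops at leaves and
at significant vertices, discards large values and biased rows, and follows both edges of the rows
in `H`. -/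
noncomputable def weight (B : BranchingProgram A O m d) (M : A → X → ℝ) (H : Finset A)
    (T β q : ℝ) : ℕ → Fin d → X → ℝ
  | 0 => fun v _ => if v = B.start then 1 else 0
  | t + 1 => fun u x => ∑ v, ∑ a, ∑ b,
      if (B.isLeaf t v = false ∧ ¬ IsSignificant T q (weight B M H T β q t v))
          ∧ B.next t v a b = u then
        edgeWeight M H T β (weight B M H T β q t v) a b x
      else 0

theorem moment_sum_le {ι : Type*} (s : Finset ι) {n : ℕ} {ψ : X → ℝ} {F : ι → X → ℝ}
    (hψ : ∀ x, 0 ≤ ψ x) (hF : ∀ i x, 0 ≤ F i x) :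
    moment n ψ (fun x => ∑ i ∈ s, F i x) ≤ ∑ i ∈ s, moment n ψ (F i) := by
  have h := sum_pow_div_sum_pow_le s (fun i => expE fun x => F i x * ψ x) (fun i => expE (F i)) n
    (fun i => expE_nonneg fun x => mul_nonneg (hF i x) (hψ x)) (fun i => expE_nonneg (hF i))
    (fun i h0 => by simp only [eq_zero_of_expE_eq_zero (hF i) h0, zero_mul, expE_zero])
  rw [moment, expE_sum]
  simp only [sum_mul, expE_sum]
  exact h

theorem moment_ite {n : ℕ} {ψ : X → ℝ} {P : Prop} [Decidable P] {F : X → ℝ} :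
    moment n ψ (fun x => if P then F x else 0) = if P then moment n ψ F else 0 := by
  split_ifs
  · rfl
  · simp [moment, expE_zero]

/-- Summing over the edges entering each vertex is summing over the edges leaving each vertex. -/
theorem sum_edges_comm (P : Fin d → Prop) (N : Fin d → A → Bool → Fin d)
    (F : Fin d → A → Bool → Fin d → ℝ) [∀ u v a b, Decidable (P v ∧ N v a b = u)]
    [∀ v, Decidable (P v)] :
    ∑ u, ∑ v, ∑ a, ∑ b, (if P v ∧ N v a b = u then F v a b u else 0)
      = ∑ v, if P v then ∑ a, ∑ b, F v a b (N v a b) else 0 := by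
  rw [sum_comm]
  refine sum_congr rfl fun v _ => ?_
  rw [sum_comm]
  by_cases hP : P v
  · rw [if_pos hP]
    refine sum_congr rfl fun a _ => ?_
    rw [sum_comm]
    refine sum_congr rfl fun b _ => ?_
    simp [hP]
  · simp [hP]

variable {B : BranchingProgram A O m d} {M : A → X → ℝ} {H : Finset A}
  {T β q κ Λ h ε G : ℝ} {n : ℕ}

theorem weight_nonneg (hM : ∀ a x, M a x = 1 ∨ M a x = -1) (t : ℕ) (v : Fin d) (x : X) :
    0 ≤ weight B M H T β q t v x := by
  induction t generalizing v x with
  | zero => simp only [weight]; split_ifs <;> norm_num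
  | succ t ih =>
    simp only [weight]
    refine sum_nonneg fun v _ => sum_nonneg fun a _ => sum_nonneg fun b _ => ?_
    split_ifs
    · exact edgeWeight_nonneg hM (ih v) a b x
    · exact le_rfl

theorem weight_le [Nonempty X] [Nonempty A] (hM : ∀ a x, M a x = 1 ∨ M a x = -1) (hT : 1 ≤ T)
    (hβ : β ≤ 1 / 2) (hq : q ≤ 1 / 2) (t : ℕ) (v : Fin d) (x : X) :
    weight B M H T β q t v x ≤ 8 * T * expE (weight B M H T β q t v) := by
  cases t with
  | zero =>
    simp only [weight, expE_const]
    split_ifs <;> linarith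
  | succ t =>
    simp only [weight, expE_sum]
    simp only [mul_sum]
    refine sum_le_sum fun v _ => sum_le_sum fun a _ => sum_le_sum fun b _ => ?_
    split_ifs with hc
    · exact edgeWeight_le_mul_expE hM (zero_le_one.trans hT) hβ hq (weight_nonneg hM t v) hc.1.2 a b x
    · simp [expE_zero]

theorem sum_expE_weight_le [Nonempty X] [Nonempty A] (hM : ∀ a x, M a x = 1 ∨ M a x = -1)
    (hh : 0 ≤ h) (hH : (H.card : ℝ) ≤ h * Fintype.card A) (t : ℕ) :
    ∑ v, expE (weight B M H T β q t v) ≤ (1 + h) ^ t := by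
  induction t with
  | zero =>
    simp only [weight, expE_const]
    simp
  | succ t ih =>
    rw [pow_succ']
    refine le_trans ?_ (mul_le_mul_of_nonneg_left ih (by linarith))
    rw [← expE_sum, ← expE_sum, ← expE_mul_left]
    refine expE_mono fun x => ?_
    simp only [weight]
    rw [sum_edges_comm (fun v => B.isLeaf t v = false ∧ ¬ IsSignificant T q (weight B M H T β q t v))
      (B.next t) (fun v a b _ => edgeWeight M H T β (weight B M H T β q t v) a b x), mul_sum]
    refine sum_le_sum fun v _ => ?_
    split_ifs
    · exact sum_edge_le hM (weight_nonneg hM t v) hH x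
    · exact mul_nonneg (by linarith) (weight_nonneg hM t v x)

theorem sum_moment_weight_succ_le [Nonempty A] (hM : ∀ a x, M a x = 1 ∨ M a x = -1) (hT : 0 ≤ T)
    (hβ0 : 0 ≤ β) (hβ : β ≤ 1 / 2) (hq0 : 0 < q) (hq : q ≤ 1 / 2) (hκ : 0 ≤ κ) (hh : 0 ≤ h)
    (hG0 : 0 ≤ G) (hG : Real.cosh (2 * (n + 1) * β) * Real.exp (2 * n * β ^ 2) ≤ G)
    (hΛ : 16 * T ^ 2 / q ≤ Λ) (hH : (H.card : ℝ) ≤ h * Fintype.card A)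
    (hU : UnbiasedOutside M H Λ β κ) {ψ : X → ℝ}
    (hψ : ∀ x, 0 ≤ ψ x) (hψT : ∀ x, ψ x ≤ 8 * T / q) (t : ℕ) :
    ∑ u, moment n ψ (weight B M H T β q (t + 1) u)
      ≤ (2 * h + G + κ * (2 / (1 - β)) ^ n) / (1 - q) ^ n
          * ∑ v, moment n ψ (weight B M H T β q t v)
        + (2 / (1 - β)) ^ n * ∑ v, expE (weight B M H T β q t v) := by
  have hD : 0 ≤ (2 / (1 - β)) ^ n := pow_nonneg (div_nonneg two_pos.le (by linarith)) _
  have hq1 : 0 < 1 - q := by linarith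
  have h1 : ∀ u, moment n ψ (weight B M H T β q (t + 1) u)
      ≤ ∑ v, ∑ a, ∑ b, if (B.isLeaf t v = false ∧ ¬ IsSignificant T q (weight B M H T β q t v))
          ∧ B.next t v a b = u then
        moment n ψ (edgeWeight M H T β (weight B M H T β q t v) a b) else 0 := by
    intro u
    have hnn : ∀ v a b x, 0 ≤ (if (B.isLeaf t v = false
        ∧ ¬ IsSignificant T q (weight B M H T β q t v)) ∧ B.next t v a b = u then
        edgeWeight M H T β (weight B M H T β q t v) a b x else 0) := fun v a b x => by
      split_ifs
      · exact edgeWeight_nonneg hM (weight_nonneg hM t v) a b x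
      · exact le_rfl
    refine (moment_sum_le _ hψ fun v x => sum_nonneg fun a _ => sum_nonneg fun b _ =>
      hnn v a b x).trans (sum_le_sum fun v _ => ?_)
    refine (moment_sum_le _ hψ fun a x => sum_nonneg fun b _ =>
      hnn v a b x).trans (sum_le_sum fun a _ => ?_)
    refine (moment_sum_le _ hψ fun b x => hnn v a b x).trans (sum_le_sum fun b _ => ?_)
    exact moment_ite.le
  refine (sum_le_sum fun u _ => h1 u).trans ?_
  rw [sum_edges_comm (fun v => B.isLeaf t v = false ∧ ¬ IsSignificant T q (weight B M H T β q t v))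
    (B.next t) (fun v a b _ => moment n ψ (edgeWeight M H T β (weight B M H T β q t v) a b)),
    mul_sum, mul_sum, ← sum_add_distrib]
  refine sum_le_sum fun v _ => ?_
  have hW : ∀ x, 0 ≤ weight B M H T β q t v x := weight_nonneg hM t v
  split_ifs with hc
  · exact sum_moment_edge_le hM hT hβ0 hβ hq0 hq hκ hh hG0 hG hΛ hH hU hW hc.2 hψ hψT
  · have := moment_nonneg (n := n) hψ hW
    have := expE_nonneg hW
    positivity

theorem sum_moment_weight_le [Nonempty X] [Nonempty A] (hM : ∀ a x, M a x = 1 ∨ M a x = -1)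
    (hT : 0 ≤ T) (hβ0 : 0 ≤ β) (hβ : β ≤ 1 / 2) (hq0 : 0 < q) (hq : q ≤ 1 / 2) (hκ : 0 ≤ κ)
    (hh : 0 ≤ h) (hG : Real.cosh (2 * (n + 1) * β) * Real.exp (2 * n * β ^ 2) ≤ G)
    (hΛ : 16 * T ^ 2 / q ≤ Λ) (hH : (H.card : ℝ) ≤ h * Fintype.card A)
    (hU : UnbiasedOutside M H Λ β κ) {ψ : X → ℝ}
    (hψ : ∀ x, 0 ≤ ψ x) (hψT : ∀ x, ψ x ≤ 8 * T / q) (hψ1 : expE ψ = 1) {t : ℕ} (ht : t ≤ m) :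
    ∑ v, moment n ψ (weight B M H T β q t v)
      ≤ ((2 * h + G + κ * (2 / (1 - β)) ^ n) / (1 - q) ^ n) ^ m
        * (1 + m * ((2 / (1 - β)) ^ n * (1 + h) ^ m)) := by
  have hD : 0 ≤ (2 / (1 - β)) ^ n := pow_nonneg (div_nonneg two_pos.le (by linarith)) _
  have hq1 : 0 < 1 - q := by linarith
  have hG1 : 1 ≤ G := by
    refine le_trans ?_ hG
    exact one_le_mul_of_one_le_of_one_le (Real.one_le_cosh _)
      (Real.one_le_exp (by positivity))
  set D := (2 / (1 - β)) ^ n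
  set P := (2 * h + G + κ * D) / (1 - q) ^ n with hP
  have hP1 : 1 ≤ P := by
    rw [hP, le_div_iff₀ (by positivity), one_mul]
    have : (1 - q) ^ n ≤ 1 := pow_le_one₀ hq1.le (by linarith)
    have : 0 ≤ κ * D := by positivity
    linarith
  set E := D * (1 + h) ^ m with hE
  have hE0 : 0 ≤ E := by positivity
  have key : ∀ t ≤ m, ∑ v, moment n ψ (weight B M H T β q t v) ≤ P ^ t * (1 + t * E) := by
    intro t
    induction t with
    | zero =>
      intro _
      have : ∀ v, moment n ψ (weight B M H T β q 0 v) = if v = B.start then 1 else 0 := by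
        intro v
        by_cases hv : v = B.start
        · have e : weight B M H T β q 0 v = fun _ => 1 := by simp [weight, hv]
          rw [if_pos hv, e, moment, expE_const]
          simp only [one_mul]
          rw [show expE (fun x => ψ x) = 1 from hψ1]
          simp
        · have e : weight B M H T β q 0 v = fun _ => 0 := by simp [weight, hv]
          rw [if_neg hv, e, moment]
          simp [expE_zero]
      simp [this]
    | succ t ih =>
      intro ht
      have h1 := sum_moment_weight_succ_le (B := B) (n := n) hM hT hβ0 hβ hq0 hq hκ hh
        (zero_le_one.trans hG1) hG hΛ hH hU hψ hψT t
      have h2 := sum_expE_weight_le (B := B) (T := T) (β := β) (q := q) hM hh hH t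
      have h3 : (1 + h) ^ t ≤ (1 + h) ^ m := pow_le_pow_right₀ (by linarith) (by omega)
      have h4 : D * ∑ v, expE (weight B M H T β q t v) ≤ E :=
        mul_le_mul_of_nonneg_left (h2.trans h3) hD
      have h5 := mul_le_mul_of_nonneg_left (ih (by omega)) (zero_le_one.trans hP1)
      have h6 : E ≤ P ^ (t + 1) * E := le_mul_of_one_le_left hE0 (one_le_pow₀ hP1)
      push_cast
      calc _ ≤ _ := h1
        _ ≤ P * (P ^ t * (1 + t * E)) + P ^ (t + 1) * E := by linarith
        _ = _ := by ring
  refine (key t ht).trans ?_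
  have : (t : ℝ) ≤ m := by exact_mod_cast ht
  have := pow_le_pow_right₀ hP1 ht
  gcongr

/-- Every significant vertex is reached with small probability. -/
theorem expE_weight_le_of_significant [Nonempty X] [Nonempty A]
    (hM : ∀ a x, M a x = 1 ∨ M a x = -1)
    (hT : 1 ≤ T) (hβ0 : 0 ≤ β) (hβ : β ≤ 1 / 2) (hq0 : 0 < q) (hq : q ≤ 1 / 2) (hκ : 0 ≤ κ)
    (hh : 0 ≤ h) (hG : Real.cosh (2 * (n + 1) * β) * Real.exp (2 * n * β ^ 2) ≤ G)
    (hΛ : 16 * T ^ 2 / q ≤ Λ) (hH : (H.card : ℝ) ≤ h * Fintype.card A)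
    (hU : UnbiasedOutside M H Λ β κ) {t : ℕ} (ht : t ≤ m) {v : Fin d}
    (hs : IsSignificant T q (weight B M H T β q t v)) :
    expE (weight B M H T β q t v)
      ≤ ((2 * h + G + κ * (2 / (1 - β)) ^ n) / (1 - q) ^ n) ^ m
        * (1 + m * ((2 / (1 - β)) ^ n * (1 + h) ^ m)) / T ^ (n + 1) := by
  have hT0 : 0 < T := by linarith
  have hW : ∀ v x, 0 ≤ weight B M H T β q t v x := weight_nonneg hM t
  obtain ⟨ψ, hψ, hψT, hψ1, hz⟩ := exists_direction_of_significant (n := n) hT0 hq0 (hW v)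
    (weight_le hM hT hβ hq t v) hs
  rw [le_div_iff₀ (by positivity)]
  refine hz.trans (le_trans ?_ (sum_moment_weight_le (B := B) hM hT0.le hβ0 hβ hq0 hq hκ hh hG hΛ
    hH hU hψ hψT hψ1 ht))
  exact single_le_sum (f := fun v => moment n ψ (weight B M H T β q t v))
    (fun v _ => moment_nonneg hψ (hW v)) (mem_univ v)

end Layers

section Path

variable {A X : Type*} [Fintype A] [Fintype X] {m d : ℕ}

/-- The expected correlation achieved on `x` from the vertex `v` of layer `t` on, if at most `j`
more steps are made. -/
noncomputable def value (B : BranchingProgram A (A → ℝ) m d) (M : A → X → ℝ) (x : X) :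
    ℕ → ℕ → Fin d → ℝ
  | 0 => fun t v => |nInner (B.label t v) (fun a => M a x)|
  | j + 1 => fun t v =>
      if B.isLeaf t v = true then |nInner (B.label t v) (fun a => M a x)|
      else (∑ a, value B M x j (t + 1) (B.next t v a (bitOf M a x))) / Fintype.card A

theorem abs_nInner_signs_le_one [Nonempty A] {u w : A → ℝ} (hu : ∀ a, u a = 1 ∨ u a = -1)
    (hw : ∀ a, w a = 1 ∨ w a = -1) : |nInner u w| ≤ 1 := by
  refine (abs_expE_le _).trans ?_
  calc _ ≤ expE (fun _ : A => (1 : ℝ)) := expE_mono fun a => by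
        rcases hu a with h1 | h1 <;> rcases hw a with h2 | h2 <;> simp [h1, h2]
    _ = 1 := expE_const 1

variable {B : BranchingProgram A (A → ℝ) m d} {M : A → X → ℝ} {x : X}

theorem value_nonneg (j t : ℕ) (v : Fin d) : 0 ≤ value B M x j t v := by
  induction j generalizing t v with
  | zero => exact abs_nonneg _
  | succ j ih =>
    simp only [value]
    split_ifs
    · exact abs_nonneg _
    · exact div_nonneg (sum_nonneg fun a _ => ih _ _) (Nat.cast_nonneg _)

theorem value_le_one [Nonempty A] (hM : ∀ a x, M a x = 1 ∨ M a x = -1)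
    (hB : ∀ t v a, B.label t v a = 1 ∨ B.label t v a = -1) (j t : ℕ) (v : Fin d) :
    value B M x j t v ≤ 1 := by
  have hA : (0 : ℝ) < Fintype.card A := Nat.cast_pos.mpr Fintype.card_pos
  induction j generalizing t v with
  | zero => exact abs_nInner_signs_le_one (hB t v) fun a => hM a x
  | succ j ih =>
    simp only [value]
    split_ifs
    · exact abs_nInner_signs_le_one (hB t v) fun a => hM a x
    · rw [div_le_one hA]
      calc _ ≤ ∑ a : A, (1 : ℝ) := sum_le_sum fun a _ => ih _ _
        _ = _ := by simp

theorem value_of_leaf {t : ℕ} {v : Fin d} (hl : B.isLeaf t v = true) (j : ℕ) :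
    value B M x j t v = |nInner (B.label t v) (fun a => M a x)| := by
  cases j with
  | zero => rfl
  | succ j => simp [value, hl]

theorem value_of_not_leaf {t : ℕ} {v : Fin d} (hl : B.isLeaf t v = false) (ht : t < m) :
    value B M x (m - t) t v
      = (∑ a, value B M x (m - (t + 1)) (t + 1) (B.next t v a (bitOf M a x)))
        / Fintype.card A := by
  obtain ⟨j, hj⟩ : ∃ j, m - t = j + 1 := ⟨m - t - 1, by omega⟩
  rw [hj, show m - (t + 1) = j by omega]
  simp [value, hl]

/-- Resampling the `i`-th coordinate of a uniformly random stream. -/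
theorem sum_sum_eq_card_mul_sum {i : Fin m} {F : (Fin m → A) → A → ℝ}
    (hF : ∀ a α β, F (Function.update a i β) α = F a α) :
    ∑ a, ∑ α, F a α = Fintype.card A * ∑ a, F a (a i) := by
  set σ : (Fin m → A) × A → (Fin m → A) × A := fun p => (Function.update p.1 i p.2, p.1 i) with hσ
  have hinv : Function.Involutive σ := fun p => by
    simp [hσ]
  have h := Equiv.sum_comp (hinv.toPerm σ) fun p : (Fin m → A) × A => F p.1 (p.1 i)
  simp only [Function.Involutive.coe_toPerm, hσ, Function.update_self, hF] at h
  rw [Fintype.sum_prod_type, Fintype.sum_prod_type] at h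
  rw [h, mul_sum]
  simp

theorem state_succ_of_not_leaf {a : Fin m → A} {t : ℕ} (ht : t < m)
    (hl : B.isLeaf t (B.state M x a t) = false) :
    B.state M x a (t + 1) = B.next t (B.state M x a t) (a ⟨t, ht⟩) (bitOf M (a ⟨t, ht⟩) x) := by
  change (if B.isLeaf t (B.state M x a t) then B.state M x a t
      else if h : t < m then B.next t (B.state M x a t) (a ⟨t, h⟩)
        (if M (a ⟨t, h⟩) x = 1 then true else false)
      else B.state M x a t) = _
  rw [if_neg (by simp [hl]), dif_pos ht, bitOf]

theorem state_succ_of_leaf {a : Fin m → A} {t : ℕ}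
    (hl : B.isLeaf t (B.state M x a t) = true) :
    B.state M x a (t + 1) = B.state M x a t := by
  change (if B.isLeaf t (B.state M x a t) then B.state M x a t
      else if h : t < m then B.next t (B.state M x a t) (a ⟨t, h⟩)
        (if M (a ⟨t, h⟩) x = 1 then true else false)
      else B.state M x a t) = _
  rw [if_pos hl]

theorem state_update {a : Fin m → A} {i : Fin m} {β : A} {s : ℕ} (hs : s ≤ i) :
    B.state M x (Function.update a i β) s = B.state M x a s := by
  induction s with
  | zero => rfl
  | succ s ih =>
    have ih := ih (by omega)
    have hsm : s < m := by omega
    by_cases hl : B.isLeaf s (B.state M x a s) = true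
    · rw [state_succ_of_leaf hl, state_succ_of_leaf (by rwa [ih]), ih]
    · have hl : B.isLeaf s (B.state M x a s) = false := by simpa using hl
      rw [state_succ_of_not_leaf hsm hl, state_succ_of_not_leaf hsm (by rwa [ih]), ih,
        Function.update_of_ne (Fin.ne_of_val_ne (by simp; omega))]

theorem stopTime_spec (a : Fin m → A) :
    B.isLeaf (B.stopTime M x a) (B.state M x a (B.stopTime M x a)) = true :=
  Nat.find_spec (B.exists_leaf M x a)

theorem stopTime_le_iff {a : Fin m → A} {t : ℕ} :
    B.stopTime M x a ≤ t ↔ ∃ s ≤ t, B.isLeaf s (B.state M x a s) = true :=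
  Nat.find_le_iff _ _

theorem stopTime_update {a : Fin m → A} {i : Fin m} {β : A} (h : B.stopTime M x a ≤ i) :
    B.stopTime M x (Function.update a i β) = B.stopTime M x a := by
  have h1 : B.stopTime M x (Function.update a i β) ≤ B.stopTime M x a :=
    stopTime_le_iff.mpr ⟨_, le_rfl, by rw [state_update h]; exact stopTime_spec a⟩
  refine h1.antisymm (stopTime_le_iff.mpr ⟨_, le_rfl, ?_⟩)
  have := stopTime_spec (B := B) (M := M) (x := x) (Function.update a i β)
  rwa [state_update (h1.trans h)] at this

theorem stopTime_update_le_iff {a : Fin m → A} {i : Fin m} {β : A} :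
    B.stopTime M x (Function.update a i β) ≤ i ↔ B.stopTime M x a ≤ i := by
  rw [stopTime_le_iff, stopTime_le_iff]
  constructor <;> rintro ⟨s, hs, h⟩ <;> refine ⟨s, hs, ?_⟩
  · rwa [state_update hs] at h
  · rwa [state_update hs]

theorem sum_output [Nonempty A] (x : X) :
    ∑ a : Fin m → A, |nInner (B.output M x a) (fun a => M a x)|
      = (Fintype.card A : ℝ) ^ m * value B M x m 0 B.start := by
  have hA : (Fintype.card A : ℝ) ≠ 0 := Nat.cast_ne_zero.mpr Fintype.card_ne_zero
  set g : (Fin m → A) → ℝ := fun a => |nInner (B.output M x a) (fun a => M a x)| with hg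
  have hout : ∀ a j, value B M x j (B.stopTime M x a) (B.state M x a (B.stopTime M x a)) = g a :=
    fun a j => value_of_leaf (stopTime_spec a) j
  set Y : ℕ → (Fin m → A) → ℝ := fun t a =>
    if B.stopTime M x a ≤ t then g a else value B M x (m - t) t (B.state M x a t) with hY
  have hstep : ∀ t (ht : t < m), ∑ a, Y t a = ∑ a, Y (t + 1) a := by
    intro t ht
    set F : (Fin m → A) → A → ℝ := fun a α =>
      if B.stopTime M x a ≤ t then g a
      else value B M x (m - (t + 1)) (t + 1) (B.next t (B.state M x a t) α (bitOf M α x)) with hF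
    have hnl : ∀ a, ¬ B.stopTime M x a ≤ t → B.isLeaf t (B.state M x a t) = false := by
      intro a ha
      by_contra h
      exact ha (stopTime_le_iff.mpr ⟨t, le_rfl, by simpa using h⟩)
    have h1 : ∀ a, Y t a = (∑ α, F a α) / Fintype.card A := by
      intro a
      simp only [hY, hF]
      split_ifs with h
      · simp [hA]
      · exact value_of_not_leaf (hnl a h) ht
    have h2 : ∀ a, Y (t + 1) a = F a (a ⟨t, ht⟩) := by
      intro a
      simp only [hY, hF]
      by_cases h : B.stopTime M x a ≤ t
      · rw [if_pos h, if_pos (by omega)]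
      · rw [if_neg h, ← state_succ_of_not_leaf ht (hnl a h)]
        split_ifs with h'
        · rw [← hout a (m - (t + 1)), show B.stopTime M x a = t + 1 by omega]
        · rfl
    have h3 : ∀ a α β, F (Function.update a ⟨t, ht⟩ β) α = F a α := by
      intro a α β
      have e := stopTime_update_le_iff (B := B) (M := M) (x := x) (a := a) (i := ⟨t, ht⟩) (β := β)
      simp only at e
      simp only [hF]
      by_cases h : B.stopTime M x a ≤ t
      · rw [if_pos h, if_pos (e.mpr h), hg]
        simp only [BranchingProgram.output]
        rw [stopTime_update h, state_update h]
      · rw [if_neg h, if_neg (fun h' => h (e.mp h')), state_update (le_refl t)]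
    simp only [h1, h2, ← sum_div, sum_sum_eq_card_mul_sum h3]
    field_simp
  have hall : ∀ t ≤ m, ∑ a, Y 0 a = ∑ a, Y t a := by
    intro t
    induction t with
    | zero => intro _; rfl
    | succ t ih => intro ht; rw [ih (by omega), hstep t (by omega)]
  have h0 : ∀ a, Y 0 a = value B M x m 0 B.start := by
    intro a
    simp only [hY]
    split_ifs with h
    · rw [← hout a m, Nat.le_zero.mp h]; rfl
    · rfl
  have hm : ∀ a, Y m a = g a := by
    intro a
    simp only [hY]
    rw [if_pos (stopTime_le_iff.mpr ⟨m, le_rfl, B.last_leaf _⟩)]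
  have := hall m le_rfl
  simp only [h0, hm] at this
  rw [← this]
  simp

theorem hypValue_eq [Nonempty A] :
    B.hypValue M = expE (fun x => value B M x m 0 B.start) := by
  have hA : (Fintype.card A : ℝ) ≠ 0 := Nat.cast_ne_zero.mpr Fintype.card_ne_zero
  rw [BranchingProgram.hypValue, Fintype.sum_prod_type]
  simp only [sum_output]
  rw [← mul_sum, expE, mul_comm, mul_div_mul_right _ _ (pow_ne_zero _ hA)]

end Path

section Main

variable {A X : Type*} [Fintype A] [Fintype X] {m d : ℕ}
variable {B : BranchingProgram A (A → ℝ) m d} {M : A → X → ℝ} {H : Finset A}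
  {T β q κ Λ h ε σ G : ℝ} {n : ℕ}

/-- The expected advantage over `ε` of the part of the process alive in layer `t`. -/
noncomputable def advantage (B : BranchingProgram A (A → ℝ) m d) (M : A → X → ℝ) (H : Finset A)
    (T β q ε : ℝ) (t : ℕ) : ℝ :=
  ∑ v, expE fun x => weight B M H T β q t v x * (value B M x (m - t) t v - ε)

theorem advantage_succ (t : ℕ) :
    advantage B M H T β q ε (t + 1)
      = ∑ v, if B.isLeaf t v = false ∧ ¬ IsSignificant T q (weight B M H T β q t v) then
          ∑ a, ∑ b, expE (fun x => edgeWeight M H T β (weight B M H T β q t v) a b x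
            * (value B M x (m - (t + 1)) (t + 1) (B.next t v a b) - ε))
        else 0 := by
  rw [← sum_edges_comm (fun v => B.isLeaf t v = false
      ∧ ¬ IsSignificant T q (weight B M H T β q t v)) (B.next t)
    (fun v a b u => expE (fun x => edgeWeight M H T β (weight B M H T β q t v) a b x
            * (value B M x (m - (t + 1)) (t + 1) u - ε))), advantage]
  refine sum_congr rfl fun u _ => ?_
  simp only [weight, sum_mul, expE_sum]
  refine sum_congr rfl fun v _ => sum_congr rfl fun a _ => sum_congr rfl fun b _ => ?_
  split_ifs
  · rfl
  · simp only [zero_mul, expE_zero]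

theorem expE_mul_value_sub_le [Nonempty A] (hM : ∀ a x, M a x = 1 ∨ M a x = -1)
    (hB : ∀ t v a, B.label t v a = 1 ∨ B.label t v a = -1) (hε : 0 ≤ ε) {f : X → ℝ}
    (hf : ∀ x, 0 ≤ f x) (j t : ℕ) (v : Fin d) :
    expE (fun x => f x * (value B M x j t v - ε)) ≤ expE f :=
  expE_mono fun x => mul_le_of_le_one_right (hf x) (by
    have := value_le_one (x := x) hM hB j t v
    linarith)

theorem advantage_leaf_le [Nonempty A] (hM : ∀ a x, M a x = 1 ∨ M a x = -1)
    (hB : ∀ t v a, B.label t v a = 1 ∨ B.label t v a = -1) (hT : 1 ≤ T)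
    (hβ0 : 0 ≤ β) (hq0 : 0 < q) (hκ : 0 ≤ κ)
    (hh : 0 ≤ h) (hΛ : 16 * T ^ 2 / q ≤ Λ) (hq : q ≤ 1 / 2)
    (hH : (H.card : ℝ) ≤ h * Fintype.card A)
    (hU : UnbiasedOutside M H Λ β κ) (hε : 3 * q + β + κ + h ≤ ε)
    {t : ℕ} {v : Fin d} (hl : B.isLeaf t v = true)
    (hs : ¬ IsSignificant T q (weight B M H T β q t v)) :
    expE (fun x => weight B M H T β q t v x * (value B M x (m - t) t v - ε)) ≤ 0 := by
  have hW : ∀ x, 0 ≤ weight B M H T β q t v x := weight_nonneg hM t v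
  have hΛ' : T / q ≤ Λ := by
    refine le_trans ?_ hΛ
    gcongr
    nlinarith
  have h1 := expE_hypothesis_le hM (zero_le_one.trans hT) hq0 hκ hβ0 hΛ' hH hh hU hW hs (hB t v)
  have h2 := mul_le_mul_of_nonneg_right hε (expE_nonneg hW)
  simp only [value_of_leaf hl, mul_sub]
  rw [expE_sub]
  simp only [mul_comm _ ε, expE_mul_left]
  change _ - ε * expE (weight B M H T β q t v) ≤ 0
  linarith

theorem advantage_le_succ [Nonempty X] [Nonempty A] (hM : ∀ a x, M a x = 1 ∨ M a x = -1)
    (hB : ∀ t v a, B.label t v a = 1 ∨ B.label t v a = -1) (hT : 1 ≤ T)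
    (hβ0 : 0 ≤ β) (hq0 : 0 < q) (hq : q ≤ 1 / 2) (hκ : 0 ≤ κ)
    (hh : 0 ≤ h) (hΛ : 16 * T ^ 2 / q ≤ Λ) (hH : (H.card : ℝ) ≤ h * Fintype.card A)
    (hU : UnbiasedOutside M H Λ β κ) (hε : 3 * q + β + κ + h ≤ ε) {t : ℕ} (ht : t < m)
    (hσ0 : 0 ≤ σ)
    (hσ : ∀ v, IsSignificant T q (weight B M H T β q t v) → expE (weight B M H T β q t v) ≤ σ) :
    advantage B M H T β q ε t ≤ advantage B M H T β q ε (t + 1)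
      + ((q + κ + ε * h) * (1 + h) ^ m + d * σ) := by
  have hε0 : 0 ≤ ε := le_trans (by positivity) hε
  have hΛ' : 2 * T ≤ Λ := by
    refine le_trans ?_ hΛ
    rw [le_div_iff₀ hq0]
    nlinarith
  have hS : ∑ v, expE (weight B M H T β q t v) ≤ (1 + h) ^ m :=
    (sum_expE_weight_le hM hh hH t).trans (pow_le_pow_right₀ (by linarith) ht.le)
  have hc : 0 ≤ q + κ + ε * h := by positivity
  have hpt : ∀ v, expE (fun x => weight B M H T β q t v x * (value B M x (m - t) t v - ε))
      ≤ (if B.isLeaf t v = false ∧ ¬ IsSignificant T q (weight B M H T β q t v) then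
          ∑ a, ∑ b, expE (fun x => edgeWeight M H T β (weight B M H T β q t v) a b x
            * (value B M x (m - (t + 1)) (t + 1) (B.next t v a b) - ε))
        else 0) + ((q + κ + ε * h) * expE (weight B M H T β q t v) + σ) := by
    intro v
    have hW : ∀ x, 0 ≤ weight B M H T β q t v x := weight_nonneg hM t v
    have hcw : 0 ≤ (q + κ + ε * h) * expE (weight B M H T β q t v) :=
      mul_nonneg hc (expE_nonneg hW)
    by_cases hs : IsSignificant T q (weight B M H T β q t v)
    · rw [if_neg fun hc => hc.2 hs]
      have := expE_mul_value_sub_le hM hB hε0 hW (m - t) t v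
      have := hσ v hs
      linarith
    by_cases hl : B.isLeaf t v = true
    · rw [if_neg (by simp [hl])]
      have := advantage_leaf_le hM hB hT hβ0 hq0 hκ hh hΛ hq hH hU hε hl hs
      linarith
    · have hl : B.isLeaf t v = false := by simpa using hl
      rw [if_pos ⟨hl, hs⟩]
      have := expE_step_le (φ := fun a b x => value B M x (m - (t + 1)) (t + 1) (B.next t v a b))
        hM (zero_le_one.trans hT) hq hκ hΛ' hε0 hH hh hU hW hs
        (fun _ _ _ => value_nonneg _ _ _) (fun _ _ _ => value_le_one hM hB _ _ _)
      simp only [value_of_not_leaf hl ht]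
      linarith
  rw [advantage_succ, advantage]
  refine (sum_le_sum fun v _ => hpt v).trans ?_
  rw [sum_add_distrib, sum_add_distrib, ← mul_sum, sum_const, card_univ, Fintype.card_fin,
    nsmul_eq_mul]
  have := mul_le_mul_of_nonneg_left hS hc
  linarith

theorem advantage_last_le [Nonempty X] [Nonempty A] (hM : ∀ a x, M a x = 1 ∨ M a x = -1)
    (hB : ∀ t v a, B.label t v a = 1 ∨ B.label t v a = -1) (hT : 1 ≤ T)
    (hβ0 : 0 ≤ β) (hq0 : 0 < q) (hq : q ≤ 1 / 2) (hκ : 0 ≤ κ)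
    (hh : 0 ≤ h) (hΛ : 16 * T ^ 2 / q ≤ Λ) (hH : (H.card : ℝ) ≤ h * Fintype.card A)
    (hU : UnbiasedOutside M H Λ β κ) (hε : 3 * q + β + κ + h ≤ ε)
    (hσ0 : 0 ≤ σ)
    (hσ : ∀ v, IsSignificant T q (weight B M H T β q m v) → expE (weight B M H T β q m v) ≤ σ) :
    advantage B M H T β q ε m ≤ d * σ := by
  have hε0 : 0 ≤ ε := le_trans (by positivity) hε
  rw [advantage]
  calc _ ≤ ∑ v : Fin d, σ := sum_le_sum fun v _ => by
        by_cases hs : IsSignificant T q (weight B M H T β q m v)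
        · exact (expE_mul_value_sub_le hM hB hε0 (weight_nonneg hM m v) _ m v).trans (hσ v hs)
        · exact (advantage_leaf_le hM hB hT hβ0 hq0 hκ hh hΛ hq hH hU hε (B.last_leaf v)
            hs).trans hσ0
    _ = _ := by simp

theorem hypValue_le_of_unbiased [Nonempty X] [Nonempty A] (hM : ∀ a x, M a x = 1 ∨ M a x = -1)
    (hB : ∀ t v a, B.label t v a = 1 ∨ B.label t v a = -1) (hT : 1 ≤ T)
    (hβ0 : 0 ≤ β) (hβ : β ≤ 1 / 2) (hq0 : 0 < q) (hq : q ≤ 1 / 2) (hκ : 0 ≤ κ)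
    (hh : 0 ≤ h) (hG : Real.cosh (2 * (n + 1) * β) * Real.exp (2 * n * β ^ 2) ≤ G)
    (hΛ : 16 * T ^ 2 / q ≤ Λ) (hH : (H.card : ℝ) ≤ h * Fintype.card A)
    (hU : UnbiasedOutside M H Λ β κ) (hε : ε = 3 * q + β + κ + h)
    (hσ : σ = ((2 * h + G + κ * (2 / (1 - β)) ^ n) / (1 - q) ^ n) ^ m
        * (1 + m * ((2 / (1 - β)) ^ n * (1 + h) ^ m)) / T ^ (n + 1)) :
    B.hypValue M ≤ ε + m * ((q + κ + ε * h) * (1 + h) ^ m) + (m + 1) * (d * σ) := by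
  have hsig : ∀ t ≤ m, ∀ v, IsSignificant T q (weight B M H T β q t v) →
      expE (weight B M H T β q t v) ≤ σ := fun t ht v hs => by
    rw [hσ]
    exact expE_weight_le_of_significant hM hT hβ0 hβ hq0 hq hκ hh hG hΛ hH hU ht hs
  have hσ0 : 0 ≤ σ := by
    have hG0 : 0 ≤ G :=
      (mul_pos (Real.cosh_pos _) (Real.exp_pos _)).le.trans hG
    have hD : 0 ≤ (2 / (1 - β)) ^ n := pow_nonneg (div_nonneg two_pos.le (by linarith)) _
    have hq1 : 0 < 1 - q := by linarith
    rw [hσ]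
    positivity
  have key : ∀ t ≤ m, advantage B M H T β q ε 0 ≤ advantage B M H T β q ε t
      + t * ((q + κ + ε * h) * (1 + h) ^ m + d * σ) := by
    intro t
    induction t with
    | zero => intro _; simp
    | succ t ih =>
      intro ht
      have h1 := ih (by omega)
      have h2 := advantage_le_succ hM hB hT hβ0 hq0 hq hκ hh hΛ hH hU hε.ge ht hσ0
        (hsig t (by omega))
      push_cast
      linarith
  have h1 := key m le_rfl
  have h2 := advantage_last_le hM hB hT hβ0 hq0 hq hκ hh hΛ hH hU hε.ge hσ0 (hsig m le_rfl)
  have h3 : advantage B M H T β q ε 0 = B.hypValue M - ε := by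
    rw [advantage, sum_eq_single B.start]
    · simp only [weight, if_true, one_mul]
      rw [expE_sub, expE_const, hypValue_eq]
      rfl
    · intro v _ hv
      simp only [weight, if_neg hv, zero_mul, expE_zero]
    · simp
  linarith

end Main

section Parameters

theorem exp_le_two_rpow {x : ℝ} (hx : 0 ≤ x) : Real.exp x ≤ (2 : ℝ) ^ (3 / 2 * x) := by
  rw [Real.rpow_def_of_pos two_pos, Real.exp_le_exp]
  nlinarith [Real.log_two_gt_d9]

theorem exp_neg_two_mul_le {x : ℝ} (h0 : 0 ≤ x) (h1 : x ≤ 1 / 2) : Real.exp (-(2 * x)) ≤ 1 - x := by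
  have := exp_sub_two_mul_sq_le (x := -x) (by rw [abs_neg, abs_of_nonneg h0]; exact h1)
  refine (Real.exp_le_exp.mpr ?_).trans this
  nlinarith

theorem inv_pow_le_exp {x : ℝ} (h0 : 0 ≤ x) (h1 : x ≤ 1 / 2) (n : ℕ) :
    1 / (1 - x) ^ n ≤ Real.exp (2 * n * x) := by
  have h2 : 0 < 1 - x := by linarith
  rw [div_le_iff₀ (by positivity)]
  have h3 := pow_le_pow_left₀ (Real.exp_pos _).le (exp_neg_two_mul_le h0 h1) n
  rw [← Real.exp_nat_mul] at h3
  refine le_trans ?_ (mul_le_mul_of_nonneg_left h3 (Real.exp_pos _).le)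
  rw [← Real.exp_add, ← Real.exp_zero]
  exact Real.exp_le_exp.mpr (by ring_nf; exact le_rfl)

theorem cosh_mul_exp_le {n : ℕ} {β δ : ℝ} (hβ0 : 0 ≤ β) (hβ1 : β ≤ 1) (hδ : 0 ≤ δ)
    (h : β ≤ δ ∨ (n + 1) * β ^ 2 ≤ δ) :
    Real.cosh (2 * (n + 1) * β) * Real.exp (2 * n * β ^ 2) ≤ Real.exp (4 * (n + 1) * δ) := by
  have hn : (0 : ℝ) ≤ n := Nat.cast_nonneg n
  rcases h with h | h
  · have h1 : Real.cosh (2 * (n + 1) * β) ≤ Real.exp (2 * (n + 1) * β) := by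
      rw [Real.cosh_eq]
      have : Real.exp (-(2 * (n + 1) * β)) ≤ Real.exp (2 * (n + 1) * β) :=
        Real.exp_le_exp.mpr (by nlinarith [mul_nonneg hn hβ0])
      linarith
    refine (mul_le_mul_of_nonneg_right h1 (Real.exp_pos _).le).trans ?_
    rw [← Real.exp_add]
    refine Real.exp_le_exp.mpr ?_
    have : n * β ^ 2 ≤ n * δ := mul_le_mul_of_nonneg_left (by nlinarith) hn
    nlinarith [mul_le_mul_of_nonneg_left h hn]
  · refine (mul_le_mul_of_nonneg_right (Real.cosh_le_exp_half_sq _) (Real.exp_pos _).le).trans ?_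
    rw [← Real.exp_add]
    refine Real.exp_le_exp.mpr ?_
    nlinarith [mul_le_mul_of_nonneg_left h hn, sq_nonneg β]

theorem growth_pow_le {n m : ℕ} {h κD q δ : ℝ} (hδ : 0 ≤ δ) (hh0 : 0 ≤ h)
    (hh : h ≤ 2 * δ) (hκ0 : 0 ≤ κD) (hκ : κD ≤ δ)
    (hq0 : 0 ≤ q) (hq : q ≤ δ) (hq1 : q ≤ 1 / 2) (hm : m * δ ≤ 1) :
    ((2 * h + Real.exp (4 * (n + 1) * δ) + κD) / (1 - q) ^ n) ^ m
      ≤ Real.exp (11 * (n + 1)) := by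
  have hn : (0 : ℝ) ≤ n := Nat.cast_nonneg n
  have hq2 : 0 < 1 - q := by linarith
  have h1 : 1 ≤ Real.exp (4 * (n + 1) * δ) := Real.one_le_exp (by positivity)
  have h2 : 2 * h + Real.exp (4 * (n + 1) * δ) + κD
      ≤ Real.exp (4 * (n + 1) * δ) * Real.exp (5 * δ) := by
    have h3 : 5 * δ + 1 ≤ Real.exp (5 * δ) := Real.add_one_le_exp _
    nlinarith [mul_le_mul_of_nonneg_left h3 (zero_le_one.trans h1)]
  have h4 : (2 * h + Real.exp (4 * (n + 1) * δ) + κD) / (1 - q) ^ n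
      ≤ Real.exp (11 * (n + 1) * δ) := by
    rw [div_eq_mul_one_div]
    refine (mul_le_mul h2 (inv_pow_le_exp hq0 hq1 n) (by positivity) (by positivity)).trans ?_
    rw [← Real.exp_add, ← Real.exp_add]
    refine Real.exp_le_exp.mpr ?_
    nlinarith [mul_le_mul_of_nonneg_left hq hn, mul_nonneg hn hδ]
  refine (pow_le_pow_left₀ (by positivity) h4 m).trans ?_
  rw [← Real.exp_nat_mul]
  refine Real.exp_le_exp.mpr ?_
  nlinarith [mul_le_mul_of_nonneg_left hm (by positivity : (0 : ℝ) ≤ 11 * (n + 1))]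

theorem two_rpow_le {a b : ℝ} (h : a ≤ b) : (2 : ℝ) ^ a ≤ 2 ^ b :=
  Real.rpow_le_rpow_of_exponent_le one_le_two h

theorem crude_pow_le {n : ℕ} {β K : ℝ} (hβ0 : 0 ≤ β) (hβ : β ≤ 1 / 300) (hn : (n : ℝ) ≤ 0.85 * K) :
    (2 / (1 - β)) ^ n ≤ (2 : ℝ) ^ (0.86 * K) := by
  have hn0 : (0 : ℝ) ≤ n := Nat.cast_nonneg n
  rw [div_pow, div_eq_mul_one_div, ← Real.rpow_natCast]
  refine (mul_le_mul_of_nonneg_left ((inv_pow_le_exp hβ0 (by linarith) n).trans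
    (exp_le_two_rpow (by positivity))) (by positivity)).trans ?_
  rw [← Real.rpow_add two_pos]
  refine two_rpow_le ?_
  nlinarith [mul_le_mul_of_nonneg_left hβ hn0]

theorem mul_two_rpow_le {r : ℝ} (hr : 400 ≤ r) : 2 ^ 18 * r ≤ (2 : ℝ) ^ (0.08 * r) := by
  have h1 : (2 : ℝ) ^ (0.08 * r) = 2 ^ 28 * 2 ^ (0.08 * r - 28) := by
    rw [← Real.rpow_natCast, ← Real.rpow_add two_pos]; congr 1; push_cast; ring
  have h2 : (0.08 * r - 28) * 0.6 + 1 ≤ (2 : ℝ) ^ (0.08 * r - 28) := by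
    rw [Real.rpow_def_of_pos two_pos]
    refine le_trans ?_ (Real.add_one_le_exp _)
    nlinarith [Real.log_two_gt_d9]
  rw [h1]
  linarith

/-- Either the bias is at most `2 ^ (-r)`, or `k` is small enough compared to `r` for the second
order term to be at most `2 ^ (-r)`. -/
theorem bias_le {K L r lE lN j β : ℝ} {n : ℕ} (hr : 400 ≤ r) (hK : r ≤ K) (hL : r ≤ L)
    (hn : (n : ℝ) + 1 ≤ 0.85 * K)
    (hE : lE = max 0 (0.75 * r - 0.15 * L + 2.5)) (hN : lN = max 0 (r - 0.14 * K + 2))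
    (hj : j = 2 * r - 3 - lE - lN) (hβ : β = (2 : ℝ) ^ (-j)) :
    (β ≤ (2 : ℝ) ^ (-r) ∨ (n + 1) * β ^ 2 ≤ (2 : ℝ) ^ (-r)) ∧ β ≤ (2 : ℝ) ^ (-(r / 2)) := by
  have hcase : r ≤ j ∨ (K ≤ 8 * r ∧ 0.54 * r - 7.5 ≤ j) := by
    rcases max_cases 0 (0.75 * r - 0.15 * L + 2.5) with ⟨e1, h1⟩ | ⟨e1, h1⟩ <;>
    rcases max_cases 0 (r - 0.14 * K + 2) with ⟨e2, h2⟩ | ⟨e2, h2⟩ <;>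
    rw [e1] at hE <;> rw [e2] at hN
    · left; linarith
    · left; linarith
    · left; linarith
    · right; constructor <;> linarith
  subst hβ
  rcases hcase with h | ⟨h, h'⟩
  · exact ⟨Or.inl (two_rpow_le (by linarith)), two_rpow_le (by linarith)⟩
  · refine ⟨Or.inr ?_, two_rpow_le (by linarith)⟩
    have h1 : ((2 : ℝ) ^ (-j)) ^ 2 ≤ 2 ^ (-r) * 2 ^ (-(0.08 * r)) * 2 ^ 15 := by
      rw [← Real.rpow_natCast, ← Real.rpow_mul two_pos.le, ← Real.rpow_natCast, ← Real.rpow_add two_pos,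
        ← Real.rpow_add two_pos]
      refine two_rpow_le ?_
      push_cast
      linarith
    have h2 := mul_two_rpow_le hr
    have h3 : (2 : ℝ) ^ (0.08 * r) * 2 ^ (-(0.08 * r)) = 1 := by
      rw [← Real.rpow_add two_pos]; simp
    have hp : (0 : ℝ) < 2 ^ (-(0.08 * r)) := by positivity
    have hp' : (0 : ℝ) < 2 ^ (-r) := by positivity
    calc (n + 1) * ((2 : ℝ) ^ (-j)) ^ 2
        ≤ (8 * r) * (2 ^ (-r) * 2 ^ (-(0.08 * r)) * 2 ^ 15) := by
          gcongr
          linarith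
      _ = 2 ^ (-r) * ((2 ^ 18 * r) * 2 ^ (-(0.08 * r))) := by ring
      _ ≤ 2 ^ (-r) * (2 ^ (0.08 * r) * 2 ^ (-(0.08 * r))) := by gcongr
      _ = 2 ^ (-r) := by rw [h3, mul_one]

/-- The total mass of the significant vertices is small. -/
theorem significant_mass_le {c K L r P Q S : ℝ} {n m d : ℕ} (hc : c ≤ 2 / 3)
    (hK : 1000 ≤ K) (hL : 1000 ≤ L) (hr : 400 ≤ r) (hrK : r ≤ K)
    (hn : (n : ℝ) + 1 ≤ 0.85 * K) (hn' : 0.85 * K ≤ n + 2)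
    (hm : (m : ℝ) ≤ 2 ^ r) (hd : (d : ℝ) ≤ 2 ^ (c * K * L))
    (hP0 : 0 ≤ P) (hP : P ≤ Real.exp (11 * (n + 1))) (hQ0 : 0 ≤ Q) (hQ : Q ≤ 2 ^ (0.86 * K))
    (hS0 : 0 ≤ S) (hS : S ≤ 8) :
    ((m : ℝ) + 1) * (d * (P * (1 + m * (Q * S)) / ((2 : ℝ) ^ (0.85 * L)) ^ (n + 1)))
      ≤ 2 ^ (-(r / 2)) := by
  have hn0 : (0 : ℝ) ≤ n := Nat.cast_nonneg n
  have h1 : P ≤ 2 ^ (15 * K) :=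
    hP.trans ((exp_le_two_rpow (by positivity)).trans (two_rpow_le (by linarith)))
  have hp1 : (1 : ℝ) ≤ 2 ^ (r + 0.86 * K + 3) := Real.one_le_rpow one_le_two (by linarith)
  have h2 : 1 + m * (Q * S) ≤ 2 ^ (r + 0.86 * K + 4) := by
    have e : (2 : ℝ) ^ (r + 0.86 * K + 4) = 2 * 2 ^ (r + 0.86 * K + 3) := by
      rw [show r + 0.86 * K + 4 = 1 + (r + 0.86 * K + 3) by ring, Real.rpow_add two_pos,
        Real.rpow_one]
    have : m * (Q * S) ≤ 2 ^ (r + 0.86 * K + 3) := by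
      have e3 : (2 : ℝ) ^ (r + 0.86 * K + 3) = 2 ^ r * (2 ^ (0.86 * K) * 8) := by
        rw [Real.rpow_add two_pos, Real.rpow_add two_pos, mul_assoc]; norm_num
      rw [e3]
      gcongr
    linarith
  have h3 : (2 : ℝ) ^ (0.7225 * K * L - 0.85 * L) ≤ ((2 : ℝ) ^ (0.85 * L)) ^ (n + 1) := by
    rw [← Real.rpow_natCast, ← Real.rpow_mul two_pos.le]
    refine two_rpow_le ?_
    push_cast
    nlinarith
  have h4 : (m : ℝ) + 1 ≤ 2 ^ (r + 1) := by
    rw [Real.rpow_add two_pos, Real.rpow_one]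
    have : (1 : ℝ) ≤ 2 ^ r := Real.one_le_rpow one_le_two (by linarith)
    linarith
  have hm0 : (0 : ℝ) ≤ m := Nat.cast_nonneg m
  calc _ ≤ (2 : ℝ) ^ (r + 1) * (2 ^ (c * K * L)
        * (2 ^ (15 * K) * 2 ^ (r + 0.86 * K + 4) / 2 ^ (0.7225 * K * L - 0.85 * L))) := by
        gcongr
    _ = 2 ^ (r + 1 + (c * K * L + (15 * K + (r + 0.86 * K + 4)
          - (0.7225 * K * L - 0.85 * L)))) := by
        simp only [Real.rpow_add two_pos, Real.rpow_sub two_pos]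
    _ ≤ 2 ^ (-(r / 2)) := by
        refine two_rpow_le ?_
        have hKL : c * K * L ≤ 2 / 3 * (K * L) := by
          rw [mul_assoc]
          exact mul_le_mul_of_nonneg_right hc (by nlinarith)
        have h5 : 1000 * K ≤ K * L := by nlinarith
        have h6 : 1000 * L ≤ K * L := by nlinarith
        linarith

end Parameters

section Extractor

variable {A X : Type*} [Fintype A] [Fintype X] {m d : ℕ}
variable {B : BranchingProgram A (A → ℝ) m d} {M : A → X → ℝ}

theorem one_add_pow_le {h ρ : ℝ} (hh0 : 0 ≤ h) (hh1 : h ≤ 2 * ρ ^ 2) (hm : m * ρ ^ 2 ≤ 1) :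
    (1 + h) ^ m ≤ 8 :=
  calc (1 + h) ^ m ≤ Real.exp h ^ m :=
        pow_le_pow_left₀ (by positivity) (by linarith [Real.add_one_le_exp h]) m
    _ = Real.exp (m * h) := (Real.exp_nat_mul _ _).symm
    _ ≤ Real.exp (2 * 1) := by
        refine Real.exp_le_exp.mpr ?_
        linarith [mul_le_mul_of_nonneg_left hh1 (Nat.cast_nonneg (α := ℝ) m)]
    _ ≤ 8 := by
        rw [two_mul, Real.exp_add]
        nlinarith [Real.exp_one_lt_d9, Real.exp_pos 1]

theorem second_moment_le {L r lE : ℝ} (hL : 1000 ≤ L) (hlE : 0.75 * r - 0.15 * L + 2.5 ≤ lE) :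
    1 + ((2 : ℝ) ^ (-lE)) ^ 2 * (16 * ((2 : ℝ) ^ (0.85 * L)) ^ 2 / 2 ^ (-(1.5 * r)))
      ≤ ((2 : ℝ) ^ L) ^ 2 := by
  have e1 : ((2 : ℝ) ^ L) ^ 2 = 2 * 2 ^ (2 * L - 1) := by
    rw [← Real.rpow_natCast, ← Real.rpow_mul two_pos.le, ← Real.rpow_one_add' two_pos.le
      (by linarith)]
    congr 1; push_cast; ring
  have e2 : (1 : ℝ) ≤ 2 ^ (2 * L - 1) := Real.one_le_rpow one_le_two (by linarith)
  have e3 : ((2 : ℝ) ^ (-lE)) ^ 2 * (16 * ((2 : ℝ) ^ (0.85 * L)) ^ 2 / 2 ^ (-(1.5 * r)))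
      = 2 ^ (4 + 1.7 * L + 1.5 * r - 2 * lE) := by
    rw [show (16 : ℝ) = 2 ^ (4 : ℝ) by norm_num, ← Real.rpow_natCast,
      ← Real.rpow_natCast, ← Real.rpow_mul two_pos.le, ← Real.rpow_mul two_pos.le,
      ← Real.rpow_add two_pos, ← Real.rpow_sub two_pos, ← Real.rpow_add two_pos]
    congr 1; push_cast; ring
  have e4 : (2 : ℝ) ^ (4 + 1.7 * L + 1.5 * r - 2 * lE) ≤ 2 ^ (2 * L - 1) :=
    two_rpow_le (by linarith)
  linarith

theorem error_term_le {h ρ κ ε S : ℝ} (hρ : 0 ≤ ρ) (hh0 : 0 ≤ h) (hh1 : h ≤ 2 * ρ ^ 2)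
    (hκ : κ ≤ ρ ^ 3) (hε : ε ≤ 7 * ρ) (hS0 : 0 ≤ S) (hS : S ≤ 8)
    (hm : m * ρ ^ 2 ≤ 1) : m * ((ρ ^ 3 + κ + ε * h) * S) ≤ 128 * ρ := by
  have h1 : ρ ^ 3 + κ + ε * h ≤ 16 * ρ ^ 3 := by
    linarith [mul_le_mul hε hh1 hh0 (by positivity)]
  calc m * ((ρ ^ 3 + κ + ε * h) * S) ≤ m * ((16 * ρ ^ 3) * 8) := by gcongr
    _ = (m * ρ ^ 2) * (128 * ρ) := by ring
    _ ≤ 1 * (128 * ρ) := by gcongr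
    _ = _ := one_mul _

theorem hypValue_le_of_extractor [Nonempty X] [Nonempty A] {c K L R r : ℝ}
    (hM : ∀ a x, M a x = 1 ∨ M a x = -1) (hE : IsL2Extractor M K L R)
    (hB : ∀ t v a, B.label t v a = 1 ∨ B.label t v a = -1) (hc : c ≤ 2 / 3)
    (hK : 1000 ≤ K) (hL : 1000 ≤ L) (hr : 400 ≤ r) (hrR : 2 * r ≤ R) (hrK : r ≤ K) (hrL : r ≤ L)
    (hm : (m : ℝ) ≤ 2 ^ r) (hd : (d : ℝ) ≤ 2 ^ (c * K * L)) :
    B.hypValue M ≤ 200 * (2 : ℝ) ^ (-(r / 2)) := by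
  obtain ⟨n, hn, hn'⟩ : ∃ n : ℕ, (n : ℝ) + 1 ≤ 0.85 * K ∧ 0.85 * K ≤ n + 2 := by
    have h1 : 1 ≤ ⌊0.85 * K⌋₊ := Nat.le_floor (by push_cast; linarith)
    refine ⟨⌊0.85 * K⌋₊ - 1, ?_, ?_⟩ <;> rw [Nat.cast_sub h1, Nat.cast_one]
    · linarith [Nat.floor_le (by linarith : 0 ≤ 0.85 * K)]
    · linarith [Nat.lt_floor_add_one (0.85 * K)]
  obtain ⟨lE, hlE⟩ : ∃ l, l = max 0 (0.75 * r - 0.15 * L + 2.5) := ⟨_, rfl⟩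
  obtain ⟨lN, hlN⟩ : ∃ l, l = max 0 (r - 0.14 * K + 2) := ⟨_, rfl⟩
  have hlE0 : 0 ≤ lE := hlE ▸ le_max_left _ _
  have hlE1 : 0.75 * r - 0.15 * L + 2.5 ≤ lE := hlE ▸ le_max_right _ _
  have hlN0 : 0 ≤ lN := hlN ▸ le_max_left _ _
  have hlN1 : r - 0.14 * K + 2 ≤ lN := hlN ▸ le_max_right _ _
  obtain ⟨N, hN1, hN2⟩ : ∃ N : ℕ, (2 : ℝ) ^ lN ≤ N ∧ (N : ℝ) ≤ 2 ^ (lN + 1) := by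
    refine ⟨⌈(2 : ℝ) ^ lN⌉₊, Nat.le_ceil _, ?_⟩
    have h1 : (1 : ℝ) ≤ 2 ^ lN := Real.one_le_rpow one_le_two hlN0
    rw [Real.rpow_add two_pos, Real.rpow_one]
    linarith [Nat.ceil_lt_add_one (by positivity : (0 : ℝ) ≤ 2 ^ lN)]
  have hN0 : (0 : ℝ) < N := lt_of_lt_of_le (by positivity) hN1
  obtain ⟨β, hβ⟩ : ∃ β, β = (2 : ℝ) ^ (-(2 * r - 3 - lE - lN)) := ⟨_, rfl⟩
  have hβ0 : 0 < β := hβ ▸ by positivity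
  obtain ⟨hβ1, hβ2⟩ := bias_le hr hrK hrL hn hlE hlN rfl hβ
  obtain ⟨ρ, hρ⟩ : ∃ ρ, ρ = (2 : ℝ) ^ (-(r / 2)) := ⟨_, rfl⟩
  have hρ0 : 0 < ρ := hρ ▸ by positivity
  have hρ1 : ρ ≤ 1 / 300 := by
    rw [hρ]
    refine (two_rpow_le (by linarith : -(r / 2) ≤ -9)).trans ?_
    rw [Real.rpow_neg two_pos.le]
    norm_num
  have hδ : (2 : ℝ) ^ (-r) = ρ ^ 2 := by
    rw [hρ, ← Real.rpow_natCast, ← Real.rpow_mul two_pos.le]; congr 1; push_cast; ring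
  have hmρ : m * ρ ^ 2 ≤ 1 := by
    rw [← hδ, Real.rpow_neg two_pos.le, ← div_eq_mul_inv]
    exact (div_le_one (by positivity)).mpr hm
  have hq : (2 : ℝ) ^ (-(1.5 * r)) = ρ ^ 3 := by
    rw [hρ, ← Real.rpow_natCast, ← Real.rpow_mul two_pos.le]; congr 1; push_cast; ring
  rw [hδ] at hβ1
  rw [← hρ] at hβ2 ⊢
  have h32 : ρ ^ 3 ≤ ρ ^ 2 := pow_le_pow_of_le_one hρ0.le (by linarith) (by norm_num)
  have h21 : ρ ^ 2 ≤ ρ := by nlinarith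
  have h2K : (2 : ℝ) ^ (-K) ≤ ρ ^ 2 := hδ ▸ two_rpow_le (by linarith)
  obtain ⟨h, hh⟩ : ∃ h, h = 2 * (2 : ℝ) ^ (-K) := ⟨_, rfl⟩
  have hh0 : 0 ≤ h := hh ▸ by positivity
  obtain ⟨κ, hκ⟩ : ∃ κ, κ = 3 * (2 : ℝ) ^ (-K) / N := ⟨_, rfl⟩
  have hκ0 : 0 ≤ κ := hκ ▸ by positivity
  have hκ1 : κ ≤ 2 ^ (-(0.86 * K) - r) := by
    rw [hκ, div_le_iff₀ hN0]
    calc 3 * (2 : ℝ) ^ (-K) ≤ 2 ^ 2 * 2 ^ (-K) := by gcongr; norm_num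
      _ ≤ 2 ^ (-(0.86 * K) - r) * 2 ^ lN := by
          rw [← Real.rpow_two, ← Real.rpow_add two_pos, ← Real.rpow_add two_pos]
          exact two_rpow_le (by linarith)
      _ ≤ _ := by gcongr
  have hκ3 : κ ≤ ρ ^ 3 := hκ1.trans (hq ▸ two_rpow_le (by linarith))
  have hD := crude_pow_le (K := K) hβ0.le (hβ2.trans hρ1) (by linarith : (n : ℝ) ≤ 0.85 * K)
  have hD0 : 0 ≤ (2 / (1 - β)) ^ n := pow_nonneg (div_nonneg two_pos.le (by linarith)) _
  have hκD : κ * (2 / (1 - β)) ^ n ≤ ρ ^ 2 := by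
    refine (mul_le_mul hκ1 hD hD0 (by positivity)).trans ?_
    rw [← Real.rpow_add two_pos, ← hδ]
    exact two_rpow_le (by linarith)
  have hh1 : h ≤ 2 * ρ ^ 2 := hh ▸ by linarith only [h2K]
  have hS := one_add_pow_le hh0 hh1 hmρ
  have hT : (1 : ℝ) ≤ 2 ^ (0.85 * L) := Real.one_le_rpow one_le_two (by linarith)
  obtain ⟨H, hH, hU⟩ := exists_exceptional_rows (Λ := 16 * ((2 : ℝ) ^ (0.85 * L)) ^ 2 / ρ ^ 3)
    (η := (2 : ℝ) ^ (-lE)) (β := β) (N := N) hE (by positivity)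
    (Real.rpow_le_one_of_one_le_of_nonpos one_le_two (by linarith)) (by
      rw [← hq]; exact second_moment_le hL hlE1) (by positivity) (by exact_mod_cast hN0) (by
      calc 4 * (2 : ℝ) ^ (-R) * N ≤ 2 ^ (2 : ℝ) * 2 ^ (-R) * 2 ^ (lN + 1) := by
            gcongr; norm_num
        _ ≤ _ := by
            rw [hβ, ← Real.rpow_add two_pos, ← Real.rpow_add two_pos, ← Real.rpow_add two_pos]
            exact two_rpow_le (by linarith))
  rw [← hκ] at hU
  rw [← hh] at hH
  have hmain := hypValue_le_of_unbiased hM hB hT hβ0.le (by linarith) (by positivity : 0 < ρ ^ 3)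
    (by linarith) hκ0 hh0 (cosh_mul_exp_le hβ0.le (by linarith) (sq_nonneg ρ) hβ1) le_rfl
    hH hU rfl rfl
  have hq1 : 0 < 1 - ρ ^ 3 := by linarith
  have hsig := significant_mass_le hc hK hL hr hrK hn hn' hm hd
    (pow_nonneg (div_nonneg (add_nonneg (add_nonneg (by positivity) (Real.exp_pos _).le)
      (mul_nonneg hκ0 hD0)) (pow_nonneg hq1.le n)) m)
    (growth_pow_le (sq_nonneg ρ) hh0 hh1 (mul_nonneg hκ0 hD0) hκD (by positivity) h32
      (by linarith) hmρ) hD0 hD (by positivity : 0 ≤ (1 + h) ^ m) hS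
  rw [← hρ] at hsig
  have hε : 3 * ρ ^ 3 + β + κ + h ≤ 7 * ρ := by linarith
  have hmid := error_term_le hρ0.le hh0 hh1 hκ3 hε
    (by positivity) hS hmρ
  linarith only [hmain, hsig, hmid, hε, hρ0]

end Extractor

end WeakLearning

/-- **Theorem (weak-learning lower bound, Theorem 2 of the paper).**
Under the same conditions as the main theorem, a branching program whose
leaves are labeled by hypotheses `h_v : A → {-1,1}` satisfies
`E[|⟨h_v, M^{(x)}⟩|] ≤ C₁ · 2^{-r/2}`. -/
theorem weak_learning_lower_bound (c γ : ℝ)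
    (hc₁ : 1 / 100 < c) (hc₂ : c < 2 / 3)
    (hγ₁ : 3 * c / 2 < γ ^ 2) (hγ₂ : γ ^ 2 < 1) :
    ∃ C₀ C₁ : ℝ, 0 < C₀ ∧ 0 < C₁ ∧
      ∀ (A X : Type) [Fintype A] [Fintype X] (M : A → X → ℝ),
        (∀ a x, M a x = 1 ∨ M a x = -1) →
        1 < Fintype.card A → 1 < Fintype.card X →
        ∀ k' ℓ' r' r : ℝ,
          C₀ ≤ k' → C₀ ≤ ℓ' → C₀ ≤ r' →
          ℓ' ≤ Real.logb 2 (Fintype.card X) →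
          IsL2Extractor M k' ℓ' r' →
          r = min (r' / 2) (min ((1 - γ) * k' / 2) ((1 - γ) * ℓ' / 2 - 1)) →
          ∀ m d : ℕ, (m : ℝ) ≤ (2 : ℝ) ^ r →
            (d : ℝ) ≤ (2 : ℝ) ^ (c * k' * ℓ') →
            ∀ B : BranchingProgram A (A → ℝ) m d,
              (∀ t v a, B.label t v a = 1 ∨ B.label t v a = -1) →
              B.hypValue M ≤ C₁ * (2 : ℝ) ^ (-(r / 2)) := by
  obtain ⟨hγ, hγ'⟩ := abs_lt.mp (sq_lt_one_iff_abs_lt_one γ |>.mp hγ₂)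
  have hγ0 : 0 < 1 - γ := sub_pos.mpr hγ'
  refine ⟨max 1000 (802 / (1 - γ)), 200, by positivity, by norm_num, ?_⟩
  intro A X _ _ M hM hA hX k ℓ r' r hk hℓ hr' _ hE hr m d hm hd B hB
  have : Nonempty A := Fintype.card_pos_iff.mp (by omega)
  have : Nonempty X := Fintype.card_pos_iff.mp (by omega)
  obtain ⟨hk1, hk2⟩ := max_le_iff.mp hk
  obtain ⟨hℓ1, hℓ2⟩ := max_le_iff.mp hℓ
  rw [div_le_iff₀ hγ0] at hk2 hℓ2
  have hr1 : r ≤ r' / 2 := hr ▸ min_le_left _ _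
  have hr2 : r ≤ (1 - γ) * k / 2 := hr ▸ (min_le_right _ _).trans (min_le_left _ _)
  have hr3 : r ≤ (1 - γ) * ℓ / 2 - 1 := hr ▸ (min_le_right _ _).trans (min_le_right _ _)
  refine WeakLearning.hypValue_le_of_extractor hM hE hB hc₂.le hk1 hℓ1 ?_ (by linarith)
    (by nlinarith) (by nlinarith) hm hd
  rw [hr]
  refine le_min ?_ (le_min ?_ ?_) <;> linarith [(max_le_iff.mp hr').1]
end

section
/- Suppose M : A × X → {-1,1} (A, X finite sets) is a (k',ℓ')-L₂-extractor with error 2^{-r}. Let f : X → ℝ be any function (possibly taking negative values) that is not identically zero and satisfies ‖f‖₂ ≤ 2^{ℓ'−r}·‖f‖₁. Then there are at most 2·2^{-k'}·|A| elements a ∈ A with |⟨M_a, f⟩| ≥ 2·2^{-r}·‖f‖₁. -/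
open Finset

attribute [local instance] Classical.propDecidable

lemma expE_mono {X : Type*} [Fintype X] {f g : X → ℝ} (h : ∀ x, f x ≤ g x) :
    expE f ≤ expE g :=
  div_le_div_of_nonneg_right (sum_le_sum fun x _ => h x) (Nat.cast_nonneg _)

lemma abs_expE_le {X : Type*} [Fintype X] (f : X → ℝ) : |expE f| ≤ expE (fun x => |f x|) := by
  unfold expE
  rw [abs_div, Nat.abs_cast]
  exact div_le_div_of_nonneg_right (abs_sum_le_sum_abs _ _) (Nat.cast_nonneg _)

lemma nInner_sub {X : Type*} [Fintype X] (m f g : X → ℝ) :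
    nInner m (fun x => f x - g x) = nInner m f - nInner m g := by
  simp only [nInner, expE, mul_sub, sum_sub_distrib, sub_div]

lemma nNorm1_pos {X : Type*} [Fintype X] {f : X → ℝ} (hf : f ≠ 0) : 0 < nNorm1 f := by
  obtain ⟨x, hx⟩ := Function.ne_iff.mp hf
  have : Nonempty X := ⟨x⟩
  exact div_pos (sum_pos' (fun y _ => abs_nonneg _) ⟨x, mem_univ x, abs_pos.mpr hx⟩)
    (Nat.cast_pos.mpr Fintype.card_pos)

lemma nNorm1_mono {X : Type*} [Fintype X] {f g : X → ℝ} (h : ∀ x, |g x| ≤ |f x|) :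
    nNorm1 g ≤ nNorm1 f :=
  expE_mono h

lemma nNorm2_mono {X : Type*} [Fintype X] {f g : X → ℝ} (h : ∀ x, |g x| ≤ |f x|) :
    nNorm2 g ≤ nNorm2 f :=
  Real.sqrt_le_sqrt (expE_mono fun x => sq_le_sq.mpr (h x))

lemma abs_nInner_le_nNorm1 {X : Type*} [Fintype X] {m : X → ℝ} (hm : ∀ x, m x = 1 ∨ m x = -1)
    (g : X → ℝ) : |nInner m g| ≤ nNorm1 g := by
  refine (abs_expE_le _).trans (expE_mono fun x => ?_)
  rcases hm x with h | h <;> simp [h]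

/-- A non-negative function dominated by `|f|` has few rows with correlation at least
`2^{-r}·‖f‖₁`. If its `ℓ₁`-norm is below that threshold there are no such rows; otherwise the
extractor property applies to it. -/
lemma IsL2Extractor.card_filter_le_of_dominated {A X : Type*} [Fintype A] [Fintype X]
    {M : A → X → ℝ} (hM : ∀ a x, M a x = 1 ∨ M a x = -1)
    {k ℓ r : ℝ} (hext : IsL2Extractor M k ℓ r)
    {f : X → ℝ} (hf : f ≠ 0) (hf2 : nNorm2 f ≤ (2 : ℝ) ^ (ℓ - r) * nNorm1 f)
    {g : X → ℝ} (hg : ∀ x, 0 ≤ g x) (hgf : ∀ x, |g x| ≤ |f x|) :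
    ((univ.filter (fun a : A => (2 : ℝ) ^ (-r) * nNorm1 f ≤ |nInner (M a) g|)).card : ℝ)
      ≤ (2 : ℝ) ^ (-k) * (Fintype.card A) := by
  have hr : (0 : ℝ) < 2 ^ (-r) := by positivity
  have hthreshold : 0 < (2 : ℝ) ^ (-r) * nNorm1 f := mul_pos hr (nNorm1_pos hf)
  rcases lt_or_ge (nNorm1 g) ((2 : ℝ) ^ (-r) * nNorm1 f) with hlt | hge
  · rw [filter_false_of_mem fun a _ =>
      not_le.mpr ((abs_nInner_le_nNorm1 (hM a) g).trans_lt hlt)]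
    simp only [card_empty, Nat.cast_zero]
    positivity
  · have hg0 : g ≠ 0 := by
      rintro rfl
      simp only [nNorm1, expE, Pi.zero_apply, abs_zero, sum_const_zero, zero_div] at hge
      exact hge.not_gt hthreshold
    have hg2 : nNorm2 g ≤ (2 : ℝ) ^ ℓ * nNorm1 g :=
      calc nNorm2 g ≤ nNorm2 f := nNorm2_mono hgf
        _ ≤ (2 : ℝ) ^ (ℓ - r) * nNorm1 f := hf2
        _ = (2 : ℝ) ^ ℓ * ((2 : ℝ) ^ (-r) * nNorm1 f) := by
          rw [sub_eq_add_neg, Real.rpow_add two_pos, mul_assoc]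
        _ ≤ (2 : ℝ) ^ ℓ * nNorm1 g := by gcongr
    refine le_trans (Nat.cast_le.mpr (card_le_card ?_)) (hext g hg hg0 hg2)
    exact monotone_filter_right _ fun a _ ha =>
      (mul_le_mul_of_nonneg_left (nNorm1_mono hgf) hr.le).trans ha

/-- **Lemma (handling negative functions).**
If `M` is a `(k',ℓ')`-L₂-extractor with error `2^{-r}`, and `f : X → ℝ` is any
(possibly negative) nonzero function with `‖f‖₂ ≤ 2^{ℓ'-r}·‖f‖₁`, then there
are at most `2·2^{-k'}·|A|` rows `a` with `|⟨M_a, f⟩| ≥ 2·2^{-r}·‖f‖₁`. -/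
theorem l2Extractor_negative_functions {A X : Type*} [Fintype A] [Fintype X]
    (M : A → X → ℝ) (hM : ∀ a x, M a x = 1 ∨ M a x = -1)
    (k' ℓ' r : ℝ) (hext : IsL2Extractor M k' ℓ' r)
    (f : X → ℝ) (hf : f ≠ 0)
    (hf2 : nNorm2 f ≤ (2 : ℝ) ^ (ℓ' - r) * nNorm1 f) :
    ((Finset.univ.filter
        (fun a : A => 2 * (2 : ℝ) ^ (-r) * nNorm1 f ≤ |nInner (M a) f|)).card : ℝ)
      ≤ 2 * (2 : ℝ) ^ (-k') * (Fintype.card A : ℝ) := by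
  have hpos := hext.card_filter_le_of_dominated hM hf hf2 (g := fun x => max (f x) 0)
    (fun x => le_max_right _ _)
    (fun x => by
      rw [abs_of_nonneg (le_max_right _ _)]
      exact max_le (le_abs_self _) (abs_nonneg _))
  have hneg := hext.card_filter_le_of_dominated hM hf hf2 (g := fun x => max (-f x) 0)
    (fun x => le_max_right _ _)
    (fun x => by
      rw [abs_of_nonneg (le_max_right _ _)]
      exact max_le (neg_le_abs _) (abs_nonneg _))
  have hsplit : ∀ a, nInner (M a) f =
      nInner (M a) (fun x => max (f x) 0) - nInner (M a) (fun x => max (-f x) 0) := fun a => by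
    rw [← nInner_sub]
    simp only [max_zero_sub_max_neg_zero_eq_self]
  rw [mul_assoc 2 ((2 : ℝ) ^ (-k')), two_mul ((2 : ℝ) ^ (-k') * _)]
  refine le_trans ?_ (add_le_add hpos hneg)
  rw [← Nat.cast_add]
  refine Nat.cast_le.mpr (le_trans (card_le_card fun a ha => ?_) (card_union_le _ _))
  simp only [mem_union, mem_filter, mem_univ, true_and] at ha ⊢
  rw [hsplit] at ha
  by_contra! hsmall
  linarith [abs_sub (nInner (M a) (fun x => max (f x) 0))
    (nInner (M a) (fun x => max (-f x) 0)), hsmall.1, hsmall.2]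
end

section
/- Let A and X be finite sets and M : A × X → {-1,1}. Let k ≥ 1, ℓ > 0 and r ≥ 8 be reals, and assume 2^{-k}·|A| ≥ 1. Suppose that every submatrix of M consisting of at least 2^{-k}·|A| rows and at least 2^{-ℓ}·|X| columns has bias at most 2^{-r}. Then every submatrix of M consisting of at least 2^{-(k + r/10)}·|A| rows and at least 2^{-ℓ}·|X| columns has bias at most 2^{-r/2}. -/
open Finset

attribute [local instance] Classical.propDecidable

/-- The bias of the submatrix of `M` with rows `T` and columns `S`. -/
noncomputable def matrixBias {A X : Type*} (M : A → X → ℝ)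
    (T : Finset A) (S : Finset X) : ℝ :=
  |∑ a ∈ T, ∑ x ∈ S, M a x| / ((T.card : ℝ) * (S.card : ℝ))

/-- A bound on the bias is a bound on the absolute value of the sum of the entries. -/
theorem abs_sum_le_of_matrixBias_le {A X : Type*} {M : A → X → ℝ}
    {T : Finset A} {S : Finset X} (hT : T.Nonempty) (hS : S.Nonempty) {ε : ℝ}
    (h : matrixBias M T S ≤ ε) :
    |∑ a ∈ T, ∑ x ∈ S, M a x| ≤ ε * ((T.card : ℝ) * (S.card : ℝ)) := by
  have hT0 : (0 : ℝ) < T.card := by exact_mod_cast hT.card_pos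
  have hS0 : (0 : ℝ) < S.card := by exact_mod_cast hS.card_pos
  exact (div_le_iff₀ (mul_pos hT0 hS0)).1 h

/-- If `r ≥ 8`, the loss factor `4 · 2^{r/10} + 1` is absorbed by `2^{r/2}`. -/
theorem four_mul_two_rpow_add_one_le {r : ℝ} (hr : 8 ≤ r) :
    4 * (2 : ℝ) ^ (r / 10) + 1 ≤ (2 : ℝ) ^ (r / 2) := by
  have h1 : (1 : ℝ) ≤ (2 : ℝ) ^ (r / 10) :=
    Real.one_le_rpow (by norm_num) (by linarith)
  have h2 : (8 : ℝ) ≤ (2 : ℝ) ^ (2 * r / 5) := by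
    calc (8 : ℝ) = (2 : ℝ) ^ (3 : ℝ) := by norm_num
      _ ≤ (2 : ℝ) ^ (2 * r / 5) :=
        Real.rpow_le_rpow_of_exponent_le (by norm_num) (by linarith)
  have h3 : (2 : ℝ) ^ (r / 2) = (2 : ℝ) ^ (2 * r / 5) * (2 : ℝ) ^ (r / 10) := by
    rw [← Real.rpow_add (by norm_num)]
    ring_nf
  rw [h3]
  nlinarith

/-- **Lemma (error vs. min-entropy, one-sided step).**
If every submatrix of `M` with at least `2^{-k}·|A|` rows and at least
`2^{-ℓ}·|X|` columns has bias at most `2^{-r}` (where `k ≥ 1`, `ℓ > 0`,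
`r ≥ 8` and `2^{-k}·|A| ≥ 1`), then every submatrix with at least
`2^{-(k+r/10)}·|A|` rows and at least `2^{-ℓ}·|X|` columns has bias at most
`2^{-r/2}`. -/
theorem bias_minEntropy_step {A X : Type*} [Fintype A] [Fintype X]
    (M : A → X → ℝ) (hM : ∀ a x, M a x = 1 ∨ M a x = -1)
    (k ℓ r : ℝ) (hk : 1 ≤ k) (hℓ : 0 < ℓ) (hr : 8 ≤ r)
    (hkA : (1 : ℝ) ≤ (2 : ℝ) ^ (-k) * (Fintype.card A : ℝ))
    (hbias : ∀ (T : Finset A) (S : Finset X), T.Nonempty → S.Nonempty →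
      (2 : ℝ) ^ (-k) * (Fintype.card A : ℝ) ≤ T.card →
      (2 : ℝ) ^ (-ℓ) * (Fintype.card X : ℝ) ≤ S.card →
      matrixBias M T S ≤ (2 : ℝ) ^ (-r)) :
    ∀ (T : Finset A) (S : Finset X), T.Nonempty → S.Nonempty →
      (2 : ℝ) ^ (-(k + r / 10)) * (Fintype.card A : ℝ) ≤ T.card →
      (2 : ℝ) ^ (-ℓ) * (Fintype.card X : ℝ) ≤ S.card →
      matrixBias M T S ≤ (2 : ℝ) ^ (-(r / 2)) := by
  intro T S hT hS hTc hSc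
  rcases le_or_gt ((2 : ℝ) ^ (-k) * (Fintype.card A : ℝ)) T.card with hle | hlt
  · exact (hbias T S hT hS hle hSc).trans
      (Real.rpow_le_rpow_of_exponent_le (by norm_num) (by linarith))
  set K : ℝ := (2 : ℝ) ^ (-k) * (Fintype.card A : ℝ) with hK
  have hAK : 2 * K ≤ Fintype.card A := by
    have h : (2 : ℝ) ^ (-k) ≤ (2 : ℝ) ^ (-1 : ℝ) :=
      Real.rpow_le_rpow_of_exponent_le (by norm_num) (by linarith)
    rw [Real.rpow_neg_one] at h
    have hA : (0 : ℝ) ≤ Fintype.card A := Nat.cast_nonneg _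
    nlinarith
  have hKN : K ≤ (⌈K⌉₊ : ℝ) := Nat.le_ceil K
  have hNK : (⌈K⌉₊ : ℝ) ≤ 2 * K := by
    have := Nat.ceil_lt_add_one (show 0 ≤ K by linarith)
    linarith
  have hcompl : ⌈K⌉₊ ≤ (univ \ T).card := by
    have h : ((univ \ T).card : ℝ) + T.card = Fintype.card A := by
      exact_mod_cast card_sdiff_add_card_eq_card (subset_univ T)
    exact Nat.ceil_le.2 (by linarith)
  obtain ⟨U, hU, hUc⟩ := exists_subset_card_eq hcompl
  have hdisj : Disjoint T U := (disjoint_sdiff (s := T)).mono_right hU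
  have hUcard : (U.card : ℝ) = ⌈K⌉₊ := by rw [hUc]
  have hTUcard : ((T ∪ U).card : ℝ) = T.card + ⌈K⌉₊ := by
    rw [card_union_of_disjoint hdisj, Nat.cast_add, hUcard]
  have hUne : U.Nonempty := by
    rw [← card_pos, hUc]
    exact Nat.ceil_pos.2 (by linarith)
  have hTUne : (T ∪ U).Nonempty := hT.mono subset_union_left
  have hT0 : (0 : ℝ) < T.card := by exact_mod_cast hT.card_pos
  have hS0 : (0 : ℝ) < S.card := by exact_mod_cast hS.card_pos
  have hUsum := abs_sum_le_of_matrixBias_le hUne hS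
    (hbias U S hUne hS (by rw [hUcard]; exact hKN) hSc)
  have hTUsum := abs_sum_le_of_matrixBias_le hTUne hS
    (hbias (T ∪ U) S hTUne hS (by rw [hTUcard]; linarith) hSc)
  rw [hUcard] at hUsum
  rw [sum_union hdisj, hTUcard] at hTUsum
  have hTsum : |∑ a ∈ T, ∑ x ∈ S, M a x|
      ≤ (2 : ℝ) ^ (-r) * ((T.card + 2 * ⌈K⌉₊) * S.card) := by
    rw [abs_le] at hUsum hTUsum ⊢
    constructor <;> linarith
  have hKT : K ≤ (2 : ℝ) ^ (r / 10) * T.card := by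
    calc K = (2 : ℝ) ^ (r / 10) * ((2 : ℝ) ^ (-(k + r / 10)) * Fintype.card A) := by
          rw [hK, ← mul_assoc, ← Real.rpow_add (by norm_num)]
          ring_nf
      _ ≤ _ := by gcongr
  have hsize : (T.card : ℝ) + 2 * ⌈K⌉₊ ≤ (2 : ℝ) ^ (r / 2) * T.card := by
    have h := mul_le_mul_of_nonneg_right (four_mul_two_rpow_add_one_le hr) hT0.le
    linarith
  have hexp : (2 : ℝ) ^ (-r) * (2 : ℝ) ^ (r / 2) = (2 : ℝ) ^ (-(r / 2)) := by
    rw [← Real.rpow_add (by norm_num)]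
    ring_nf
  rw [matrixBias, div_le_iff₀ (mul_pos hT0 hS0)]
  calc _ ≤ (2 : ℝ) ^ (-r) * ((T.card + 2 * ⌈K⌉₊) * S.card) := hTsum
    _ ≤ (2 : ℝ) ^ (-r) * ((2 : ℝ) ^ (r / 2) * T.card * S.card) := by gcongr
    _ = (2 : ℝ) ^ (-(r / 2)) * (T.card * S.card) := by
      rw [← hexp]
      ring
end

section
/- If a matrix M : A × X → {-1,1} (A, X finite sets) is a (k,ℓ)-L₂-extractor with error 2^{-r}, then for every ξ with 0 < ξ < k, M is a (k−ξ, 2ℓ ∼ min{r,ξ}−1)-L∞-extractor. -/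
open Finset

attribute [local instance] Classical.propDecidable

/-- `M` is a `(k, ℓ ∼ r)`-L∞-extractor: for all probability distributions
`p_a` on `A` with min-entropy at least `log₂|A| - k` and `p_x` on `X` with
min-entropy at least `log₂|X| - ℓ`, the `(p_a, p_x)`-average of `M` has
absolute value at most `2^{-r}`. -/
def IsLinfExtractor {A X : Type*} [Fintype A] [Fintype X]
    (M : A → X → ℝ) (k ℓ r : ℝ) : Prop :=
  ∀ pa : A → ℝ, (∀ a, 0 ≤ pa a) → (∑ a, pa a) = 1 →
    (∀ a, pa a ≤ (2 : ℝ) ^ (-(Real.logb 2 (Fintype.card A) - k))) →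
  ∀ px : X → ℝ, (∀ x, 0 ≤ px x) → (∑ x, px x) = 1 →
    (∀ x, px x ≤ (2 : ℝ) ^ (-(Real.logb 2 (Fintype.card X) - ℓ))) →
    |∑ a, ∑ x, pa a * px x * M a x| ≤ (2 : ℝ) ^ (-r)

lemma two_rpow_neg_logb_sub {n : ℝ} (hn : 0 < n) (t : ℝ) :
    (2 : ℝ) ^ (-(Real.logb 2 n - t)) = 2 ^ t / n := by
  rw [neg_sub, Real.rpow_sub two_pos, Real.rpow_logb two_pos (by norm_num) hn]

lemma nNorm1_eq_of_sum_eq_one {X : Type*} [Fintype X] {p : X → ℝ} (hp : ∀ x, 0 ≤ p x)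
    (hsum : ∑ x, p x = 1) : nNorm1 p = 1 / Fintype.card X := by
  simp only [nNorm1, expE, abs_of_nonneg (hp _), hsum]

/-- A distribution with min-entropy at least `log₂|X| - 2ℓ` has `ℓ₂`-to-`ℓ₁` ratio at most
`2^ℓ`. -/
lemma nNorm2_le_of_le_rpow {X : Type*} [Fintype X] [Nonempty X] {p : X → ℝ} {ℓ : ℝ}
    (hp : ∀ x, 0 ≤ p x) (hsum : ∑ x, p x = 1)
    (hle : ∀ x, p x ≤ (2 : ℝ) ^ (-(Real.logb 2 (Fintype.card X) - 2 * ℓ))) :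
    nNorm2 p ≤ (2 : ℝ) ^ ℓ * nNorm1 p := by
  have hX : (0 : ℝ) < Fintype.card X := by exact_mod_cast Fintype.card_pos
  have hsq : ∑ x, p x ^ 2 ≤ (2 : ℝ) ^ (2 * ℓ) / Fintype.card X := by
    calc ∑ x, p x ^ 2 ≤ ∑ x, (2 : ℝ) ^ (2 * ℓ) / Fintype.card X * p x := by
          refine Finset.sum_le_sum fun x _ => ?_
          rw [sq, ← two_rpow_neg_logb_sub hX]
          exact mul_le_mul_of_nonneg_right (hle x) (hp x)
      _ = _ := by rw [← Finset.mul_sum, hsum, mul_one]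
  rw [nNorm1_eq_of_sum_eq_one hp hsum, nNorm2, expE]
  refine Real.sqrt_le_iff.2 ⟨by positivity, ?_⟩
  calc (∑ x, p x ^ 2) / (Fintype.card X : ℝ)
      ≤ (2 : ℝ) ^ (2 * ℓ) / Fintype.card X / Fintype.card X := by gcongr
    _ = _ := by
      rw [two_mul, Real.rpow_add two_pos]
      field_simp

/-- Splitting an average into its large and small terms. -/
lemma sum_mul_le_card_filter_mul_add {A : Type*} [Fintype A] {p u : A → ℝ} {c ε : ℝ}
    (hp : ∀ a, 0 ≤ p a) (hsum : ∑ a, p a = 1) (hpc : ∀ a, p a ≤ c) (hε : 0 ≤ ε)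
    (hu : ∀ a, u a ≤ 1) :
    ∑ a, p a * u a ≤ (Finset.univ.filter fun a => ε ≤ u a).card * c + ε := by
  calc ∑ a, p a * u a ≤ ∑ a, ((if ε ≤ u a then c else 0) + p a * ε) := by
        refine Finset.sum_le_sum fun a _ => ?_
        split_ifs with h
        · have h1 := mul_le_of_le_one_right (hp a) (hu a)
          have h2 := mul_nonneg (hp a) hε
          linarith [hpc a]
        · rw [zero_add]
          exact mul_le_mul_of_nonneg_left (not_le.1 h).le (hp a)
    _ = _ := by
      rw [Finset.sum_add_distrib, ← Finset.sum_mul, hsum, one_mul, ← Finset.sum_filter,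
        Finset.sum_const, nsmul_eq_mul]

/-- **Lemma (L₂-extractor implies L∞-extractor).**
If `M` is a `(k,ℓ)`-L₂-extractor with error `2^{-r}`, then for every
`0 < ξ < k`, `M` is a `(k-ξ, 2ℓ ∼ min{r,ξ}-1)`-L∞-extractor. -/
theorem l2Extractor_to_linfExtractor {A X : Type*} [Fintype A] [Fintype X]
    (M : A → X → ℝ) (hM : ∀ a x, M a x = 1 ∨ M a x = -1)
    (k ℓ r : ℝ) (hext : IsL2Extractor M k ℓ r) :
    ∀ ξ : ℝ, 0 < ξ → ξ < k →
      IsLinfExtractor M (k - ξ) (2 * ℓ) (min r ξ - 1) := by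
  intro ξ _ _ pa hpa hpa1 hpaM px hpx hpx1 hpxM
  have : Nonempty A := by
    by_contra h
    rw [not_nonempty_iff] at h
    simp at hpa1
  have : Nonempty X := by
    by_contra h
    rw [not_nonempty_iff] at h
    simp at hpx1
  have hA : (0 : ℝ) < Fintype.card A := by exact_mod_cast Fintype.card_pos
  have hX : (0 : ℝ) < Fintype.card X := by exact_mod_cast Fintype.card_pos
  have hpx0 : px ≠ 0 := by
    rintro rfl
    simp at hpx1
  have hcard := hext px hpx hpx0 (nNorm2_le_of_le_rpow hpx hpx1 hpxM)
  have hlarge : ∀ a, (2 : ℝ) ^ (-r) * nNorm1 px ≤ |nInner (M a) px| ↔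
      (2 : ℝ) ^ (-r) ≤ |∑ x, M a x * px x| := fun a => by
    rw [nNorm1_eq_of_sum_eq_one hpx hpx1, nInner, expE, abs_div, abs_of_pos hX, mul_one_div,
      div_le_div_iff_of_pos_right hX]
  simp only [hlarge] at hcard
  have hu : ∀ a, |∑ x, M a x * px x| ≤ 1 := fun a => by
    rw [← hpx1]
    refine (Finset.abs_sum_le_sum_abs _ _).trans (Finset.sum_le_sum fun x _ => ?_)
    rcases hM a x with h | h <;> simp [h, abs_of_nonneg (hpx x)]
  simp only [two_rpow_neg_logb_sub hA] at hpaM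
  have hr : (2 : ℝ) ^ (-r) ≤ 2 ^ (-min r ξ) :=
    Real.rpow_le_rpow_of_exponent_le one_le_two (neg_le_neg (min_le_left _ _))
  have hξ : (2 : ℝ) ^ (-ξ) ≤ 2 ^ (-min r ξ) :=
    Real.rpow_le_rpow_of_exponent_le one_le_two (neg_le_neg (min_le_right _ _))
  calc |∑ a, ∑ x, pa a * px x * M a x|
      ≤ ∑ a, |∑ x, pa a * px x * M a x| := Finset.abs_sum_le_sum_abs _ _
    _ = ∑ a, pa a * |∑ x, M a x * px x| := by
      refine Finset.sum_congr rfl fun a _ => ?_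
      rw [← abs_of_nonneg (hpa a), ← abs_mul, abs_of_nonneg (hpa a), Finset.mul_sum]
      simp only [mul_assoc, mul_comm (px _)]
    _ ≤ (Finset.univ.filter fun a => (2 : ℝ) ^ (-r) ≤ |∑ x, M a x * px x|).card *
          (2 ^ (k - ξ) / Fintype.card A) + 2 ^ (-r) :=
      sum_mul_le_card_filter_mul_add hpa hpa1 hpaM (by positivity) hu
    _ ≤ (2 : ℝ) ^ (-k) * Fintype.card A * (2 ^ (k - ξ) / Fintype.card A) + 2 ^ (-r) := by
      gcongr
    _ = (2 : ℝ) ^ (-ξ) + 2 ^ (-r) := by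
      rw [mul_assoc, mul_div_cancel₀ _ hA.ne', ← Real.rpow_add two_pos]
      congr 2
      ring
    _ ≤ 2 * (2 : ℝ) ^ (-min r ξ) := by linarith
    _ = (2 : ℝ) ^ (-(min r ξ - 1)) := by
      rw [neg_sub, sub_eq_add_neg, Real.rpow_add two_pos, Real.rpow_one]
end

section
/- There exist absolute constants c₁, c₂, c₃, C > 0 such that the following holds. If M : A × X → {-1,1} (A, X finite sets) is a (k,ℓ)-L₂-extractor with error 2^{-r} and k ≥ C, ℓ ≥ C, r ≥ C, then the transposed matrix Mᵗ : X × A → {-1,1}, defined by Mᵗ(x,a) = M(a,x), is a (c₁·ℓ, c₂·k)-L₂-extractor with error 2^{-c₃·min{r,k}}. -/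
open Finset

attribute [local instance] Classical.propDecidable

lemma nNorm1_of_nonneg {X : Type*} [Fintype X] {f : X → ℝ} (hf : ∀ x, 0 ≤ f x) :
    nNorm1 f = (∑ x, f x) / Fintype.card X := by
  simp only [nNorm1, expE, abs_of_nonneg (hf _)]

/-- Squared form of the `ℓ₂`-`ℓ₁` norm comparison. -/
lemma nNorm2_le_iff {X : Type*} [Fintype X] [Nonempty X] {f : X → ℝ} (hf : ∀ x, 0 ≤ f x)
    (ℓ : ℝ) : nNorm2 f ≤ (2 : ℝ) ^ ℓ * nNorm1 f ↔
      (∑ x, f x ^ 2) * Fintype.card X ≤ (2 : ℝ) ^ (2 * ℓ) * (∑ x, f x) ^ 2 := by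
  have hn : (0 : ℝ) < Fintype.card X := by exact_mod_cast Fintype.card_pos
  have hG : 0 ≤ ∑ x, f x := Finset.sum_nonneg fun x _ => hf x
  have hpow : (2 : ℝ) ^ (2 * ℓ) = ((2 : ℝ) ^ ℓ) ^ 2 := by
    rw [mul_comm, Real.rpow_mul (by norm_num)]; norm_num
  rw [nNorm1_of_nonneg hf, nNorm2, expE, Real.sqrt_le_left (by positivity), hpow,
    show ((2 : ℝ) ^ ℓ * ((∑ x, f x) / Fintype.card X)) ^ 2
      = (((2 : ℝ) ^ ℓ) ^ 2 * (∑ x, f x) ^ 2 / Fintype.card X) / Fintype.card X by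
        field_simp,
    div_le_div_iff_of_pos_right hn, le_div_iff₀ hn]

/-- An extractor applied to the indicator function of a set of density at least `2^{-2ℓ}`. -/
lemma IsL2Extractor.card_filter_sum_le {A X : Type*} [Fintype A] [Fintype X] {M : A → X → ℝ}
    {k ℓ r : ℝ} (h : IsL2Extractor M k ℓ r) {S : Finset X} (hS : S.Nonempty)
    (hcard : (2 : ℝ) ^ (-(2 * ℓ)) * Fintype.card X ≤ S.card) :
    ((univ.filter fun a => (2 : ℝ) ^ (-r) * S.card ≤ |∑ x ∈ S, M a x|).card : ℝ)
      ≤ (2 : ℝ) ^ (-k) * Fintype.card A := by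
  obtain ⟨x₀, hx₀⟩ := hS
  have : Nonempty X := ⟨x₀⟩
  have hn : (0 : ℝ) < Fintype.card X := by exact_mod_cast Fintype.card_pos
  set f : X → ℝ := fun x => if x ∈ S then 1 else 0 with hf
  have hf0 : ∀ x, 0 ≤ f x := fun x => by simp only [hf]; split_ifs <;> norm_num
  have hsum : ∑ x, f x = S.card := by simp [hf]
  have hsq : ∑ x, f x ^ 2 = S.card := by simp [hf, ite_pow]
  have hne : f ≠ 0 := fun h0 => by simpa [hf, hx₀] using congrFun h0 x₀
  have hnorm : nNorm2 f ≤ (2 : ℝ) ^ ℓ * nNorm1 f := by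
    rw [nNorm2_le_iff hf0, hsum, hsq]
    rw [Real.rpow_neg (by norm_num), inv_mul_le_iff₀ (by positivity)] at hcard
    have := mul_le_mul_of_nonneg_left hcard (Nat.cast_nonneg (α := ℝ) S.card)
    linarith
  convert h f hf0 hne hnorm using 4 with a
  have hin : nInner (M a) f = (∑ x ∈ S, M a x) / Fintype.card X := by
    simp [nInner, expE, hf]
  rw [nNorm1_of_nonneg hf0, hsum, hin, abs_div, abs_of_pos hn, ← mul_div_assoc,
    div_le_div_iff_of_pos_right hn]

/-- A function with small `ℓ₂`-norm relative to its `ℓ₁`-norm has little mass on a small set. -/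
lemma sum_le_of_nNorm2_le {A : Type*} [Fintype A] [Nonempty A] {g : A → ℝ} (hg : ∀ a, 0 ≤ g a)
    {k m : ℝ} (hnorm : nNorm2 g ≤ (2 : ℝ) ^ m * nNorm1 g) {T : Finset A}
    (hT : (T.card : ℝ) ≤ (2 : ℝ) ^ (-k) * Fintype.card A) :
    ∑ a ∈ T, g a ≤ (2 : ℝ) ^ (m - k / 2) * ∑ a, g a := by
  have hG : 0 ≤ ∑ a, g a := Finset.sum_nonneg fun a _ => hg a
  rw [nNorm2_le_iff hg] at hnorm
  refine (le_abs_self _).trans (abs_le_of_sq_le_sq ?_ (by positivity))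
  calc (∑ a ∈ T, g a) ^ 2 ≤ T.card * ∑ a ∈ T, g a ^ 2 := sq_sum_le_card_mul_sum_sq
    _ ≤ T.card * ∑ a, g a ^ 2 := by
      gcongr
      exact subset_univ T
    _ ≤ ((2 : ℝ) ^ (-k) * Fintype.card A) * ∑ a, g a ^ 2 := by gcongr
    _ = (2 : ℝ) ^ (-k) * ((∑ a, g a ^ 2) * Fintype.card A) := by ring
    _ ≤ (2 : ℝ) ^ (-k) * ((2 : ℝ) ^ (2 * m) * (∑ a, g a) ^ 2) := by gcongr
    _ = ((2 : ℝ) ^ (m - k / 2) * ∑ a, g a) ^ 2 := by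
      rw [mul_pow, ← mul_assoc, ← Real.rpow_add (by norm_num), ← Real.rpow_mul_natCast (by norm_num)]
      congr 2
      push_cast
      ring

/-- One-sided transpose bound: few columns correlate positively with `g`. -/
lemma IsL2Extractor.card_filter_le_nInner {A X : Type*} [Fintype A] [Fintype X]
    {M : A → X → ℝ} (hM : ∀ a x, |M a x| ≤ 1) {k ℓ r m ε : ℝ} (h : IsL2Extractor M k ℓ r)
    {g : A → ℝ} (hg : ∀ a, 0 ≤ g a) (hg0 : g ≠ 0)
    (hnorm : nNorm2 g ≤ (2 : ℝ) ^ m * nNorm1 g)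
    (hε : (2 : ℝ) ^ (-r) + (2 : ℝ) ^ (m - k / 2) < ε) :
    ((univ.filter fun x => ε * nNorm1 g ≤ nInner (fun a => M a x) g).card : ℝ)
      ≤ (2 : ℝ) ^ (-(2 * ℓ)) * Fintype.card X := by
  obtain ⟨a₀, ha₀⟩ := Function.ne_iff.mp hg0
  have : Nonempty A := ⟨a₀⟩
  have hN : (0 : ℝ) < Fintype.card A := by exact_mod_cast Fintype.card_pos
  have hG : 0 < ∑ a, g a :=
    Finset.sum_pos' (fun a _ => hg a) ⟨a₀, mem_univ _, (hg a₀).lt_of_ne' ha₀⟩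
  set S := univ.filter fun x => ε * nNorm1 g ≤ nInner (fun a => M a x) g with hSdef
  by_contra! hS
  have hs : (0 : ℝ) < S.card := lt_of_le_of_lt (by positivity) hS
  have hSne : S.Nonempty := Finset.card_pos.mp (by exact_mod_cast hs)
  have hT := h.card_filter_sum_le hSne hS.le
  set T := univ.filter fun a => (2 : ℝ) ^ (-r) * S.card ≤ |∑ x ∈ S, M a x| with hTdef
  have hTg := sum_le_of_nNorm2_le hg hnorm hT
  have hlow : S.card * (ε * ∑ a, g a) ≤ ∑ x ∈ S, ∑ a, M a x * g a := by
    rw [← nsmul_eq_mul]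
    refine Finset.card_nsmul_le_sum _ _ _ fun x hx => ?_
    have hx' := (Finset.mem_filter.mp hx).2
    rwa [nNorm1_of_nonneg hg, nInner, expE, ← mul_div_assoc,
      div_le_div_iff_of_pos_right hN] at hx'
  have hrow : ∀ a, ∑ x ∈ S, M a x ≤ S.card * ((2 : ℝ) ^ (-r) + if a ∈ T then 1 else 0) := by
    intro a
    split_ifs with ha
    · have : ∑ x ∈ S, M a x ≤ S.card := by
        simpa using Finset.sum_le_card_nsmul S (M a) 1 fun x _ => (le_abs_self _).trans (hM a x)
      have : 0 ≤ S.card * (2 : ℝ) ^ (-r) := by positivity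
      linarith
    · have ha' : |∑ x ∈ S, M a x| < (2 : ℝ) ^ (-r) * S.card := by simpa [hTdef] using ha
      linarith [le_abs_self (∑ x ∈ S, M a x)]
  have hup : ∑ x ∈ S, ∑ a, M a x * g a
      ≤ S.card * ((2 : ℝ) ^ (-r) * ∑ a, g a + ∑ a ∈ T, g a) := by
    calc ∑ x ∈ S, ∑ a, M a x * g a = ∑ a, (∑ x ∈ S, M a x) * g a := by
          rw [Finset.sum_comm]; simp only [Finset.sum_mul]
      _ ≤ ∑ a, S.card * ((2 : ℝ) ^ (-r) + if a ∈ T then 1 else 0) * g a :=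
          Finset.sum_le_sum fun a _ => mul_le_mul_of_nonneg_right (hrow a) (hg a)
      _ = S.card * ((2 : ℝ) ^ (-r) * ∑ a, g a + ∑ a ∈ T, g a) := by
          simp only [mul_assoc, ← Finset.mul_sum, add_mul, Finset.sum_add_distrib, ite_mul,
            one_mul, zero_mul, Finset.sum_ite_mem, univ_inter]
  have hle := le_of_mul_le_mul_left (hlow.trans hup) hs
  have := mul_lt_mul_of_pos_right hε hG
  linarith

lemma nInner_neg_left {X : Type*} [Fintype X] (f g : X → ℝ) :
    nInner (fun x => -f x) g = -nInner f g := by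
  simp [nInner, expE, neg_div]

lemma IsL2Extractor.neg {A X : Type*} [Fintype A] [Fintype X] {M : A → X → ℝ} {k ℓ r : ℝ}
    (h : IsL2Extractor M k ℓ r) : IsL2Extractor (fun a x => -M a x) k ℓ r := by
  simpa only [IsL2Extractor, nInner_neg_left, abs_neg] using h

/-- Transposition with explicit parameters. -/
lemma IsL2Extractor.transpose {A X : Type*} [Fintype A] [Fintype X] {M : A → X → ℝ}
    (hM : ∀ a x, |M a x| ≤ 1) {k ℓ r m s : ℝ} (h : IsL2Extractor M k ℓ r) (hℓ : 1 ≤ ℓ)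
    (hs : (2 : ℝ) ^ (-r) + (2 : ℝ) ^ (m - k / 2) < (2 : ℝ) ^ (-s)) :
    IsL2Extractor (fun x a => M a x) ℓ m s := by
  intro g hg hg0 hnorm
  have hpos := h.card_filter_le_nInner hM hg hg0 hnorm hs
  have hneg := h.neg.card_filter_le_nInner (by simpa using hM) hg hg0 hnorm hs
  simp only [nInner_neg_left] at hneg
  have hsub : (univ.filter fun x => (2 : ℝ) ^ (-s) * nNorm1 g ≤ |nInner (fun a => M a x) g|)
      ⊆ (univ.filter fun x => (2 : ℝ) ^ (-s) * nNorm1 g ≤ nInner (fun a => M a x) g)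
        ∪ univ.filter fun x => (2 : ℝ) ^ (-s) * nNorm1 g ≤ -nInner (fun a => M a x) g := by
    intro x
    simp [le_abs]
  have hcard : ((univ.filter fun x =>
      (2 : ℝ) ^ (-s) * nNorm1 g ≤ |nInner (fun a => M a x) g|).card : ℝ) ≤ _ :=
    Nat.cast_le.mpr ((Finset.card_le_card hsub).trans (Finset.card_union_le _ _))
  push_cast at hcard
  have hpow : 2 * (2 : ℝ) ^ (-(2 * ℓ)) ≤ (2 : ℝ) ^ (-ℓ) := by
    rw [← Real.rpow_one_add' (by norm_num) (by linarith)]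
    exact Real.rpow_le_rpow_of_exponent_le (by norm_num) (by linarith)
  have := mul_le_mul_of_nonneg_right hpow (Nat.cast_nonneg (α := ℝ) (Fintype.card X))
  linarith

/-- **Lemma (transpose).**
There are absolute constants `c₁, c₂, c₃, C > 0` such that: if `M` is a
`(k,ℓ)`-L₂-extractor with error `2^{-r}` and `k, ℓ, r ≥ C`, then the
transposed matrix `Mᵗ` is a `(c₁·ℓ, c₂·k)`-L₂-extractor with error
`2^{-c₃·min{r,k}}`. -/
theorem transpose_l2Extractor :
    ∃ c₁ c₂ c₃ C : ℝ, 0 < c₁ ∧ 0 < c₂ ∧ 0 < c₃ ∧ 0 < C ∧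
      ∀ (A X : Type) [Fintype A] [Fintype X] (M : A → X → ℝ),
        (∀ a x, M a x = 1 ∨ M a x = -1) →
        ∀ k ℓ r : ℝ, C ≤ k → C ≤ ℓ → C ≤ r →
          IsL2Extractor M k ℓ r →
          IsL2Extractor (fun (x : X) (a : A) => M a x)
            (c₁ * ℓ) (c₂ * k) (c₃ * min r k) := by
  refine ⟨1, 1 / 4, 1 / 8, 16, by norm_num, by norm_num, by norm_num, by norm_num, ?_⟩
  intro A X _ _ M hM k ℓ r hk hℓ hr h
  rw [one_mul]
  refine h.transpose (fun a x => by rcases hM a x with h | h <;> simp [h]) (by linarith) ?_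
  have key : ∀ t : ℝ, t ≤ -(1 / 8 * min r k) - 2 →
      (2 : ℝ) ^ t ≤ (2 : ℝ) ^ (-(1 / 8 * min r k)) / 4 := by
    intro t ht
    calc (2 : ℝ) ^ t ≤ (2 : ℝ) ^ (-(1 / 8 * min r k) - 2) :=
          Real.rpow_le_rpow_of_exponent_le (by norm_num) ht
      _ = (2 : ℝ) ^ (-(1 / 8 * min r k)) / 4 := by
          rw [Real.rpow_sub (by norm_num)]; norm_num
  have h₁ := key (-r) (by linarith [min_le_left r k])
  have h₂ := key (1 / 4 * k - k / 2) (by linarith [min_le_right r k])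
  have : (0 : ℝ) < (2 : ℝ) ^ (-(1 / 8 * min r k)) := by positivity
  linarith
end

section
/- Let A, X be finite sets and M : A × X → {-1,1} a matrix whose rows {M_a}_{a∈A} are (ε,δ)-almost orthogonal, where ε, δ > 0 and ε + δ^{1/2} < 1. Set γ = (ε + δ^{1/2})^{1/2}, k = (1/2)·log₂(1/δ), and ℓ = r = (1/2)·log₂(1/γ). Then M is a (k,ℓ)-L₂-extractor with error 2^{-r}: for every non-negative f : X → ℝ that is not identically zero and satisfies ‖f‖₂ ≤ 2^ℓ·‖f‖₁, there are at most 2^{-k}·|A| elements a ∈ A with |⟨M_a,f⟩| ≥ 2^{-r}·‖f‖₁. -/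
open Finset

attribute [local instance] Classical.propDecidable

/-- A family of `±1`-valued vectors `v i : X → ℝ` indexed by a finite set `I`
is `(ε,δ)`-almost orthogonal: for every `i` there are at most `δ·|I|` indices
`j` with `|⟨v i, v j⟩| > ε`. -/
def AlmostOrtho {I X : Type*} [Fintype I] [Fintype X]
    (v : I → X → ℝ) (ε δ : ℝ) : Prop :=
  ∀ i : I,
    ((Finset.univ.filter (fun j : I => ε < |nInner (v i) (v j)|)).card : ℝ)
      ≤ δ * (Fintype.card I : ℝ)

lemma nInner_comm {X : Type*} [Fintype X] (f g : X → ℝ) : nInner f g = nInner g f := by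
  simp only [nInner, mul_comm]

lemma nInner_sum_smul_left {A X : Type*} [Fintype X] (S : Finset A) (c : A → ℝ)
    (v : A → X → ℝ) (f : X → ℝ) :
    nInner (fun x => ∑ a ∈ S, c a * v a x) f = ∑ a ∈ S, c a * nInner (v a) f := by
  simp only [nInner, expE, Finset.sum_mul, ← mul_div_assoc, Finset.mul_sum, ← Finset.sum_div]
  rw [Finset.sum_comm]
  simp only [mul_assoc]

lemma nInner_sq_le {X : Type*} [Fintype X] (f g : X → ℝ) :
    nInner f g ^ 2 ≤ nInner f f * nInner g g := by
  have h := Finset.sum_mul_sq_le_sq_mul_sq Finset.univ f g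
  simp only [nInner, expE, div_pow, div_mul_div_comm, ← sq]
  gcongr

lemma abs_nInner_le_one {X : Type*} [Fintype X] {f g : X → ℝ}
    (hf : ∀ x, |f x| ≤ 1) (hg : ∀ x, |g x| ≤ 1) : |nInner f g| ≤ 1 := by
  simp only [nInner, expE, abs_div, Nat.abs_cast]
  refine div_le_one_of_le₀ ((Finset.abs_sum_le_sum_abs _ _).trans ?_) (Nat.cast_nonneg _)
  calc ∑ x, |f x * g x| ≤ ∑ _x : X, (1 : ℝ) := by
        gcongr with x
        rw [abs_mul]
        exact mul_le_one₀ (hf x) (abs_nonneg _) (hg x)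
    _ = _ := by simp

lemma nNorm2_sq {X : Type*} [Fintype X] (f : X → ℝ) : nNorm2 f ^ 2 = nInner f f := by
  rw [nNorm2, Real.sq_sqrt]
  · simp only [nInner, sq]
  · exact div_nonneg (Finset.sum_nonneg fun _ _ => sq_nonneg _) (Nat.cast_nonneg _)

/-- The square of a half power of two, in terms of the base-two logarithm. -/
lemma two_rpow_half_logb_sq {y : ℝ} (hy : 0 < y) :
    ((2 : ℝ) ^ (1 / 2 * Real.logb 2 y)) ^ 2 = y := by
  rw [← Real.rpow_natCast, ← Real.rpow_mul (by norm_num)]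
  convert Real.rpow_logb (b := 2) (by norm_num) (by norm_num) hy using 2
  push_cast
  ring

/-- In an almost orthogonal family of vectors bounded by one, the absolute inner products of a
vector with the members of a subfamily have a small sum. -/
lemma AlmostOrtho.sum_abs_nInner_le {I X : Type*} [Fintype I] [Fintype X] {v : I → X → ℝ}
    {ε δ : ℝ} (hv : AlmostOrtho v ε δ) (hε : 0 ≤ ε) (hb : ∀ i x, |v i x| ≤ 1)
    (S : Finset I) (i : I) :
    ∑ j ∈ S, |nInner (v i) (v j)| ≤ ε * #S + δ * Fintype.card I := by
  calc ∑ j ∈ S, |nInner (v i) (v j)|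
      ≤ ∑ j ∈ S, (ε + if ε < |nInner (v i) (v j)| then 1 else 0) := by
        gcongr with j
        split_ifs with h
        · linarith [abs_nInner_le_one (hb i) (hb j)]
        · linarith
    _ = ε * #S + ∑ j ∈ S, (if ε < |nInner (v i) (v j)| then (1 : ℝ) else 0) := by
        rw [Finset.sum_add_distrib, Finset.sum_const, nsmul_eq_mul, mul_comm]
    _ ≤ ε * #S + ∑ j, (if ε < |nInner (v i) (v j)| then (1 : ℝ) else 0) := by
        gcongr
        exact Finset.subset_univ S
    _ ≤ _ := by
        rw [Finset.sum_boole]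
        gcongr
        exact hv i

/-- A sum over a subfamily, with coefficients bounded by one, of an almost orthogonal family of
vectors bounded by one has a small square norm. -/
lemma AlmostOrtho.nInner_sum_self_le {I X : Type*} [Fintype I] [Fintype X] {v : I → X → ℝ}
    {ε δ : ℝ} (hv : AlmostOrtho v ε δ) (hε : 0 ≤ ε) (hb : ∀ i x, |v i x| ≤ 1)
    (S : Finset I) {c : I → ℝ} (hc : ∀ i, |c i| ≤ 1) :
    nInner (fun x => ∑ i ∈ S, c i * v i x) (fun x => ∑ i ∈ S, c i * v i x)
      ≤ #S * (ε * #S + δ * Fintype.card I) := by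
  rw [nInner_sum_smul_left]
  calc _ ≤ ∑ _i ∈ S, (ε * #S + δ * Fintype.card I) := by
        gcongr with i
        rw [nInner_comm, nInner_sum_smul_left, Finset.mul_sum]
        refine (Finset.sum_le_sum fun j _ => ?_).trans (hv.sum_abs_nInner_le hε hb S i)
        refine (le_abs_self _).trans ?_
        rw [abs_mul, abs_mul, nInner_comm (v j)]
        exact (mul_le_of_le_one_left (by positivity) (hc i)).trans
          (mul_le_of_le_one_left (abs_nonneg _) (hc j))
    _ = _ := by rw [Finset.sum_const, nsmul_eq_mul]

lemma abs_signType_cast_le_one (s : SignType) : |(s : ℝ)| ≤ 1 := by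
  cases s <;> simp

/-- **Lemma (almost orthogonal rows give an L₂-extractor).**
If the rows of `M : A × X → {-1,1}` are `(ε,δ)`-almost orthogonal with
`ε, δ > 0` and `ε + δ^{1/2} < 1`, then, setting `γ = (ε + δ^{1/2})^{1/2}`,
`k = ½·log₂(1/δ)` and `ℓ = r = ½·log₂(1/γ)`, the matrix `M` is a
`(k,ℓ)`-L₂-extractor with error `2^{-r}`. -/
theorem almostOrtho_l2Extractor {A X : Type*} [Fintype A] [Fintype X]
    (M : A → X → ℝ) (hM : ∀ a x, M a x = 1 ∨ M a x = -1)
    (ε δ : ℝ) (hε : 0 < ε) (hδ : 0 < δ)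
    (hsum : ε + Real.sqrt δ < 1)
    (hortho : AlmostOrtho M ε δ) :
    IsL2Extractor M (1 / 2 * Real.logb 2 (1 / δ))
      (1 / 2 * Real.logb 2 (1 / Real.sqrt (ε + Real.sqrt δ)))
      (1 / 2 * Real.logb 2 (1 / Real.sqrt (ε + Real.sqrt δ))) := by
  intro f _ hf hnorm
  set γ := Real.sqrt (ε + Real.sqrt δ)
  have hγ : 0 < γ := Real.sqrt_pos.mpr (by positivity)
  have hγ2 : γ ^ 2 = ε + √δ := Real.sq_sqrt (by positivity)
  have hδ2 : √δ ^ 2 = δ := Real.sq_sqrt hδ.le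
  have hk : (2 : ℝ) ^ (-(1 / 2 * Real.logb 2 (1 / δ))) = √δ := by
    rw [← Real.sqrt_sq (Real.rpow_nonneg zero_le_two _), ← mul_neg, one_div δ, Real.logb_inv,
      neg_neg, two_rpow_half_logb_sq hδ]
  have hr : ((2 : ℝ) ^ (-(1 / 2 * Real.logb 2 (1 / γ)))) ^ 2 = γ := by
    rw [← mul_neg, one_div γ, Real.logb_inv, neg_neg, two_rpow_half_logb_sq hγ]
  have hl := two_rpow_half_logb_sq (one_div_pos.mpr hγ)
  have hρ : 0 < (2 : ℝ) ^ (-(1 / 2 * Real.logb 2 (1 / γ))) := by positivity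
  rw [hk]
  generalize (2 : ℝ) ^ (-(1 / 2 * Real.logb 2 (1 / γ))) = ρ at hr hρ ⊢
  generalize (2 : ℝ) ^ (1 / 2 * Real.logb 2 (1 / γ)) = L at hnorm hl
  by_contra! hS
  set S := Finset.univ.filter (fun a : A => ρ * nNorm1 f ≤ |nInner (M a) f|)
  have hn : 0 < nNorm1 f := nNorm1_pos hf
  have hT : (0 : ℝ) < #S := lt_of_le_of_lt (by positivity) hS
  have hb : ∀ a x, |M a x| ≤ 1 := fun a x => by rcases hM a x with h | h <;> simp [h]
  set c : A → ℝ := fun a => (SignType.sign (nInner (M a) f) : ℝ) with hc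
  set g : X → ℝ := fun x => ∑ a ∈ S, c a * M a x
  have hgg : nInner g g < (#S * γ) ^ 2 := by
    refine (hortho.nInner_sum_self_le hε.le hb S fun a => abs_signType_cast_le_one _).trans_lt ?_
    calc (#S : ℝ) * (ε * #S + δ * Fintype.card A)
        = #S * (ε * #S + √δ * (√δ * Fintype.card A)) := by rw [← mul_assoc √δ, ← sq, hδ2]
      _ < #S * (ε * #S + √δ * #S) := by
          have := Real.sqrt_pos.mpr hδ
          gcongr
      _ = (#S * γ) ^ 2 := by rw [mul_pow, hγ2]; ring
  have hgf : #S * (ρ * nNorm1 f) ≤ nInner g f := by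
    rw [nInner_sum_smul_left, ← nsmul_eq_mul]
    refine Finset.card_nsmul_le_sum _ _ _ fun a ha => ?_
    rw [hc, sign_mul_self]
    exact (Finset.mem_filter.mp ha).2
  have hff : nInner f f ≤ 1 / γ * nNorm1 f ^ 2 := by
    rw [← nNorm2_sq, ← hl, ← mul_pow]
    exact pow_le_pow_left₀ (Real.sqrt_nonneg _) hnorm 2
  refine lt_irrefl ((#S : ℝ) ^ 2 * γ * nNorm1 f ^ 2) ?_
  calc (#S : ℝ) ^ 2 * γ * nNorm1 f ^ 2 = (#S * (ρ * nNorm1 f)) ^ 2 := by rw [← hr]; ring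
    _ ≤ nInner g f ^ 2 := by gcongr
    _ ≤ nInner g g * nInner f f := nInner_sq_le g f
    _ ≤ nInner g g * (1 / γ * nNorm1 f ^ 2) :=
        mul_le_mul_of_nonneg_left hff (nNorm2_sq g ▸ sq_nonneg _)
    _ < (#S * γ) ^ 2 * (1 / γ * nNorm1 f ^ 2) := by gcongr
    _ = (#S : ℝ) ^ 2 * γ * nNorm1 f ^ 2 := by field_simp
end

section
/- Let A, X be finite sets, n = log₂|X|, M : A × X → {-1,1}, and let ℓ, r, r' > 0 be reals. Let P be a probability distribution on X with ∑_{x∈X} P(x)² ≤ 2^{2ℓ}·2^{-n}, and let a ∈ A satisfy |∑_{x∈X} M(a,x)·P(x)| ≤ 2^{-r'}. Then for each b ∈ {-1,1}, ∑ P(x), summed over those x ∈ X with P(x) ≤ 2^{2ℓ+2r}·2^{-n} and M(a,x) = b, is at least 1/2 − 2^{-r'} − 2^{-2r}. -/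
open Finset

attribute [local instance] Classical.propDecidable

/-- A function with small second moment has little mass above a threshold: restricting a sum
to `{x | P x ≤ T}` loses at most `(∑ x, P x ^ 2) / T`. -/
theorem sum_filter_le_sum_filter_le_add {X : Type*} [Fintype X] (P : X → ℝ)
    (hP : ∀ x, 0 ≤ P x) (p : X → Prop) {T : ℝ} (hT : 0 < T) :
    ∑ x ∈ univ.filter p, P x
      ≤ ∑ x ∈ univ.filter (fun x => P x ≤ T ∧ p x), P x + (∑ x, P x ^ 2) / T := by
  rw [sum_filter, sum_filter, sum_div, ← sum_add_distrib]
  refine sum_le_sum fun x _ => ?_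
  have hx := hP x
  have hsq : 0 ≤ P x ^ 2 / T := by positivity
  by_cases hp : p x
  · by_cases hle : P x ≤ T
    · simpa [hp, hle] using hsq
    · simp only [hp, hle, if_true, if_false, false_and, zero_add]
      rw [le_div_iff₀ hT]
      nlinarith
  · simpa [hp] using hsq

/-- The mass of a level set of a sign function in terms of its correlation with `P`. -/
theorem sum_filter_sign_eq {X : Type*} [Fintype X] (f P : X → ℝ)
    (hf : ∀ x, f x = 1 ∨ f x = -1) {b : ℝ} (hb : b = 1 ∨ b = -1) :
    ∑ x ∈ univ.filter (fun x => f x = b), P x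
      = (∑ x, P x + b * ∑ x, f x * P x) / 2 := by
  rw [sum_filter, mul_sum, ← sum_add_distrib, sum_div]
  refine sum_congr rfl fun x _ => ?_
  rcases hf x with h | h <;> rcases hb with rfl | rfl <;> norm_num [h]

/-- **Claim (normalization factor of edge distributions).**
Let `n = log₂|X|`, let `P` be a probability distribution on `X` with
`∑_x P(x)² ≤ 2^{2ℓ}·2^{-n}`, and let `a ∈ A` satisfy
`|∑_x M(a,x)·P(x)| ≤ 2^{-r'}`.  Then for each `b ∈ {-1,1}`, the sum of `P(x)`
over those `x` with `P(x) ≤ 2^{2ℓ+2r}·2^{-n}` and `M(a,x) = b` is at least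
`1/2 - 2^{-r'} - 2^{-2r}`. -/
theorem edge_normalization {A X : Type*} [Fintype A] [Fintype X]
    (M : A → X → ℝ) (hM : ∀ a x, M a x = 1 ∨ M a x = -1)
    (ℓ r r' : ℝ) (hℓ : 0 < ℓ) (hr : 0 < r) (hr' : 0 < r')
    (P : X → ℝ) (hP0 : ∀ x, 0 ≤ P x) (hP1 : (∑ x, P x) = 1)
    (hP2 : (∑ x, (P x) ^ 2)
      ≤ (2 : ℝ) ^ (2 * ℓ) * (2 : ℝ) ^ (-(Real.logb 2 (Fintype.card X))))
    (a : A) (ha : |∑ x, M a x * P x| ≤ (2 : ℝ) ^ (-r')) :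
    ∀ b : ℝ, b = 1 ∨ b = -1 →
      1 / 2 - (2 : ℝ) ^ (-r') - (2 : ℝ) ^ (-(2 * r))
        ≤ ∑ x ∈ Finset.univ.filter (fun x : X =>
            P x ≤ (2 : ℝ) ^ (2 * ℓ + 2 * r)
                * (2 : ℝ) ^ (-(Real.logb 2 (Fintype.card X)))
            ∧ M a x = b), P x := by
  intro b hb
  have hs : (0 : ℝ) < (2 : ℝ) ^ (-(Real.logb 2 (Fintype.card X))) := by positivity
  generalize (2 : ℝ) ^ (-(Real.logb 2 (Fintype.card X))) = s at *
  have hT : (0 : ℝ) < (2 : ℝ) ^ (2 * ℓ + 2 * r) * s := by positivity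
  have htail : (∑ x, P x ^ 2) / ((2 : ℝ) ^ (2 * ℓ + 2 * r) * s) ≤ (2 : ℝ) ^ (-(2 * r)) := by
    rw [div_le_iff₀ hT, ← mul_assoc, ← Real.rpow_add two_pos, add_comm (2 * ℓ), neg_add_cancel_left]
    exact hP2
  have hlevel := sum_filter_le_sum_filter_le_add P hP0 (fun x => M a x = b) hT
  rw [sum_filter_sign_eq (M a) P (hM a) hb, hP1] at hlevel
  have hcorr : -(2 : ℝ) ^ (-r') ≤ b * ∑ x, M a x * P x := by
    have h := abs_le.mp ha
    rcases hb with rfl | rfl <;> linarith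
  have hpos : (0 : ℝ) < (2 : ℝ) ^ (-r') := by positivity
  linarith
end
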